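/- Let q be an odd prime and m ≥ 0 an integer such that 3 ≤ q^m ≤ 501. If x, y are coprime positive integers and p is an odd prime with x² + q^(2m) = 2·y^p, then (x, y, q, m, p) is one of the following fifteen tuples: (3,5,79,1,5), (9,5,13,1,3), (13,5,3,2,3), (55,13,37,1,3), (79,5,3,1,5), (99,17,5,1,3), (161,25,73,1,3), (249,5,307,1,7), (351,41,11,2,3), (545,53,3,3,3), (649,61,181,1,3), (1665,113,337,1,3), (2431,145,433,1,3), (5291,241,19,1,3), (275561,3361,71,1,3). -/

import Mathlib

/-- `δ₄ = 1` if `p ≡ 1 (mod 4)` and `δ₄ = -1` if `p ≡ 3 (mod 4)`. -/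
def d4 (p : ℕ) : ℤ := if p % 4 = 1 then 1 else -1

/-- `δ₈ = 1` if `p ≡ 1, 3 (mod 8)` and `δ₈ = -1` if `p ≡ 5, 7 (mod 8)`. -/
def d8 (p : ℕ) : ℤ := if p % 8 = 1 ∨ p % 8 = 3 then 1 else -1

/-- `F_p(u,v) = Re((1+i)(u+iv)^p)`. -/
def Ffun (p : ℕ) (u v : ℤ) : ℤ :=
  ((⟨1, 1⟩ : GaussianInt) * (⟨u, v⟩ : GaussianInt) ^ p).re

/-- `G_p(u,v) = Im((1+i)(u+iv)^p)`. -/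
def Gfun (p : ℕ) (u v : ℤ) : ℤ :=
  ((⟨1, 1⟩ : GaussianInt) * (⟨u, v⟩ : GaussianInt) ^ p).im

/-- `H_p(u,v) = G_p(u,v)/(u + δ₄ v)` (exact division whenever `u + δ₄ v ≠ 0`). -/
def Hfun (p : ℕ) (u v : ℤ) : ℤ := Gfun p u v / (u + d4 p * v)


theorem taylor_rem (f : ℂ → ℂ) (hf : Differentiable ℂ f) (N : ℕ) :
    ∃ (c : ℕ → ℂ) (g : ℂ → ℂ), Differentiable ℂ g ∧
      ∀ w, f w = ∑ n ∈ Finset.range N, c n * w ^ n + w ^ N * g w := by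
  induction N with
  | zero => exact ⟨fun _ => 0, f, hf, by simp⟩
  | succ N ih =>
    obtain ⟨c, g, hg, h⟩ := ih
    refine ⟨fun n => if n = N then g 0 else c n, dslope g 0, ?_, ?_⟩
    · rw [← differentiableOn_univ] at hg ⊢
      exact (Complex.differentiableOn_dslope Filter.univ_mem).2 hg
    · intro w
      have h1 : g w = g 0 + w * dslope g 0 w := by
        have := sub_smul_dslope g 0 w
        simp only [sub_zero, smul_eq_mul] at this
        rw [this]; ring
      rw [h w, Finset.sum_range_succ]
      have h2 : ∑ n ∈ Finset.range N, (if n = N then g 0 else c n) * w ^ n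
          = ∑ n ∈ Finset.range N, c n * w ^ n := by
        apply Finset.sum_congr rfl
        intro n hn
        rw [if_neg (by have := Finset.mem_range.1 hn; omega)]
      rw [h2]
      simp only [if_true]
      conv_lhs => rw [h1]
      ring

theorem det_bound {N : ℕ} (A : Matrix (Fin N) (Fin N) ℂ) (F : Fin N → ℝ)
    (h : ∀ i j, ‖A i j‖ ≤ F i) : ‖A.det‖ ≤ (N.factorial : ℝ) * ∏ i, F i := by
  rw [← Matrix.det_transpose, Matrix.det_apply]
  refine (norm_sum_le _ _).trans ?_
  have : ∀ σ ∈ (Finset.univ : Finset (Equiv.Perm (Fin N))),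
      ‖Equiv.Perm.sign σ • ∏ i, A.transpose (σ i) i‖ ≤ ∏ i, F i := by
    intro σ _
    have h1 : ‖Equiv.Perm.sign σ • ∏ i, A.transpose (σ i) i‖ = ∏ i, ‖A i (σ i)‖ := by
      rcases Int.units_eq_one_or (Equiv.Perm.sign σ) with h | h <;>
        simp [h, Matrix.transpose_apply]
    rw [h1]
    exact Finset.prod_le_prod (fun i _ => norm_nonneg _) (fun i _ => h i _)
  refine (Finset.sum_le_card_nsmul _ _ _ this).trans ?_
  simp [Fintype.card_perm]

theorem interp_det {N : ℕ} (f : Fin N → ℂ → ℂ) (hf : ∀ i, Differentiable ℂ (f i))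
    (x : Fin N → ℂ) (hx : Function.Injective x) (η : Fin N → Fin N → ℂ) (E : ℝ) (hE : 1 ≤ E)
    (F : Fin N → ℝ)
    (hF : ∀ i j z, ‖z‖ = E → ‖f i (z * x j)‖ + E ^ N * ‖η i j‖ ≤ F i) :
    ‖(Matrix.of fun i j => f i (x j) + η i j).det‖ * E ^ (N * (N - 1) / 2)
      ≤ (N.factorial : ℝ) * ∏ i, F i := by
  choose c g hg hfg using fun i => taylor_rem (f i) (hf i) N
  set X : Matrix (Fin N) (Fin N) ℂ := (Matrix.vandermonde x).transpose with hX
  have hXdet : X.det ≠ 0 := by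
    rw [hX, Matrix.det_transpose]
    exact Matrix.det_vandermonde_ne_zero_iff.2 hx
  have hXu : IsUnit X.det := isUnit_iff_ne_zero.2 hXdet
  set C : Matrix (Fin N) (Fin N) ℂ := Matrix.of fun i n => c i n with hC
  let G : ℂ → Matrix (Fin N) (Fin N) ℂ := fun z => Matrix.of fun i j =>
    x j ^ N * g i (z * x j) + η i j
  let Dg : ℂ → Matrix (Fin N) (Fin N) ℂ := fun z => Matrix.diagonal fun n : Fin N => z ^ (n : ℕ)
  let Dc : ℂ → Matrix (Fin N) (Fin N) ℂ := fun z => Matrix.diagonal fun n : Fin N => z ^ (N - n : ℕ)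
  let A : ℂ → Matrix (Fin N) (Fin N) ℂ := fun z => Matrix.of fun i j =>
    f i (z * x j) + z ^ N * η i j
  let H : ℂ → ℂ := fun z => (C + G z * X⁻¹ * Dc z).det * X.det
  have hA : ∀ z, A z = (C + G z * X⁻¹ * Dc z) * Dg z * X := by
    intro z
    have h1 : Dc z * Dg z = (z ^ N) • (1 : Matrix (Fin N) (Fin N) ℂ) := by
      simp only [Dc, Dg, Matrix.diagonal_mul_diagonal]
      rw [← Matrix.diagonal_one, ← Matrix.diagonal_smul]
      congr 1
      funext n
      rw [← pow_add]
      have := n.2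
      simp only [Pi.smul_apply, smul_eq_mul, mul_one]
      congr 1
      omega
    have h2 : (C + G z * X⁻¹ * Dc z) * Dg z * X = C * Dg z * X + z ^ N • G z := by
      rw [add_mul, add_mul, mul_assoc (G z * X⁻¹), h1]
      congr 1
      rw [Matrix.mul_smul, Matrix.mul_one, Matrix.smul_mul, mul_assoc, Matrix.nonsing_inv_mul _ hXu,
        mul_one]
    rw [h2]
    ext i j
    simp only [A, G, Dg, Matrix.of_apply, Matrix.add_apply, Matrix.smul_apply, smul_eq_mul]
    rw [hfg i (z * x j), Matrix.mul_apply, Finset.sum_range]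
    simp only [Matrix.mul_diagonal, hC, Matrix.of_apply, hX, Matrix.transpose_apply,
      Matrix.vandermonde_apply]
    have : ∀ n : Fin N, c i n * (z * x j) ^ (n : ℕ) = c i n * z ^ (n : ℕ) * x j ^ (n : ℕ) := by
      intro n; rw [mul_pow]; ring
    rw [Finset.sum_congr rfl (fun n _ => this n)]
    rw [mul_pow]; ring
  have hdet : ∀ z, (A z).det = z ^ (N * (N - 1) / 2) * H z := by
    intro z
    rw [hA, Matrix.det_mul, Matrix.det_mul]
    have : (Dg z).det = z ^ (N * (N - 1) / 2) := by
      simp only [Dg, Matrix.det_diagonal]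
      rw [Finset.prod_pow_eq_pow_sum, ← Finset.sum_range_id, Finset.sum_range]
    rw [this]; simp only [H]; ring
  have hH : Differentiable ℂ H := by
    refine Differentiable.mul ?_ (differentiable_const _)
    have hent : ∀ i j, Differentiable ℂ fun z => (C + G z * X⁻¹ * Dc z) i j := by
      intro i j
      simp only [Matrix.add_apply, Dc, Matrix.mul_diagonal]
      simp only [Matrix.mul_apply, G, Matrix.of_apply]
      have : ∀ k : Fin N, Differentiable ℂ fun z => g i (z * x k) := fun k =>
        (hg i).comp (differentiable_id.mul_const _)
      fun_prop
    simp only [Matrix.det_apply]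
    refine Differentiable.fun_sum fun σ _ => ?_
    refine Differentiable.const_smul ?_ _
    exact Differentiable.fun_finsetProd fun i _ => hent _ _
  have hE0 : 0 < E := by linarith
  set T := (N.factorial : ℝ) * ∏ i, F i with hT
  have hbd : ∀ z, ‖z‖ = E → ‖H z‖ ≤ T / E ^ (N * (N - 1) / 2) := by
    intro z hz
    rw [le_div_iff₀ (by positivity)]
    have h1 : ‖(A z).det‖ ≤ T := by
      apply det_bound
      intro i j
      refine (norm_add_le _ _).trans ?_
      rw [norm_mul, norm_pow, hz]
      exact hF i j z hz
    rw [hdet, norm_mul, norm_pow, hz] at h1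
    linarith
  have h1 : ‖H 1‖ ≤ T / E ^ (N * (N - 1) / 2) := by
    refine Complex.norm_le_of_forall_mem_frontier_norm_le (U := Metric.ball 0 E)
      Metric.isBounded_ball hH.diffContOnCl ?_ ?_
    · intro z hz
      rw [frontier_ball _ hE0.ne'] at hz
      exact hbd z (by simpa using hz)
    · rw [closure_ball _ hE0.ne']
      simpa using hE
  have h2 : (Matrix.of fun i j => f i (x j) + η i j) = A 1 := by
    ext i j; simp [A]
  rw [h2, hdet, one_pow, one_mul]
  rwa [le_div_iff₀ (by positivity)] at h1
open Polynomial in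
theorem coeff_det_top {n : ℕ} (P : Matrix (Fin n) (Fin n) ℂ[X]) (D : ℕ)
    (h : ∀ i j, (P i j).natDegree ≤ D) :
    P.det.coeff (n * D) = (P.map fun q => q.coeff D).det ∧ P.det.natDegree ≤ n * D := by
  have hprod : ∀ σ : Equiv.Perm (Fin n), (∏ i, P (σ i) i).coeff (n * D) = ∏ i, (P (σ i) i).coeff D := by
    intro σ
    have := Polynomial.coeff_prod_of_natDegree_le (s := Finset.univ) (f := fun i => P (σ i) i) D
      (fun i _ => h _ _)
    simpa using this
  constructor
  · rw [Matrix.det_apply, Matrix.det_apply, Polynomial.finsetSum_coeff]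
    refine Finset.sum_congr rfl fun σ _ => ?_
    rcases Int.units_eq_one_or (Equiv.Perm.sign σ) with hs | hs <;>
      simp [hs, hprod σ]
  · rw [Matrix.det_apply]
    refine Polynomial.natDegree_sum_le_of_forall_le _ _ fun σ _ => ?_
    have h1 : (∏ i, P (σ i) i).natDegree ≤ n * D := by
      refine (Polynomial.natDegree_prod_le _ _).trans ?_
      refine (Finset.sum_le_card_nsmul _ _ D fun i _ => h _ _).trans ?_
      simp
    rcases Int.units_eq_one_or (Equiv.Perm.sign σ) with hs | hs <;>
      simpa [hs] using h1

open Polynomial in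
theorem zero_est (K L R2 S : ℕ) (hK : 1 ≤ K) (hL : 1 ≤ L) (hKL : K * L ≤ R2 * S) (ξ : ℂ)
    (hξ0 : ξ ≠ 0) (hξ : ∀ n, 1 ≤ n → n < L → ξ ^ n ≠ 1) (κ T : ℂ)
    (hinj : ∀ r < R2, ∀ σ < S, ∀ r' < R2, ∀ σ' < S, κ * (r : ℂ) + T * (σ : ℂ) = κ * (r' : ℂ) + T * (σ' : ℂ) →
      r = r' ∧ σ = σ')
    (Q : Fin L → ℂ[X]) (hQ : ∀ b, (Q b).natDegree < K)
    (hz : ∀ r < R2 + L, ∀ σ < S, ∑ b : Fin L, (Q b).eval (κ * (r : ℂ) + T * (σ : ℂ)) * ξ ^ ((b : ℕ) * r) = 0) :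
    ∀ b, Q b = 0 := by
  classical
  by_contra! hne
  obtain ⟨b0, hb0⟩ := hne
  set B : Finset (Fin L) := Finset.univ.filter fun b => Q b ≠ 0 with hB
  set n := B.card with hn
  have hnL : n ≤ L := by
    have := Finset.card_le_univ B
    simpa using this
  have hn1 : 1 ≤ n := Finset.card_pos.2 ⟨b0, by simp [hB, hb0]⟩
  let e : Fin n ≃ B := (B.equivFin).symm
  let β : Fin n → Fin L := fun k => (e k : Fin L)
  have hβinj : Function.Injective β := fun k k' h => e.injective (Subtype.ext h)
  have hβne : ∀ k, Q (β k) ≠ 0 := fun k => by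
    exact (Finset.mem_filter.1 (e k).2).2
  have hsum : ∀ F : Fin L → ℂ, (∀ b, Q b = 0 → F b = 0) → ∑ b, F b = ∑ k, F (β k) := by
    intro F hF
    have h1 : ∑ k, F (β k) = ∑ b : B, F b := e.sum_comp (fun b : B => F b)
    rw [h1, Finset.sum_coe_sort B F]
    symm
    apply Finset.sum_subset (Finset.subset_univ _)
    intro b _ hb
    apply hF
    by_contra h
    exact hb (by simp [hB, h])
  set D := K - 1 with hD
  have hdeg : ∀ b, (Q b).natDegree ≤ D := fun b => by have := hQ b; omega
  have hcdeg : ∀ (b : Fin L) (u : ℂ), ((Q b).comp (X + C u)).natDegree = (Q b).natDegree := by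
    intro b u
    rw [natDegree_comp, natDegree_X_add_C, mul_one]
  let M : Matrix (Fin n) (Fin n) ℂ[X] := Matrix.of fun r k =>
    C (ξ ^ ((β k : ℕ) * (r : ℕ))) * (Q (β k)).comp (X + C (κ * ((r : ℕ) : ℂ)))
  have hMdeg : ∀ i j, (M i j).natDegree ≤ D := by
    intro i j
    simp only [M, Matrix.of_apply]
    refine (natDegree_C_mul_le _ _).trans ?_
    rw [hcdeg]; exact hdeg _
  have hMnd : M.det.natDegree ≤ n * D := (coeff_det_top M D hMdeg).2
  have hM0 : M.det ≠ 0 := by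
    intro h0
    let P : Matrix (Fin n) (Fin n) ℂ[X] := Matrix.of fun r k =>
      X ^ (D - (Q (β k)).natDegree) * M r k
    have hP : P.det = 0 := by
      have := Matrix.det_mul_row (fun k => (X : ℂ[X]) ^ (D - (Q (β k)).natDegree)) M
      simp only [P]
      rw [this, h0, mul_zero]
    have hPdeg : ∀ i j, (P i j).natDegree ≤ D := by
      intro i j
      simp only [P, M, Matrix.of_apply]
      refine natDegree_mul_le.trans ?_
      rw [natDegree_X_pow]
      have h1 := natDegree_C_mul_le (ξ ^ ((β j : ℕ) * (i : ℕ))) ((Q (β j)).comp (X + C (κ * ((i : ℕ) : ℂ))))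
      rw [hcdeg] at h1
      have := hdeg (β j)
      omega
    have h1 := (coeff_det_top P D hPdeg).1
    rw [hP, coeff_zero] at h1
    have h2 : (P.map fun q => q.coeff D) = Matrix.of fun r k : Fin n =>
        (Q (β k)).leadingCoeff * (Matrix.vandermonde fun k : Fin n => ξ ^ (β k : ℕ)).transpose r k := by
      ext r k
      simp only [Matrix.map_apply, P, M, Matrix.of_apply, Matrix.transpose_apply, Matrix.vandermonde_apply]
      have h3 : D = (Q (β k)).natDegree + (D - (Q (β k)).natDegree) := by have := hdeg (β k); omega
      conv_lhs => rw [h3]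
      rw [show (Q (β k)).natDegree + (D - (Q (β k)).natDegree) - (Q (β k)).natDegree = D - (Q (β k)).natDegree by omega]
      rw [coeff_X_pow_mul, coeff_C_mul]
      have h4 : ((Q (β k)).comp (X + C (κ * ((r : ℕ) : ℂ)))).coeff (Q (β k)).natDegree = (Q (β k)).leadingCoeff := by
        conv_lhs => rw [← hcdeg (β k) (κ * ((r : ℕ) : ℂ))]
        rw [coeff_natDegree, leadingCoeff_comp (by rw [natDegree_X_add_C]; norm_num),
          leadingCoeff_X_add_C, one_pow, mul_one]
      rw [h4, pow_mul]; ring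
    rw [h2, Matrix.det_mul_row, Matrix.det_transpose] at h1
    symm at h1
    rcases mul_eq_zero.1 h1 with h | h
    · rw [Finset.prod_eq_zero_iff] at h
      obtain ⟨k, _, hk⟩ := h
      exact hβne k (leadingCoeff_eq_zero.1 hk)
    · refine (Matrix.det_vandermonde_ne_zero_iff.2 ?_) h
      have key : ∀ a b : ℕ, a < b → b < L → ξ ^ a ≠ ξ ^ b := by
        intro a b hab hb heq
        apply hξ (b - a) (by omega) (by omega)
        have : ξ ^ b = ξ ^ a * ξ ^ (b - a) := by rw [← pow_add]; congr 1; omega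
        rw [this] at heq
        exact (mul_right_eq_self₀.1 heq.symm).resolve_right (pow_ne_zero _ hξ0)
      intro k k' hkk
      apply hβinj
      apply Fin.ext
      rcases lt_trichotomy (β k : ℕ) (β k' : ℕ) with h | h | h
      · exact absurd hkk (key _ _ h (β k').2)
      · exact h
      · exact absurd hkk.symm (key _ _ h (β k).2)
  apply hM0
  refine Polynomial.eq_zero_of_natDegree_lt_card_of_eval_eq_zero (ι := Fin R2 × Fin S) M.det
    (f := fun q => κ * ((q.1 : ℕ) : ℂ) + T * ((q.2 : ℕ) : ℂ)) ?_ ?_ ?_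
  · rintro ⟨r, σ⟩ ⟨r', σ'⟩ h
    obtain ⟨h1, h2⟩ := hinj r r.2 σ σ.2 r' r'.2 σ' σ'.2 h
    exact Prod.ext (Fin.ext h1) (Fin.ext h2)
  · rintro ⟨r, σ⟩
    have : eval (κ * ((r : ℕ) : ℂ) + T * ((σ : ℕ) : ℂ)) M.det
        = (M.map (evalRingHom (κ * ((r : ℕ) : ℂ) + T * ((σ : ℕ) : ℂ)))).det := by
      rw [← coe_evalRingHom, RingHom.map_det]; rfl
    simp only
    rw [this]
    apply Matrix.exists_mulVec_eq_zero_iff.1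
    refine ⟨fun k => ξ ^ ((β k : ℕ) * (r : ℕ)), ?_, ?_⟩
    · intro h
      have := congrFun h ⟨0, hn1⟩
      simp [hξ0] at this
    · funext r1
      simp only [Matrix.mulVec, dotProduct, Matrix.map_apply, M, Matrix.of_apply, Pi.zero_apply,
        coe_evalRingHom]
      have h1 := hz ((r : ℕ) + (r1 : ℕ)) (by have := r.2; have := r1.2; omega) σ σ.2
      rw [hsum _ (by intro b hb; simp [hb])] at h1
      rw [← h1]
      refine Finset.sum_congr rfl fun k _ => ?_
      rw [eval_mul, eval_C, eval_comp, eval_add, eval_X, eval_C]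
      rw [mul_add, pow_add]
      push_cast
      rw [show κ * ((r : ℕ) : ℂ) + T * ((σ : ℕ) : ℂ) + κ * ((r1 : ℕ) : ℂ)
        = κ * (((r : ℕ) : ℂ) + ((r1 : ℕ) : ℂ)) + T * ((σ : ℕ) : ℂ) by ring]
      ring
  · simp only [Fintype.card_prod, Fintype.card_fin]
    have h1 : n * D ≤ L * D := Nat.mul_le_mul_right _ hnL
    have h2 : L * D < K * L := by
      rw [mul_comm K L]; exact Nat.mul_lt_mul_of_pos_left (by omega) (by omega)
    omega
theorem exists_cols {N : ℕ} {κ : Type} [Fintype κ] (A : Matrix (Fin N) κ ℂ)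
    (h : LinearIndependent ℂ A.row) :
    ∃ c : Fin N → κ, Function.Injective c ∧ (A.submatrix id c).det ≠ 0 := by
  classical
  obtain ⟨ι, a, ha, hsp, hli⟩ := exists_linearIndependent' ℂ A.col
  have hr : A.rank = N := by rw [h.rank_matrix]; simp
  rw [Matrix.rank_eq_finrank_span_cols] at hr
  rw [← hsp] at hr
  have : Finite ι := Finite.of_injective a ha
  have : Fintype ι := Fintype.ofFinite ι
  have hc : Fintype.card ι = N := by
    rw [← hr, finrank_span_eq_card hli]
  let e : Fin N ≃ ι := (Fintype.equivFinOfCardEq hc).symm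
  refine ⟨a ∘ e, ha.comp e.injective, ?_⟩
  have h2 : LinearIndependent ℂ (A.submatrix id (a ∘ e)).col := by
    have := hli.comp e e.injective
    exact this
  rw [Matrix.linearIndependent_cols_iff_isUnit, Matrix.isUnit_iff_isUnit_det] at h2
  exact h2.ne_zero

/-- binomial polynomial as a function -/
noncomputable def binf (a : ℕ) (w : ℂ) : ℂ := (∏ i ∈ Finset.range a, (w - i)) / (a.factorial : ℂ)

theorem binf_nat (a x : ℕ) : binf a (x : ℂ) = (x.choose a : ℂ) := by
  unfold binf
  rw [div_eq_iff (by exact_mod_cast a.factorial_ne_zero)]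
  have h : ((x.descFactorial a : ℕ) : ℂ) = ∏ i ∈ Finset.range a, ((x : ℂ) - i) := by
    induction a with
    | zero => simp
    | succ a ih =>
      rw [Nat.descFactorial_succ, Finset.prod_range_succ, ← ih]
      by_cases hx : a ≤ x
      · push_cast [Nat.cast_sub hx]; ring
      · rw [Nat.descFactorial_eq_zero_iff_lt.2 (by omega)]; simp
  rw [← h, Nat.descFactorial_eq_factorial_mul_choose]; push_cast; ring

open Polynomial in
noncomputable def binP (a : ℕ) : ℂ[X] :=
  C ((a.factorial : ℂ)⁻¹) * ∏ i ∈ Finset.range a, (X - C (i : ℂ))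

open Polynomial in
theorem binP_eval (a : ℕ) (w : ℂ) : (binP a).eval w = binf a w := by
  unfold binP binf
  rw [eval_mul, eval_C, eval_prod]
  simp only [eval_sub, eval_X, eval_C]
  rw [div_eq_mul_inv, mul_comm]

open Polynomial in
theorem binP_deg (a : ℕ) : (binP a).natDegree ≤ a := by
  unfold binP
  refine (natDegree_C_mul_le _ _).trans ?_
  refine (natDegree_prod_le _ _).trans ?_
  refine (Finset.sum_le_card_nsmul _ _ 1 fun i _ => ?_).trans ?_
  · exact (natDegree_X_sub_C _).le
  · simp

theorem binf_diff (a : ℕ) : Differentiable ℂ (binf a) := by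
  unfold binf
  fun_prop

theorem binf_norm (a K : ℕ) (haK : a ≤ K) (w : ℂ) (X : ℝ) (hw : ‖w‖ ≤ X) :
    ‖binf a w‖ ≤ (X + K) ^ a / (a.factorial : ℝ) := by
  unfold binf
  rw [norm_div, norm_prod, Complex.norm_natCast]
  gcongr
  refine (Finset.prod_le_prod (g := fun _ => X + K) (fun _ _ => norm_nonneg _) ?_).trans (by simp)
  intro i hi
  refine (norm_sub_le _ _).trans ?_
  rw [Complex.norm_natCast]
  have : (i : ℝ) ≤ K := by exact_mod_cast ((Finset.mem_range.1 hi).le.trans haK)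
  linarith

theorem binP_indep (K : ℕ) (c : Fin K → ℂ) (h : ∑ a, Polynomial.C (c a) * binP a = 0) :
    ∀ a, c a = 0 := by
  have key : ∀ n : ℕ, ∀ hn : n < K, c ⟨n, hn⟩ = 0 := by
    intro n
    induction n using Nat.strong_induction_on with
    | _ n ih =>
      intro hn
      have h1 := congrArg (Polynomial.eval (n : ℂ)) h
      rw [Polynomial.eval_finsetSum] at h1
      simp only [Polynomial.eval_mul, Polynomial.eval_C, binP_eval, binf_nat, Polynomial.eval_zero] at h1
      rw [Finset.sum_eq_single ⟨n, hn⟩] at h1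
      · simpa using h1
      · intro b _ hb
        rcases lt_trichotomy (b : ℕ) n with h | h | h
        · rw [ih b h b.2]; simp
        · exact absurd (Fin.ext h) hb
        · rw [Nat.choose_eq_zero_of_lt h]; simp
      · simp
  exact fun a => key a a.2
open Complex in
theorem baker_ineq (γ : GaussianInt) (hγ : γ ≠ 0)
    (hroot : ∀ n, 1 ≤ n → γ ^ n ≠ (star γ) ^ n) (p κ K l R2 S : ℕ) (ψ ε : ℝ)
    (hψ : (γ : ℂ) = (starRingEnd ℂ) (γ : ℂ) * exp (I * ψ))
    (hψ2 : p * ψ = κ * Real.pi / 2 + ε) (hp : 0 < p) (hκp : κ ≤ p) (hcop : Nat.Coprime κ (4 * p))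
    (hRp : (2 * l + 1) * (R2 + (2 * l + 1)) ≤ p) (hK : 1 ≤ K) (hKL : K * (2 * l + 1) ≤ R2 * S)
    (hε : 4 ^ (K * (2 * l + 1)) * |ε| ≤ 1) :
    (4 : ℝ) ^ (K * (2 * l + 1) * (K * (2 * l + 1) - 1) / 2) ≤
      ((K * (2 * l + 1)).factorial : ℝ) *
      (∏ i : Fin K × Fin (2 * l + 1), 2 * ((4 * (p * (R2 + (2 * l + 1) + 4 * S) : ℝ) + K) ^ (i.1 : ℕ) /
        ((i.1 : ℕ).factorial : ℝ) * Real.exp (Real.pi / (2 * p) * |((i.2 : ℕ) : ℝ) - l| *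
          (4 * (p * (R2 + (2 * l + 1) + 4 * S) : ℝ))))) *
      (γ.norm : ℝ) ^ (∑ q : Fin (R2 + (2 * l + 1)) × Fin S, l * (q.1 : ℕ)) := by
  classical
  set L := 2 * l + 1 with hL
  set R := R2 + L with hR
  set N := K * L with hN
  set Xm : ℝ := (p * (R2 + (2 * l + 1) + 4 * S) : ℝ) with hXm
  have hp0 : (p : ℝ) ≠ 0 := by positivity
  have hpc : (p : ℂ) ≠ 0 := by exact_mod_cast hp.ne'
  set g : ℂ := (γ : ℂ) with hg
  set gc : ℂ := (starRingEnd ℂ) g with hgc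
  set u : ℂ := exp (I * ψ) with hu
  have hu0 : u ≠ 0 := exp_ne_zero _
  have hg0 : g ≠ 0 := by rw [hg]; exact fun h => hγ (GaussianInt.toComplex_eq_zero.1 h)
  have hgc0 : gc ≠ 0 := by rw [hgc]; simpa using hg0
  have hRp' : R ≤ p := by
    refine le_trans ?_ hRp
    exact Nat.le_mul_of_pos_left _ (by omega)
  let xx : ℕ → ℕ → ℕ := fun r σ => κ * r + 4 * p * σ
  have hxinj : ∀ r < R, ∀ σ < S, ∀ r' < R, ∀ σ' < S, xx r σ = xx r' σ' → r = r' ∧ σ = σ' := by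
    intro r hr σ hσ r' hr' σ' hσ' h
    simp only [xx] at h
    have h1 : ((4 * p : ℕ) : ℤ) ∣ (κ : ℤ) * ((r : ℤ) - r') := by
      refine ⟨(σ' : ℤ) - σ, ?_⟩
      have : ((κ * r + 4 * p * σ : ℕ) : ℤ) = ((κ * r' + 4 * p * σ' : ℕ) : ℤ) := by rw [h]
      push_cast at this ⊢
      linear_combination this
    have h2 : ((4 * p : ℕ) : ℤ) ∣ (r : ℤ) - r' := by
      refine IsCoprime.dvd_of_dvd_mul_left ?_ h1
      exact (Nat.isCoprime_iff_coprime.2 hcop).symm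
    have h3 : (r : ℤ) - r' = 0 := by
      apply Int.eq_zero_of_abs_lt_dvd h2
      rw [abs_lt]; push_cast; constructor <;> omega
    have h4 : r = r' := by omega
    refine ⟨h4, ?_⟩
    subst h4
    have : 4 * p * σ = 4 * p * σ' := by omega
    exact Nat.eq_of_mul_eq_mul_left (by omega) this
  -- the Gaussian integer matrix
  let AZ : Matrix (Fin K × Fin L) (Fin R × Fin S) GaussianInt := Matrix.of fun i q =>
    ((xx q.1 q.2).choose i.1 : GaussianInt) * (γ ^ ((i.2 : ℕ) * q.1) * star γ ^ ((2 * l - i.2) * q.1))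
  let AC : Matrix (Fin K × Fin L) (Fin R × Fin S) ℂ := AZ.map GaussianInt.toComplex
  have hAC : ∀ i q, AC i q = binf i.1 (xx q.1 q.2) * (g ^ ((i.2 : ℕ) * q.1) * gc ^ ((2 * l - i.2) * q.1)) := by
    intro i q
    simp only [AC, AZ, Matrix.map_apply, Matrix.of_apply, binf_nat, map_mul, map_pow, map_natCast,
      GaussianInt.toComplex_star, hg, hgc]
  have hACu : ∀ i q, AC i q = binf i.1 (xx q.1 q.2) * u ^ ((i.2 : ℕ) * q.1) * gc ^ (2 * l * (q.1 : ℕ)) := by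
    intro i q
    rw [hAC, hψ, mul_pow]
    have : 2 * l * (q.1 : ℕ) = i.2 * q.1 + (2 * l - i.2) * q.1 := by
      rw [← add_mul]; congr 1; have := i.2.2; omega
    rw [this, pow_add]; ring
  have hroot' : ∀ n, 1 ≤ n → n < L → u ^ n ≠ 1 := by
    intro n hn _ h
    apply hroot n hn
    apply GaussianInt.toComplex_injective
    rw [map_pow, map_pow, GaussianInt.toComplex_star]
    change g ^ n = gc ^ n
    rw [hψ, mul_pow, h, mul_one]
  let e : Fin N ≃ Fin K × Fin L := finProdFinEquiv.symm
  have hli : LinearIndependent ℂ (AC.submatrix e id).row := by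
    rw [Fintype.linearIndependent_iff]
    intro c hc
    let c' : Fin K × Fin L → ℂ := fun i => c (e.symm i)
    have hc' : ∀ q, ∑ i, c' i * AC i q = 0 := by
      intro q
      have := congrFun hc q
      simp only [Finset.sum_apply, Pi.smul_apply, smul_eq_mul, Pi.zero_apply, Matrix.row,
        Matrix.submatrix_apply, id] at this
      rw [← e.sum_comp]
      simpa [c'] using this
    have hQ := zero_est K L R2 S hK (by omega) hKL u hu0 hroot' (κ : ℂ) (4 * p : ℂ) ?_
      (fun b => ∑ a : Fin K, Polynomial.C (c' (a, b)) * binP a) ?_ ?_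
    · intro i
      have h1 := binP_indep K (fun a => c' (a, (e i).2)) (hQ (e i).2) (e i).1
      simpa [c'] using h1
    · intro r hr σ hσ r' hr' σ' hσ' h
      apply hxinj r (by omega) σ hσ r' (by omega) σ' hσ'
      have : ((xx r σ : ℕ) : ℂ) = (xx r' σ' : ℕ) := by
        simp only [xx]; push_cast; exact h
      exact_mod_cast this
    · intro b
      refine lt_of_le_of_lt (Polynomial.natDegree_sum_le_of_forall_le (n := K - 1) _ _ fun a _ => ?_) (by omega)
      refine (Polynomial.natDegree_C_mul_le _ _).trans ((binP_deg _).trans ?_)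
      have := a.2; omega
    · intro r hr σ hσ
      have h1 := hc' (⟨r, hr⟩, ⟨σ, hσ⟩)
      simp only [hACu] at h1
      rw [Fintype.sum_prod_type, Finset.sum_comm] at h1
      have h2 : (∑ b : Fin L, (∑ a : Fin K, c' (a, b) * binf a (xx r σ)) * u ^ ((b : ℕ) * r)) * gc ^ (2 * l * r) = 0 := by
        rw [← h1, Finset.sum_mul]
        refine Finset.sum_congr rfl fun b _ => ?_
        rw [Finset.sum_mul, Finset.sum_mul]
        refine Finset.sum_congr rfl fun a _ => ?_
        ring
      rw [mul_eq_zero, or_iff_left (pow_ne_zero _ hgc0)] at h2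
      rw [← h2]
      refine Finset.sum_congr rfl fun b _ => ?_
      congr 1
      rw [Polynomial.eval_finsetSum]
      refine Finset.sum_congr rfl fun a _ => ?_
      rw [Polynomial.eval_mul, Polynomial.eval_C, binP_eval]
      simp only [xx]; push_cast; rfl
  obtain ⟨c, hcinj, hdet⟩ := exists_cols _ hli
  -- lower bound
  have hlow : 1 ≤ ‖((AC.submatrix e id).submatrix id c).det‖ := by
    have h1 : ((AC.submatrix e id).submatrix id c).det = GaussianInt.toComplex (AZ.submatrix e c).det := by
      rw [RingHom.map_det]; rfl
    rw [h1] at hdet ⊢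
    have h2 : (AZ.submatrix e c).det ≠ 0 := fun h => hdet (by rw [h]; simp)
    have h3 := GaussianInt.norm_pos.2 h2
    have h4 : (1 : ℝ) ≤ ((AZ.submatrix e c).det.norm : ℝ) := by exact_mod_cast h3
    rw [GaussianInt.intCast_real_norm, Complex.normSq_eq_norm_sq] at h4
    nlinarith [norm_nonneg (GaussianInt.toComplex (AZ.submatrix e c).det)]
  -- normalised matrix
  let ω : ℝ := Real.pi / (2 * p)
  let f : Fin N → ℂ → ℂ := fun i w => binf (e i).1 w * exp (I * ω * ((((e i).2 : ℕ) : ℂ) - l) * w)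
  let xj : Fin N → ℂ := fun j => (xx (c j).1 (c j).2 : ℕ)
  let Ex : Fin N → Fin N → ℂ := fun i j => binf (e i).1 (xj j) * exp (I * ψ * ((((e i).2 : ℕ) : ℂ) - l) * ((c j).1 : ℕ))
  let η : Fin N → Fin N → ℂ := fun i j => Ex i j - f i (xj j)
  let F : Fin N → ℝ := fun i => 2 * ((4 * Xm + K) ^ ((e i).1 : ℕ) / (((e i).1 : ℕ).factorial : ℝ) *
      Real.exp (ω * |(((e i).2 : ℕ) : ℝ) - l| * (4 * Xm)))
  have hXm0 : 0 ≤ Xm := by positivity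
  have hxX : ∀ j, ‖xj j‖ ≤ Xm := by
    intro j
    simp only [xj, Complex.norm_natCast, xx]
    have h1 : ((c j).1 : ℕ) ≤ R := (c j).1.2.le
    have h2 : ((c j).2 : ℕ) ≤ S := (c j).2.2.le
    have h3 : κ * ((c j).1 : ℕ) + 4 * p * ((c j).2 : ℕ) ≤ p * (R2 + L + 4 * S) := by
      have := Nat.mul_le_mul hκp h1
      have := Nat.mul_le_mul_left (4 * p) h2
      nlinarith
    have h4 : ((κ * ((c j).1 : ℕ) + 4 * p * ((c j).2 : ℕ) : ℕ) : ℝ) ≤ (p * (R2 + L + 4 * S) : ℕ) := by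
      exact_mod_cast h3
    refine h4.trans (le_of_eq ?_)
    rw [hXm, hL]; push_cast; ring
  have hfx : ∀ i j, f i (xj j) = binf (e i).1 (xj j) *
      exp (I * (κ * Real.pi / 2 / p : ℝ) * ((((e i).2 : ℕ) : ℂ) - l) * ((c j).1 : ℕ)) := by
    intro i j
    simp only [f]
    congr 1
    have h1 : I * (ω : ℂ) * ((((e i).2 : ℕ) : ℂ) - l) * xj j =
        I * (κ * Real.pi / 2 / p : ℝ) * ((((e i).2 : ℕ) : ℂ) - l) * ((c j).1 : ℕ)
        + (((((e i).2 : ℕ) : ℤ) - (l : ℤ)) * (((c j).2 : ℕ) : ℤ) : ℤ) * (2 * Real.pi * I) := by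
      simp only [xj, xx, ω]; push_cast
      field_simp
      ring
    rw [h1, Complex.exp_add, Complex.exp_int_mul_two_pi_mul_I, mul_one]
  have hψc : (ψ : ℝ) = κ * Real.pi / 2 / p + ε / p := by
    field_simp
    linarith
  have hη : ∀ i j, ‖η i j‖ ≤ ‖binf (e i).1 (xj j)‖ * |ε| := by
    intro i j
    set B : ℝ := (((e i).2 : ℕ) : ℝ) - l with hB
    set r : ℝ := (((c j).1 : ℕ) : ℝ) with hr
    set al : ℝ := κ * Real.pi / 2 / p with hal
    have hBc : (((e i).2 : ℕ) : ℂ) - l = (B : ℂ) := by rw [hB]; push_cast; rfl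
    have hrc : (((c j).1 : ℕ) : ℂ) = (r : ℂ) := by rw [hr]; push_cast; rfl
    have h1 : η i j = binf (e i).1 (xj j) * exp ((al * B * r : ℝ) * I) * (exp (I * (B * r * ε / p : ℝ)) - 1) := by
      simp only [η, Ex, hfx]
      rw [hBc, hrc, mul_sub, mul_one, mul_assoc (binf _ _) (exp _) (exp _), ← Complex.exp_add]
      congr 3
      · rw [hψc]; push_cast; ring
      · push_cast; ring
    rw [h1, norm_mul, norm_mul, Complex.norm_exp_ofReal_mul_I, mul_one]
    gcongr
    refine Real.norm_exp_I_mul_ofReal_sub_one_le.trans ?_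
    rw [Real.norm_eq_abs, abs_div, abs_mul, abs_mul, abs_of_nonneg (Nat.cast_nonneg p : (0:ℝ) ≤ p)]
    rw [div_le_iff₀ (by positivity), mul_comm |ε|]
    gcongr
    have hBl : |B| ≤ L := by
      have := (e i).2.2
      have h2 : (((e i).2 : ℕ) : ℝ) ≤ 2 * l := by exact_mod_cast (by omega)
      have h3 : (0:ℝ) ≤ (((e i).2 : ℕ) : ℝ) := by positivity
      have hLc : (L : ℝ) = 2 * l + 1 := by rw [hL]; push_cast; ring
      have hl0 : (0:ℝ) ≤ l := by positivity
      rw [hB, abs_le]; constructor <;> linarith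
    have hrR : |r| ≤ R := by
      rw [hr, Nat.abs_cast]; exact_mod_cast (c j).1.2.le
    calc |B| * |r| ≤ L * R := by gcongr
      _ ≤ p := by exact_mod_cast hRp
  have hω0 : 0 ≤ ω := by have := Real.pi_pos; positivity
  have hbound := interp_det f (fun i => ?_) xj ?_ η 4 (by norm_num) F ?_
  rotate_left
  · have := binf_diff (e i).1
    simp only [f]
    fun_prop
  · intro j j' h
    simp only [xj] at h
    have h' : xx (c j).1 (c j).2 = xx (c j').1 (c j').2 := by exact_mod_cast h
    obtain ⟨h1, h2⟩ := hxinj _ (c j).1.2 _ (c j).2.2 _ (c j').1.2 _ (c j').2.2 h'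
    exact hcinj (Prod.ext (Fin.ext h1) (Fin.ext h2))
  · intro i j z hz
    set G : ℝ := (4 * Xm + K) ^ ((e i).1 : ℕ) / (((e i).1 : ℕ).factorial : ℝ) with hG
    have hG0 : 0 ≤ G := by positivity
    have hexp1 : 1 ≤ Real.exp (ω * |(((e i).2 : ℕ) : ℝ) - l| * (4 * Xm)) := by
      apply Real.one_le_exp; positivity
    have h1 : ‖f i (z * xj j)‖ ≤ G * Real.exp (ω * |(((e i).2 : ℕ) : ℝ) - l| * (4 * Xm)) := by
      simp only [f]
      rw [norm_mul, Complex.norm_exp]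
      have hzx : ‖z * xj j‖ ≤ 4 * Xm := by
        rw [norm_mul, hz]; gcongr; exact hxX j
      gcongr
      · exact binf_norm _ _ (e i).1.2.le _ _ hzx
      · refine (Complex.re_le_norm _).trans ?_
        have hBc : (((e i).2 : ℕ) : ℂ) - l = ((((e i).2 : ℕ) : ℝ) - l : ℝ) := by push_cast; rfl
        rw [norm_mul, norm_mul, norm_mul, Complex.norm_I, hBc, Complex.norm_real, Complex.norm_real, one_mul,
          Real.norm_eq_abs, Real.norm_eq_abs, abs_of_nonneg hω0]
        gcongr
    have h2 : (4:ℝ) ^ N * ‖η i j‖ ≤ G * Real.exp (ω * |(((e i).2 : ℕ) : ℝ) - l| * (4 * Xm)) := by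
      have h3 : ‖binf (e i).1 (xj j)‖ ≤ G := by
        refine binf_norm _ _ (e i).1.2.le _ _ ((hxX j).trans (by linarith))
      calc (4:ℝ) ^ N * ‖η i j‖ ≤ 4 ^ N * (G * |ε|) := by
            gcongr; exact (hη i j).trans (by gcongr)
        _ = G * (4 ^ N * |ε|) := by ring
        _ ≤ G * 1 := by gcongr
        _ ≤ _ := by gcongr
    simp only [F]
    linarith
  -- relate determinants
  have hY : g * gc = (γ.norm : ℂ) := by
    rw [hgc, Complex.mul_conj, ← GaussianInt.intCast_complex_norm]
  have hn1 : 1 ≤ γ.norm := GaussianInt.norm_pos.2 hγ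
  have hn1' : (1:ℝ) ≤ γ.norm := by exact_mod_cast hn1
  have hent : (AC.submatrix e id).submatrix id c = Matrix.of fun i j =>
      ((γ.norm : ℂ) ^ (l * ((c j).1 : ℕ))) * (Matrix.of fun i j => f i (xj j) + η i j) i j := by
    ext i j
    simp only [Matrix.submatrix_apply, id, Matrix.of_apply, η, add_sub_cancel, hACu, Ex]
    have h1 : (γ.norm : ℂ) ^ (l * ((c j).1 : ℕ)) = gc ^ (2 * l * ((c j).1 : ℕ)) * u ^ (l * ((c j).1 : ℕ)) := by
      rw [← hY]
      conv_lhs => rw [hψ]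
      rw [mul_right_comm, ← pow_two, mul_pow, ← pow_mul]; congr 2; ring
    have h2 : u ^ (((e i).2 : ℕ) * ((c j).1 : ℕ)) = u ^ (l * ((c j).1 : ℕ)) *
        exp (I * ψ * ((((e i).2 : ℕ) : ℂ) - l) * ((c j).1 : ℕ)) := by
      rw [hu, ← Complex.exp_nat_mul, ← Complex.exp_nat_mul, ← Complex.exp_add]
      congr 1; push_cast; ring
    rw [h1, h2]; simp only [xj]; ring
  rw [hent, Matrix.det_mul_row, norm_mul, norm_prod] at hlow
  have hprod : ∏ j, ‖(γ.norm : ℂ) ^ (l * ((c j).1 : ℕ))‖ ≤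
      (γ.norm : ℝ) ^ (∑ q : Fin R × Fin S, l * (q.1 : ℕ)) := by
    have h1 : ∀ j, ‖(γ.norm : ℂ) ^ (l * ((c j).1 : ℕ))‖ = (γ.norm : ℝ) ^ (l * ((c j).1 : ℕ)) := by
      intro j
      rw [norm_pow, Complex.norm_intCast, abs_of_nonneg (by linarith)]
    rw [Finset.prod_congr rfl fun j _ => h1 j, Finset.prod_pow_eq_pow_sum]
    apply pow_le_pow_right₀ hn1'
    rw [← Finset.sum_image (f := fun q : Fin R × Fin S => l * (q.1 : ℕ)) (s := Finset.univ) (g := c)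
      (fun _ _ _ _ h => hcinj h)]
    exact Finset.sum_le_sum_of_subset (Finset.subset_univ _)
  have hFprod : ∏ i, F i = ∏ i : Fin K × Fin L, 2 * ((4 * Xm + K) ^ (i.1 : ℕ) /
        ((i.1 : ℕ).factorial : ℝ) * Real.exp (Real.pi / (2 * p) * |((i.2 : ℕ) : ℝ) - l| * (4 * Xm))) := by
    rw [← e.prod_comp]
  rw [← hFprod]
  set DD := ‖(Matrix.of fun i j => f i (xj j) + η i j).det‖ with hDD
  have hDD0 : 0 ≤ DD := norm_nonneg _
  set PP := (γ.norm : ℝ) ^ (∑ q : Fin R × Fin S, l * (q.1 : ℕ)) with hPP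
  have hPP0 : 0 ≤ PP := by positivity
  have h1 : 1 ≤ PP * DD := hlow.trans (mul_le_mul_of_nonneg_right hprod hDD0)
  calc (4:ℝ) ^ (N * (N - 1) / 2) ≤ (PP * DD) * 4 ^ (N * (N - 1) / 2) := by
        refine le_mul_of_one_le_left (by positivity) h1
    _ = PP * (DD * 4 ^ (N * (N - 1) / 2)) := by ring
    _ ≤ PP * ((N.factorial : ℝ) * ∏ i, F i) := by gcongr
    _ = _ := by ring

theorem sum_abs_center (l : ℕ) : ∑ b : Fin (2 * l + 1), |((b : ℕ) : ℝ) - l| = l * (l + 1) := by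
  rw [Fin.sum_univ_eq_sum_range (fun b => |((b : ℕ) : ℝ) - l|) (2 * l + 1),
    show 2 * l + 1 = l + (l + 1) by ring, Finset.sum_range_add]
  have h1 : ∑ x ∈ Finset.range l, |((x : ℕ) : ℝ) - l| = ∑ x ∈ Finset.range l, ((x : ℝ) + 1) := by
    rw [← Finset.sum_range_reflect]
    refine Finset.sum_congr rfl fun x hx => ?_
    have hx' := Finset.mem_range.1 hx
    have : ((l - 1 - x : ℕ) : ℝ) = l - 1 - x := by
      rw [Nat.cast_sub (by omega), Nat.cast_sub (by omega)]; simp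
    rw [this, abs_of_nonpos]
    · ring
    · have : (0:ℝ) ≤ x := by positivity
      linarith
  have h2 : ∑ x ∈ Finset.range (l + 1), |((l + x : ℕ) : ℝ) - l| = ∑ x ∈ Finset.range (l + 1), (x : ℝ) := by
    refine Finset.sum_congr rfl fun x hx => ?_
    push_cast
    rw [add_sub_cancel_left, abs_of_nonneg (by positivity)]
  rw [h1, h2]
  have h3 : ∀ n : ℕ, ∑ x ∈ Finset.range n, (x : ℝ) = n * (n - 1) / 2 := by
    intro n
    induction n with
    | zero => simp
    | succ n ih => rw [Finset.sum_range_succ, ih]; push_cast; ring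
  rw [Finset.sum_add_distrib, h3, h3]
  simp
  ring

theorem sum_range_cast (n : ℕ) : ∑ x : Fin n, ((x : ℕ) : ℝ) = n * (n - 1) / 2 := by
  rw [Fin.sum_univ_eq_sum_range (fun b => (b : ℝ)) n]
  induction n with
  | zero => simp
  | succ n ih => rw [Finset.sum_range_succ, ih]; push_cast; ring

theorem pow_growth (n : ℕ) (hn : 21 ≤ n) :
    666 * (2 * n + 1) ^ 2 + 43 * (2 * n + 1) + 11 ≤ 2 ^ n := by
  induction n, hn using Nat.le_induction with
  | base => norm_num
  | succ n hn ih =>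
    rw [show 2^(n+1)=2*2^n from by ring]
    nlinarith

set_option maxHeartbeats 4000000 in
theorem baker_num (γ : GaussianInt) (hy : 5 ≤ γ.norm)
    (hroot : ∀ n, 1 ≤ n → γ ^ n ≠ (star γ) ^ n) (p κ : ℕ) (ψ ε : ℝ)
    (hψ : (γ : ℂ) = (starRingEnd ℂ) (γ : ℂ) * Complex.exp (Complex.I * ψ))
    (hψ2 : p * ψ = κ * Real.pi / 2 + ε) (hp : 2 ^ 21 ≤ p) (hκp : κ ≤ p) (hcop : Nat.Coprime κ (4 * p))
    (hε : |ε| ≤ 1600 * Real.exp (-(p * (Real.log γ.norm / 2)))) : False := by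
  have hγ : γ ≠ 0 := by
    rintro rfl
    simp at hy
  set n := Nat.log 2 p with hn
  have hp0 : p ≠ 0 := by intro h; rw [h] at hp; norm_num at hp
  have hn1 : 2 ^ n ≤ p := Nat.pow_log_le_self 2 hp0
  have hn2 : p < 2 ^ (n + 1) := Nat.lt_pow_succ_log_self (by norm_num) p
  have hn21 : 21 ≤ n := (Nat.le_log_iff_pow_le (by norm_num) hp0).2 hp
  set h : ℝ := Real.log γ.norm / 2 with hh
  have hl2a : (0.6931 : ℝ) < Real.log 2 := by have := Real.log_two_gt_d9; linarith
  have hl2b : Real.log 2 < (0.69315 : ℝ) := by have := Real.log_two_lt_d9; linarith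
  have hl4 : Real.log 4 = 2 * Real.log 2 := by
    rw [show (4:ℝ) = 2 ^ 2 by norm_num, Real.log_pow]; norm_num
  have hh79 : 0.79 ≤ h := by
    have h1 : Real.log 5 ≤ Real.log γ.norm := Real.log_le_log (by norm_num) (by exact_mod_cast hy)
    have h2 : Real.log ((2:ℝ) ^ 16) ≤ Real.log ((5:ℝ) ^ 7) := Real.log_le_log (by norm_num) (by norm_num)
    rw [Real.log_pow, Real.log_pow] at h2
    push_cast at h2
    rw [hh]; linarith
  set L : ℕ := 2 * n + 1 with hL
  set S : ℕ := ⌈20 * (L : ℝ) * h⌉₊ with hS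
  have hLr : (L : ℝ) = 2 * n + 1 := by rw [hL]; push_cast; ring
  have hnr : (21 : ℝ) ≤ n := by exact_mod_cast hn21
  have hL43 : (43 : ℝ) ≤ L := by rw [hLr]; linarith
  have hSlo : 20 * (L : ℝ) * h ≤ S := Nat.le_ceil _
  have hShi : (S : ℝ) ≤ 20 * (L : ℝ) * h + 1 := (Nat.ceil_lt_add_one (by positivity)).le
  have hSL : 15.8 * (L : ℝ) ≤ S := by nlinarith
  have hS1 : 1 ≤ S := by
    have : (1:ℝ) ≤ S := by linarith
    exact_mod_cast this
  have hgrow := pow_growth n hn21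
  rw [← hL] at hgrow
  have hpL : 666 * L ^ 2 + 43 * L + 11 ≤ p := hgrow.trans hn1
  have hpLr : 666 * (L:ℝ) ^ 2 + 43 * L + 11 ≤ p := by exact_mod_cast hpL
  have hpr : (0:ℝ) < p := by positivity
  set N : ℕ := 24 * S * L with hN
  have hNr : (N : ℝ) = 24 * S * L := by rw [hN]; push_cast; ring
  have heps : (4:ℝ) ^ N * |ε| ≤ 1 := by
    have h1 : (4:ℝ) ^ N * (1600 * Real.exp (-(p * h))) ≤ 1 := by
      have e1 : (4:ℝ) ^ N = Real.exp (N * Real.log 4) := by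
        rw [mul_comm, Real.exp_mul, Real.exp_log (by norm_num), Real.rpow_natCast]
      have e2 : (1600:ℝ) ≤ Real.exp (11 * Real.log 2) := by
        rw [mul_comm, Real.exp_mul, Real.exp_log (by norm_num)]; norm_num
      calc (4:ℝ) ^ N * (1600 * Real.exp (-(p * h)))
          ≤ Real.exp (N * Real.log 4) * (Real.exp (11 * Real.log 2) * Real.exp (-(p * h))) := by
            rw [e1]; gcongr
        _ = Real.exp (N * Real.log 4 + 11 * Real.log 2 - p * h) := by
            rw [← Real.exp_add, ← Real.exp_add]; congr 1; ring
        _ ≤ 1 := by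
            rw [Real.exp_le_one_iff]
            have a1 : (N : ℝ) * Real.log 4 ≤ 24 * (20 * L * h + 1) * L * 1.3863 := by
              rw [hNr, hl4]
              have : (S:ℝ) * L ≤ (20 * L * h + 1) * L := by gcongr
              have h0 : (0:ℝ) ≤ S * L := by positivity
              nlinarith
            have a2 : (666 * (L:ℝ) ^ 2 + 43 * L + 11) * h ≤ p * h := by gcongr
            nlinarith [mul_nonneg (sq_nonneg (L:ℝ)) (by linarith : (0:ℝ) ≤ h - 0.79)]
    refine le_trans ?_ h1
    gcongr
  have key := baker_ineq γ hγ hroot p κ (24 * S) n (24 * L) S ψ ε hψ hψ2 (by omega) hκp hcop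
    (by rw [← hL]; nlinarith) (by omega) (by rw [← hL]; nlinarith) (by rw [← hL]; exact heps)
  rw [← hL, ← hN] at key
  have hn2r : (p:ℝ) ≤ 2 ^ (n + 1) := by exact_mod_cast hn2.le
  have hlogp : Real.log p ≤ (n + 1) * Real.log 2 := by
    have := Real.log_le_log hpr hn2r
    rwa [Real.log_pow, Nat.cast_add, Nat.cast_one] at this
  have hyr : (5:ℝ) ≤ (γ.norm : ℝ) := by exact_mod_cast hy
  have hSr : (0:ℝ) < S := by exact_mod_cast hS1
  have hpi : Real.pi < 3.1416 := Real.pi_lt_d4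
  set c : ℝ := 2 * Real.pi * (25 * L + 4 * S) with hc
  have hfac : ∀ i : Fin (24 * S) × Fin L, 
      2 * ((4 * ((p:ℝ) * (((24 * L : ℕ):ℝ) + (2 * (n:ℝ) + 1) + 4 * (S:ℝ))) + ((24 * S : ℕ) : ℝ)) ^ (i.1:ℕ) / (((i.1:ℕ).factorial : ℕ) : ℝ) *
        Real.exp (Real.pi / (2 * (p:ℝ)) * |((i.2:ℕ):ℝ) - (n:ℝ)| * (4 * ((p:ℝ) * (((24 * L : ℕ):ℝ) + (2 * (n:ℝ) + 1) + 4 * (S:ℝ)))))) 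
      ≤ Real.exp (Real.log 2 + (i.1:ℕ) * Real.log p + 24 * S + c * |((i.2:ℕ):ℝ) - (n:ℝ)|) := by
    intro i
    have e1 : Real.pi / (2 * (p:ℝ)) * |((i.2:ℕ):ℝ) - (n:ℝ)| * (4 * ((p:ℝ) * (((24 * L : ℕ):ℝ) + (2 * (n:ℝ) + 1) + 4 * (S:ℝ)))) = c * |((i.2:ℕ):ℝ) - (n:ℝ)| := by
      rw [hc]; push_cast; rw [← hLr]; field_simp; ring
    rw [e1, Real.exp_add, Real.exp_add, Real.exp_add, Real.exp_log (by norm_num)]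
    have e2 : Real.exp ((i.1:ℕ) * Real.log p) = (p:ℝ) ^ (i.1:ℕ) := by
      rw [mul_comm, Real.exp_mul, Real.exp_log hpr, Real.rpow_natCast]
    have e3 : (4 * ((p:ℝ) * (((24 * L : ℕ):ℝ) + (2 * (n:ℝ) + 1) + 4 * (S:ℝ))) + ((24 * S : ℕ) : ℝ)) ≤ p * (24 * S) := by
      push_cast
      rw [← hLr]
      have u1 : 15.8 * (L:ℝ) * p ≤ S * p := mul_le_mul_of_nonneg_right hSL hpr.le
      have u2 : (S:ℝ) * 1000 ≤ S * p := by
        gcongr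
        have : 1000 ≤ p := le_trans (by norm_num) hp
        exact_mod_cast this
      ring_nf at u1 u2 ⊢
      linarith only [u1, u2, hSr]
    have e4 : ((24 * S : ℝ)) ^ (i.1:ℕ) / (((i.1:ℕ).factorial : ℕ) : ℝ) ≤ Real.exp (24 * S) :=
      Real.pow_div_factorial_le_exp _ (by positivity) _
    calc _ ≤ 2 * ((p * (24 * S : ℝ)) ^ (i.1:ℕ) / (((i.1:ℕ).factorial : ℕ) : ℝ) * Real.exp (c * |((i.2:ℕ):ℝ) - (n:ℝ)|)) := by
          gcongr
      _ = 2 * (p:ℝ) ^ (i.1:ℕ) * (((24 * S : ℝ)) ^ (i.1:ℕ) / (((i.1:ℕ).factorial : ℕ) : ℝ)) * Real.exp (c * |((i.2:ℕ):ℝ) - (n:ℝ)|) := by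
          rw [mul_pow]; ring
      _ ≤ _ := by
          rw [e2]; gcongr
  have hprod := Finset.prod_le_prod (s := Finset.univ) (fun i _ => by positivity) (fun i _ => hfac i)
  rw [← Real.exp_sum] at hprod
  have hsum : ∑ i : Fin (24 * S) × Fin L, (Real.log 2 + (i.1:ℕ) * Real.log p + 24 * S + c * |((i.2:ℕ):ℝ) - (n:ℝ)|)
      = N * Real.log 2 + L * (24 * S * (24 * S - 1) / 2) * Real.log p + N * (24 * S) + 24 * S * c * (n * (n + 1)) := by
    rw [Fintype.sum_prod_type]
    simp only [Finset.sum_add_distrib, Finset.sum_const, Finset.card_univ, Fintype.card_fin, nsmul_eq_mul, ← Finset.mul_sum, ← Finset.sum_mul]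
    have := sum_abs_center n
    rw [← hL] at this
    rw [this, sum_range_cast, hNr]
    push_cast
    ring
  rw [hsum] at hprod
  have hexp : ∑ q : Fin (24 * L + L) × Fin S, n * (q.1 : ℕ) = (∑ q : Fin (24 * L + L), (q : ℕ)) * (S * n) := by
    rw [Fintype.sum_prod_type]
    simp only [Finset.sum_const, Finset.card_univ, Fintype.card_fin, smul_eq_mul, Finset.sum_mul]
    refine Finset.sum_congr rfl fun x _ => by ring
  have hexpr : ((∑ q : Fin (24 * L + L) × Fin S, n * (q.1 : ℕ) : ℕ) : ℝ) = (25 * L) * (25 * L - 1) / 2 * (S * n) := by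
    rw [hexp]
    push_cast
    rw [sum_range_cast]
    push_cast
    ring
  have hNpos : 0 < N := by rw [hN]; positivity
  have hfact : ((N.factorial : ℕ) : ℝ) ≤ Real.exp (N * Real.log N) := by
    rw [mul_comm, Real.exp_mul, Real.exp_log (by exact_mod_cast hNpos), Real.rpow_natCast]
    exact_mod_cast Nat.factorial_le_pow N
  have hnormexp : ∀ k : ℕ, ((γ.norm : ℝ)) ^ k = Real.exp (k * (2 * h)) := by
    intro k
    rw [hh, mul_comm, show 2 * (Real.log (γ.norm : ℝ) / 2) = Real.log (γ.norm : ℝ) by ring, Real.exp_mul, Real.exp_log (by linarith), Real.rpow_natCast]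
  have hlhs : Real.exp ((N * (N - 1)) * Real.log 2) ≤ (4:ℝ) ^ (N * (N - 1) / 2) := by
    have hev : N * (N - 1) / 2 * 2 = N * (N - 1) := Nat.div_mul_cancel (Nat.even_mul_pred_self N).two_dvd
    rw [show (4:ℝ) = 2 ^ 2 by norm_num, ← pow_mul, mul_comm 2, hev, mul_comm, Real.exp_mul, Real.exp_log (by norm_num)]
    rw [← Real.rpow_natCast]
    push_cast [Nat.cast_sub (show 1 ≤ N from hNpos)]
    exact le_rfl
  rw [hnormexp, hexpr] at key
  have key2 := hlhs.trans (key.trans (mul_le_mul_of_nonneg_right (mul_le_mul hfact hprod (by positivity) (by positivity)) (Real.exp_pos _).le))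
  rw [← Real.exp_add, ← Real.exp_add, Real.exp_le_exp] at key2
  clear key hprod hsum hexp hexpr hfact hnormexp hlhs hfac heps hψ hψ2 hroot hε
  have hN0 : (0:ℝ) < N := by exact_mod_cast hNpos
  have hNbig : (700000:ℝ) ≤ N := by rw [hNr]; nlinarith
  have hlogN : Real.log N ≤ N / 1024 + 6 := by
    have h1 : Real.log N = Real.log (N / 1024) + Real.log 1024 := by
      rw [← Real.log_mul (by positivity) (by norm_num)]; congr 1; ring
    have h2 := Real.log_le_sub_one_of_pos (show (0:ℝ) < N / 1024 by positivity)
    have h3 : Real.log 1024 = 10 * Real.log 2 := by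
      rw [show (1024:ℝ) = 2 ^ 10 by norm_num, Real.log_pow]; norm_num
    rw [h1, h3]; linarith
  have T1 : (N:ℝ) * Real.log N + N * Real.log 2 ≤ 0.001 * N ^ 2 := by nlinarith
  have hnL : (n : ℝ) = (L - 1) / 2 := by rw [hLr]; ring
  have T2 : (L:ℝ) * (24 * S * (24 * S - 1) / 2) * Real.log p ≤ 0.178 * N ^ 2 := by
    have a1 : Real.log p ≤ L * 0.355 := by
      refine hlogp.trans ?_
      rw [hnL]
      nlinarith
    have a2 : (0:ℝ) ≤ L * (24 * S * (24 * S - 1) / 2) := by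
      have : (1:ℝ) ≤ S := by exact_mod_cast hS1
      have : (0:ℝ) ≤ 24 * S - 1 := by linarith
      positivity
    calc _ ≤ (L:ℝ) * (24 * S * (24 * S - 1) / 2) * (L * 0.355) := by gcongr
      _ ≤ _ := by rw [hNr]; nlinarith [mul_pos (sq_pos_of_pos (by linarith : (0:ℝ) < L)) hSr, mul_pos (sq_pos_of_pos (by linarith : (0:ℝ) < L)) (sq_pos_of_pos hSr)]
  have T2b : (N:ℝ) * (24 * S) ≤ 0.0233 * N ^ 2 := by
    have : (N:ℝ) * (24 * S) * 1 ≤ N * (24 * S) * (0.0233 * L) := by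
      gcongr; linarith
    rw [hNr] at *; nlinarith
  have T3 : 24 * S * c * (n * (n + 1)) ≤ 0.366 * (N:ℝ) ^ 2 := by
    have a1 : c ≤ 35.08 * S := by
      rw [hc]; nlinarith [Real.pi_pos]
    have a2 : (n:ℝ) * (n + 1) ≤ L ^ 2 / 4 := by rw [hnL]; nlinarith
    calc _ ≤ 24 * S * (35.08 * S) * ((L:ℝ) ^ 2 / 4) := by gcongr
      _ ≤ _ := by rw [hNr]; nlinarith [mul_pos (sq_pos_of_pos (by linarith : (0:ℝ) < L)) (sq_pos_of_pos hSr)]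
  have T4 : (25 * L) * (25 * L - 1) / 2 * (S * n) * (2 * h) ≤ 0.0275 * (N:ℝ) ^ 2 := by
    have a1 : (25 * (L:ℝ)) * (25 * L - 1) / 2 ≤ 312.5 * L ^ 2 := by nlinarith
    have a2 : (n:ℝ) ≤ L / 2 := by rw [hnL]; linarith
    calc _ ≤ 312.5 * (L:ℝ) ^ 2 * (S * (L / 2)) * (2 * h) := by gcongr
      _ = 312.5 * (L:ℝ) ^ 2 * S * (L * h) := by ring
      _ ≤ 312.5 * (L:ℝ) ^ 2 * S * (S / 20) := by gcongr; linarith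
      _ ≤ _ := by rw [hNr]; nlinarith [mul_pos (sq_pos_of_pos (by linarith : (0:ℝ) < L)) (sq_pos_of_pos hSr)]
  have T0 : 0.69 * (N:ℝ) ^ 2 ≤ (N * (N - 1)) * Real.log 2 := by nlinarith
  nlinarith

theorem gauss_coprime (u v : ℤ) (h : IsCoprime u v) (hodd : Odd (u ^ 2 + v ^ 2)) :
    IsCoprime (⟨u, v⟩ : GaussianInt) (star ⟨u, v⟩) := by
  obtain ⟨a, b, hab⟩ := h
  obtain ⟨k, hk⟩ := hodd
  -- 2 = a(γ+γ̄) + b(-i)(γ-γ̄)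
  refine ⟨star (⟨u, v⟩ : GaussianInt) - k * (a + b * ⟨0, -1⟩), - k * (a - b * ⟨0, -1⟩), ?_⟩
  apply Zsqrtd.ext
  · simp
    linear_combination hk - 2 * k * hab
  · simp
    ring

theorem root_ne (u v : ℤ) (h : IsCoprime u v) (hodd : Odd (u ^ 2 + v ^ 2)) (h5 : 5 ≤ u ^ 2 + v ^ 2) (n : ℕ) (hn : 1 ≤ n) :
    (⟨u, v⟩ : GaussianInt) ^ n ≠ (star ⟨u, v⟩) ^ n := by
  intro he
  have h1 := (gauss_coprime u v h hodd).pow (m := n) (n := n)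
  rw [← he] at h1
  have h2 : IsUnit ((⟨u, v⟩ : GaussianInt) ^ n) := isCoprime_self.1 h1
  have h3 : IsUnit (⟨u, v⟩ : GaussianInt) := (isUnit_pow_iff (by omega)).1 h2
  have h4 := Zsqrtd.norm_eq_one_iff.2 h3
  have : (⟨u, v⟩ : GaussianInt).norm = u ^ 2 + v ^ 2 := by simp [Zsqrtd.norm]; ring
  rw [this] at h4
  omega

theorem exp_near_one (φ δ : ℝ) (h : ‖Complex.exp (Complex.I * φ) - 1‖ ≤ δ) :
    ∃ m : ℤ, |φ - 2 * Real.pi * m| ≤ Real.pi / 2 * δ := by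
  refine ⟨round (φ / (2 * Real.pi)), ?_⟩
  set m := round (φ / (2 * Real.pi)) with hm
  set φ' : ℝ := φ - 2 * Real.pi * m with hφ
  have hpi := Real.pi_pos
  have h1 : |φ'| ≤ Real.pi := by
    have := abs_sub_round (φ / (2 * Real.pi))
    rw [← hm] at this
    have e : φ' = (φ / (2 * Real.pi) - m) * (2 * Real.pi) := by rw [hφ]; field_simp
    rw [e, abs_mul, abs_of_pos (by positivity : (0:ℝ) < 2 * Real.pi)]
    nlinarith
  have h2 : Complex.exp (Complex.I * φ) = Complex.exp (Complex.I * φ') := by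
    rw [hφ]
    have : Complex.I * ((φ - 2 * Real.pi * m : ℝ) : ℂ) = Complex.I * φ - m * (2 * Real.pi * Complex.I) := by
      push_cast; ring
    rw [this, Complex.exp_sub, Complex.exp_int_mul_two_pi_mul_I, div_one]
  rw [h2, Complex.norm_exp_I_mul_ofReal_sub_one] at h
  have h3 := Real.mul_abs_le_abs_sin (x := φ' / 2) (by rw [abs_div, abs_two]; linarith)
  rw [norm_mul, Real.norm_eq_abs, Real.norm_eq_abs, abs_two] at h
  rw [abs_div, abs_two] at h3
  have h4 : 2 / Real.pi * |φ'| ≤ δ := by linarith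
  calc |φ'| = Real.pi / 2 * (2 / Real.pi * |φ'|) := by field_simp
    _ ≤ _ := by gcongr

set_option maxHeartbeats 2000000 in
theorem baker_app (u v : ℤ) (hv : 0 ≤ v) (huv : v < u) (hcop : IsCoprime u v) (hodd : Odd (u ^ 2 + v ^ 2))
    (h5 : 5 ≤ u ^ 2 + v ^ 2) (p : ℕ) (hp : p.Prime) (c : GaussianInt) (hc : c = ⟨1, 1⟩ ∨ c = ⟨1, -1⟩)
    (hIm : (((c * ⟨u, v⟩) ^ p).im) ^ 2 ≤ 2 ^ (p - 1) * 501 ^ 2) : p < 2 ^ 21 := by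
  by_contra hbig
  push Not at hbig
  set γ : GaussianInt := ⟨u, v⟩ with hγ
  have hnorm : γ.norm = u ^ 2 + v ^ 2 := by simp [hγ, Zsqrtd.norm]; ring
  have hodd2 : p % 2 = 1 := by
    rcases hp.eq_two_or_odd with h | h
    · rw [h] at hbig; norm_num at hbig
    · exact h
  -- complex w
  set g : ℂ := (γ : ℂ) with hg
  have hg1 : g = u + v * Complex.I := by rw [hg, hγ, GaussianInt.toComplex_def']
  have hgre : g.re = u := by rw [hg1]; simp
  have hgim : g.im = v := by rw [hg1]; simp
  have hur : (0:ℝ) < u := by exact_mod_cast (by omega : 0 < u)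
  have hvr : (0:ℝ) ≤ v := by exact_mod_cast hv
  have huvr : (v:ℝ) + 1 ≤ u := by exact_mod_cast huv
  have hg0 : g ≠ 0 := by
    intro h; rw [h] at hgre; simp at hgre; linarith
  have hgc0 : (starRingEnd ℂ) g ≠ 0 := by simpa using hg0
  set Y : ℝ := (u:ℝ) ^ 2 + (v:ℝ) ^ 2 with hY
  have hY5 : 5 ≤ Y := by rw [hY]; exact_mod_cast h5
  have hYn : ((γ.norm : ℤ) : ℝ) = Y := by rw [hnorm, hY]; push_cast; ring
  have hng : ‖g‖ ^ 2 = Y := by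
    rw [← Complex.normSq_eq_norm_sq, Complex.normSq_apply, hgre, hgim, hY]; ring
  set w : ℂ := g / (starRingEnd ℂ) g with hw
  have hw1 : ‖w‖ = 1 := by
    rw [hw, norm_div, RCLike.norm_conj, div_self (by simpa using hg0)]
  have hww : w * Y = g * g := by
    have : (Y : ℂ) = g * (starRingEnd ℂ) g := by
      rw [Complex.mul_conj, Complex.normSq_eq_norm_sq, hng]
    rw [this, hw]; field_simp
  have hY0 : (0:ℝ) < Y := by linarith
  have hwre : w.re * Y = u ^ 2 - v ^ 2 := by
    have := congrArg Complex.re hww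
    simp only [Complex.mul_re, Complex.ofReal_re, Complex.ofReal_im, hgre, hgim] at this
    linarith
  have hwim : w.im * Y = 2 * u * v := by
    have := congrArg Complex.im hww
    simp only [Complex.mul_im, Complex.ofReal_re, Complex.ofReal_im, hgre, hgim] at this
    linarith
  have hwre0 : 0 ≤ w.re := by
    by_contra h; push Not at h; nlinarith
  have hwim0 : 0 ≤ w.im := by
    by_contra h; push Not at h; nlinarith
  set ψ : ℝ := w.arg with hψd
  have hψ0 : 0 ≤ ψ := Complex.arg_nonneg_iff.2 hwim0
  have hψ1 : ψ ≤ Real.pi / 2 := (abs_le.1 (Complex.abs_arg_le_pi_div_two_iff.2 hwre0)).2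
  have hwexp : w = Complex.exp (Complex.I * ψ) := by
    have := Complex.norm_mul_exp_arg_mul_I w
    rw [hw1] at this
    rw [mul_comm, ← hψd] at *
    simpa using this.symm
  have hψeq : g = (starRingEnd ℂ) g * Complex.exp (Complex.I * ψ) := by
    rw [← hwexp, hw]; field_simp
  -- Z
  set E : ℝ := Real.exp (-(p * (Real.log γ.norm / 2))) with hE
  have hE0 : 0 < E := Real.exp_pos _
  have hEsq : E ^ 2 * Y ^ p = 1 := by
    have : Y ^ p = Real.exp (p * Real.log Y) := by
      rw [mul_comm, Real.exp_mul, Real.exp_log hY0, Real.rpow_natCast]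
    rw [this, hE, hYn, ← Real.exp_nat_mul, ← Real.exp_add]
    rw [Real.exp_eq_one_iff]; push_cast; ring
  set C : ℂ := (c : ℂ) with hC
  have hCη : ∃ η : ℤ, (η = 1 ∨ η = -1) ∧ C = 1 + η * Complex.I := by
    rcases hc with h | h
    · exact ⟨1, Or.inl rfl, by rw [hC, h, GaussianInt.toComplex_def']; simp⟩
    · exact ⟨-1, Or.inr rfl, by rw [hC, h, GaussianInt.toComplex_def']; simp⟩
  obtain ⟨η, hη, hCη⟩ := hCη
  have hη2 : (η:ℝ) ^ 2 = 1 := by rcases hη with h | h <;> rw [h] <;> norm_num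
  have hη2c : (η:ℂ) ^ 2 = 1 := by rcases hη with h | h <;> rw [h] <;> norm_num
  have hCc : (starRingEnd ℂ) C = 1 - η * Complex.I := by
    rw [hCη]; simp [Complex.conj_I]; ring
  have hCsq : ‖C‖ ^ 2 = 2 := by
    rw [← Complex.normSq_eq_norm_sq, Complex.normSq_apply, hCη]
    simp
    nlinarith
  have hC0 : C ≠ 0 := by
    intro h; rw [h] at hCsq; simp at hCsq
  have hCc0 : (starRingEnd ℂ) C ≠ 0 := by simpa using hC0
  have hCdiv : C / (starRingEnd ℂ) C = η * Complex.I := by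
    rw [div_eq_iff hCc0, hCc, hCη]
    linear_combination Complex.I ^ 2 * hη2c + Complex.I_sq
  set Z : ℂ := (C * g) ^ p with hZ
  have hZ0 : Z ≠ 0 := pow_ne_zero _ (mul_ne_zero hC0 hg0)
  have hZc0 : (starRingEnd ℂ) Z ≠ 0 := by simpa using hZ0
  have hZn : ‖Z‖ ^ 2 = 2 ^ p * Y ^ p := by
    rw [hZ, norm_pow, ← pow_mul, mul_comm p 2, pow_mul, norm_mul, mul_pow, hCsq, hng, mul_pow]
  have hZcast : Z = (((c * γ) ^ p : GaussianInt) : ℂ) := by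
    rw [hZ, hC, hg]; simp only [map_pow, map_mul]
  have hZim : Z.im = ((((c * γ) ^ p).im : ℤ) : ℝ) := by
    rw [hZcast]; simp
  have hZim2 : Z.im ^ 2 ≤ 2 ^ (p - 1) * 501 ^ 2 := by
    rw [hZim]; exact_mod_cast hIm
  have hquot : Z / (starRingEnd ℂ) Z = (η * Complex.I) ^ p * w ^ p := by
    rw [hZ, map_pow, map_mul, ← hCdiv, hw, ← mul_pow, ← div_pow]
    congr 1
    field_simp
  have hclose : ‖(η * Complex.I) ^ p * w ^ p - 1‖ ≤ 709 * E := by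
    rw [← hquot]
    have e1 : Z / (starRingEnd ℂ) Z - 1 = (2 * Z.im * Complex.I) / (starRingEnd ℂ) Z := by
      have := Complex.sub_conj Z
      push_cast at this
      rw [← this]; field_simp
    rw [e1, norm_div, RCLike.norm_conj, norm_mul, norm_mul, Complex.norm_I, mul_one, Complex.norm_real, Complex.norm_ofNat]
    rw [div_le_iff₀ (by positivity), Real.norm_eq_abs]
    apply le_of_sq_le_sq _ (by positivity)
    rw [mul_pow, sq_abs, mul_pow, hZn, mul_pow]
    have e2 : (2:ℝ) ^ p = 2 * 2 ^ (p - 1) := by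
      rw [← pow_succ']; congr 1; omega
    have e3 : (709:ℝ) ^ 2 * E ^ 2 * (2 ^ p * Y ^ p) = 709 ^ 2 * 2 * 2 ^ (p - 1) * (E ^ 2 * Y ^ p) := by
      rw [e2]; ring
    rw [e3, hEsq]
    have : (0:ℝ) < 2 ^ (p - 1) := by positivity
    linarith
  have hσ : ∃ σ : ℤ, (σ = 1 ∨ σ = -1) ∧ (η * Complex.I) ^ p = Complex.exp (Complex.I * ((σ * (Real.pi / 2) : ℝ) : ℂ)) := by
    have f1 : (1:ℂ) * Complex.I = Complex.exp (Complex.I * (((1:ℤ) * (Real.pi / 2) : ℝ) : ℂ)) := by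
      rw [mul_comm Complex.I]; push_cast; rw [one_mul, one_mul, Complex.exp_pi_div_two_mul_I]
    have f2 : (-1:ℂ) * Complex.I = Complex.exp (Complex.I * (((-1:ℤ) * (Real.pi / 2) : ℝ) : ℂ)) := by
      rw [mul_comm Complex.I]; push_cast; rw [show (-1:ℂ) * (Real.pi / 2) * Complex.I = -(Real.pi / 2 * Complex.I) by ring, Complex.exp_neg, Complex.exp_pi_div_two_mul_I]; simp
    obtain ⟨k, hk⟩ : ∃ k, p = 2 * k + 1 := ⟨p / 2, by omega⟩
    have f3 : (η * Complex.I) ^ p = ((-1) ^ k * η) * Complex.I := by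
      rw [hk, pow_succ, pow_mul, mul_pow, hη2c, Complex.I_sq]; ring
    rw [f3]
    have f4 : (-1) ^ k * (η:ℂ) = 1 ∨ (-1) ^ k * (η:ℂ) = -1 := by
      rcases neg_one_pow_eq_or ℂ k with h | h <;> rcases hη with h' | h' <;> rw [h, h'] <;> norm_num
    rcases f4 with h | h
    · exact ⟨1, Or.inl rfl, by rw [h]; exact f1⟩
    · exact ⟨-1, Or.inr rfl, by rw [h]; exact f2⟩
  obtain ⟨σ, hσ, hσe⟩ := hσ
  have hwp : w ^ p = Complex.exp (Complex.I * ((p * ψ : ℝ) : ℂ)) := by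
    rw [hwexp, ← Complex.exp_nat_mul]; congr 1; push_cast; ring
  rw [hσe, hwp, ← Complex.exp_add, ← mul_add, ← Complex.ofReal_add] at hclose
  obtain ⟨m, hm⟩ := exp_near_one _ _ hclose
  set ε : ℝ := σ * (Real.pi / 2) + p * ψ - 2 * Real.pi * m with hεd
  have hpi := Real.pi_pos
  have hpi2 : Real.pi < 3.1416 := Real.pi_lt_d4
  have hεE : |ε| ≤ 1600 * E := by
    refine hm.trans ?_
    nlinarith
  have hpr : (2097152:ℝ) ≤ p := by
    have : 2097152 ≤ p := le_trans (by norm_num) hbig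
    exact_mod_cast this
  have hEsmall : E * Y ≤ 1 / 3200 := by
    -- E ^ 2 * Y^p = 1, Y^(p-2) ≥ 5^p'
    have h1 : (5:ℝ) ^ 12 ≤ Y ^ (p - 2) := by
      calc (5:ℝ) ^ 12 ≤ Y ^ 12 := by gcongr
        _ ≤ Y ^ (p - 2) := pow_le_pow_right₀ (by linarith) (by
            have : 2097152 ≤ p := le_trans (by norm_num) hbig
            omega)
    have h2 : Y ^ p = Y ^ (p - 2) * Y ^ 2 := by
      rw [← pow_add]; congr 1
      have : 2097152 ≤ p := le_trans (by norm_num) hbig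
      omega
    rw [h2] at hEsq
    have h3 : (E * Y) ^ 2 * 5 ^ 12 ≤ 1 := by
      calc (E * Y) ^ 2 * 5 ^ 12 ≤ (E * Y) ^ 2 * Y ^ (p - 2) := by gcongr
        _ = 1 := by rw [← hEsq]; ring
    apply le_of_sq_le_sq _ (by norm_num)
    norm_num at h3 ⊢
    linarith
  have hεsmall : |ε| ≤ 1 / 10 := by
    have : E * 5 ≤ E * Y := by gcongr
    linarith
  have hψ2 : p * ψ = ((4 * m - σ : ℤ) : ℝ) * Real.pi / 2 + ε := by
    rw [hεd]; push_cast; ring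
  have hε1 := abs_le.1 hεsmall
  have hpi3 : (3:ℝ) < Real.pi := Real.pi_gt_three
  set k : ℤ := 4 * m - σ with hk
  have hk0 : 0 ≤ k := by
    by_contra h
    have : (k:ℝ) ≤ -1 := by exact_mod_cast (by omega : k ≤ -1)
    nlinarith [mul_nonneg (by linarith : (0:ℝ) ≤ p) hψ0]
  have hkp : k ≤ p := by
    by_contra h
    have : (p:ℝ) + 1 ≤ k := by exact_mod_cast (by omega : (p:ℤ) + 1 ≤ k)
    have : (p:ℝ) * ψ ≤ p * (Real.pi / 2) := by gcongr
    nlinarith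
  obtain ⟨κ, hκ⟩ := Int.eq_ofNat_of_zero_le hk0
  have hκr : (k:ℝ) = (κ:ℝ) := by rw [hκ]; simp
  rw [hκr] at hψ2
  have hκp : κ ≤ p := by omega
  have hκodd : κ % 2 = 1 := by
    rcases hσ with h | h <;> omega
  have hκne : κ ≠ p := by
    intro h
    rw [h] at hψ2
    have e1 : ψ - Real.pi / 2 = ε / p := by
      field_simp; linarith
    have e2 : ‖w - Complex.I‖ ≤ |ε / p| := by
      have : w - Complex.I = Complex.I * (Complex.exp (Complex.I * ((ψ - Real.pi / 2 : ℝ) : ℂ)) - 1) := by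
        have : Complex.I * ((ψ - Real.pi / 2 : ℝ) : ℂ) = Complex.I * ψ - Real.pi / 2 * Complex.I := by
          push_cast; ring
        rw [this, Complex.exp_sub, Complex.exp_pi_div_two_mul_I, ← hwexp, mul_sub, mul_one, mul_div_cancel₀ _ Complex.I_ne_zero]
      rw [this, norm_mul, Complex.norm_I, one_mul, ← e1]
      exact Real.norm_exp_I_mul_ofReal_sub_one_le
    have e3 : |ε / p| ≤ |ε| := by
      rw [abs_div]
      apply div_le_self (abs_nonneg _)
      rw [abs_of_nonneg (by positivity)]; linarith
    have e4 : |w.re| ≤ ‖w - Complex.I‖ := by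
      have := Complex.abs_re_le_norm (w - Complex.I)
      simpa using this
    have e5 : 1 ≤ w.re * Y := by
      rw [hwre]; nlinarith
    have e6 : w.re ≤ 1600 * E := (le_abs_self _).trans (e4.trans (e2.trans (e3.trans hεE)))
    have e7 : w.re * Y ≤ 1600 * E * Y := by gcongr
    linarith
  have hcopκ : Nat.Coprime κ (4 * p) := by
    apply Nat.Coprime.mul_right
    · have : Nat.Coprime κ 2 := (Nat.coprime_two_right).2 (Nat.odd_iff.2 hκodd)
      exact Nat.Coprime.pow_right 2 this
    · refine (Nat.Coprime.symm ((Nat.Prime.coprime_iff_not_dvd hp).2 fun hd => ?_))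
      have := Nat.le_of_dvd (by omega) hd
      omega
  exact baker_num γ (by rw [hnorm]; exact h5) (root_ne u v hcop hodd h5) p κ ψ ε hψeq hψ2 hbig hκp hcopκ hεE

theorem unit_pow (ε : GaussianIntˣ) (p : ℕ) (hop : Odd p) : ∃ η : GaussianInt, (ε : GaussianInt) * η ^ p = 1 := by
  have h4 : (ε : GaussianInt) ^ 4 = 1 := by
    have := (Zsqrtd.norm_eq_one_iff (x := (ε : GaussianInt))).2 ε.isUnit
    obtain ⟨⟨a, b⟩, hε⟩ : ∃ z : GaussianInt, z = ε := ⟨_, rfl⟩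
    rw [← hε] at this ⊢
    have h1 : a * a + b * b = 1 := by
      have h2 : (0:ℤ) ≤ a * a + b * b := add_nonneg (mul_self_nonneg a) (mul_self_nonneg b)
      have h3 : (⟨a, b⟩ : GaussianInt).norm = a * a + b * b := by simp only [Zsqrtd.norm]; ring
      rw [h3] at this
      omega
    have ha : a ≤ 1 := by nlinarith
    have ha' : -1 ≤ a := by nlinarith
    have hb : b ≤ 1 := by nlinarith
    have hb' : -1 ≤ b := by nlinarith
    interval_cases a <;> interval_cases b <;> first | omega | decide
  obtain ⟨k, rfl⟩ := hop
  rcases Nat.even_or_odd k with ⟨i, rfl⟩ | ⟨i, rfl⟩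
  · refine ⟨ε ^ 3, ?_⟩
    have : (ε : GaussianInt) * (ε ^ 3) ^ (2 * (i + i) + 1) = ((ε : GaussianInt) ^ 4) ^ (3 * i + 1) := by ring
    rw [this, h4, one_pow]
  · refine ⟨ε, ?_⟩
    have : (ε : GaussianInt) * ε ^ (2 * (2 * i + 1) + 1) = ((ε : GaussianInt) ^ 4) ^ (i + 1) := by ring
    rw [this, h4, one_pow]

theorem descent0 (x a y : ℕ) (j : ℕ) (hxa : Nat.Coprime x a) (hx : Odd x) (ha : Odd a) (hy : Odd y)
    (heq : x ^ 2 + a ^ 2 = 2 * y ^ (2 * j + 1)) :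
    ∃ T S : ℤ, (⟨T, S⟩ : GaussianInt) ^ (2 * j + 1) = 2 ^ j * ⟨x, a⟩ := by
  obtain ⟨e, rfl⟩ := hx
  obtain ⟨f, rfl⟩ := ha
  obtain ⟨b, hb⟩ : ∃ b : ℤ, b = e + f + 1 := ⟨_, rfl⟩
  obtain ⟨c, hc⟩ : ∃ c : ℤ, c = f - e := ⟨_, rfl⟩
  have hbc : b ^ 2 + c ^ 2 = (y : ℤ) ^ (2 * j + 1) := by
    have : ((2 * e + 1 : ℤ)) ^ 2 + (2 * f + 1) ^ 2 = 2 * y ^ (2 * j + 1) := by exact_mod_cast heq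
    rw [hb, hc]; linarith
  have hcop : IsCoprime b c := by
    have h := Nat.isCoprime_iff_coprime.2 hxa
    obtain ⟨m, n, hmn⟩ := h
    refine ⟨m + n, n - m, ?_⟩
    rw [hb, hc]; push_cast at hmn; linarith
  have hodd : Odd (b ^ 2 + c ^ 2) := by rw [hbc]; exact_mod_cast hy.pow
  have hg := gauss_coprime b c hcop hodd
  have hmul : (⟨b, c⟩ : GaussianInt) * ⟨b, -c⟩ = (y : GaussianInt) ^ (2 * j + 1) := by
    have h2 : ((b ^ 2 + c ^ 2 : ℤ) : GaussianInt) = (y : GaussianInt) ^ (2 * j + 1) := by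
      rw [hbc]; push_cast; rfl
    rw [← h2]
    apply Zsqrtd.ext
    · rw [Zsqrtd.re_intCast]; simp; ring
    · rw [Zsqrtd.im_intCast]; simp; ring
  obtain ⟨d, ε, hd⟩ := exists_associated_pow_of_mul_eq_pow' hg hmul
  have hp : Odd (2 * j + 1) := ⟨j, rfl⟩
  -- (1+i)^(2 j + 1) = (1+i) (2 i)^j
  have h1i : (⟨1, 1⟩ : GaussianInt) ^ (2 * j + 1) = 2 ^ j * (⟨0, 1⟩ ^ j * ⟨1, 1⟩) := by
    rw [pow_succ, pow_mul, ← mul_assoc, ← mul_pow]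
    congr 2
  have hx' : (⟨1, 1⟩ : GaussianInt) * ⟨b, c⟩ = ⟨((2 * e + 1 : ℕ) : ℤ), ((2 * f + 1 : ℕ) : ℤ)⟩ := by
    ext <;> simp [hb, hc] <;> ring
  have hI : IsUnit (⟨0, 1⟩ : GaussianInt) := by
    rw [← Zsqrtd.norm_eq_one_iff]; decide
  obtain ⟨ι, hι⟩ := hI
  obtain ⟨η, hη⟩ := unit_pow (ι ^ j) (2 * j + 1) hp
  obtain ⟨η', hη'⟩ := unit_pow (ε⁻¹) (2 * j + 1) hp
  obtain ⟨⟨T, S⟩, hTS⟩ : ∃ z : GaussianInt, z = ⟨1, 1⟩ * d * η * η' := ⟨_, rfl⟩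
  refine ⟨T, S, ?_⟩
  rw [hTS, mul_pow, mul_pow, mul_pow, h1i, ← hx', ← hd, ← hι]
  have hε : (ε : GaussianInt) * (ε⁻¹ : GaussianIntˣ) = 1 := by simp
  have h5 : η' ^ (2 * j + 1) = ε := by
    linear_combination (ε : GaussianInt) * hη' - η' ^ (2 * j + 1) * hε
  rw [Units.val_pow_eq_pow_val] at hη
  rw [h5]
  linear_combination (2 ^ j * ⟨1, 1⟩ * d ^ (2 * j + 1) * ε) * hη

noncomputable def frc {α : Type} (n : ℕ) (k : ℕ → α) : α := Nat.rec (k 0) (fun n' _ => k (Nat.succ n')) n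

theorem frc_eq {α : Type} (n : ℕ) (k : ℕ → α) : frc n k = k n := by cases n <;> rfl

inductive SL | nil | cons (V W B a b : ℕ) (t : SL)

inductive ML | nil | cons (s mask : ℕ) (t : ML)

inductive DL | nil | cons (m P : ℕ) (t : DL)

/-- one step of all states -/
noncomputable def stepSL {R : Type} (m e : ℕ) (k : SL → ℕ → R) (l : SL) : SL → ℕ → R :=
  SL.rec (fun acc bits => k acc bits)
    (fun V W B a b _ ih acc bits =>
      frc (Nat.mod (Nat.add (Nat.mul V b) (Nat.mul W a)) m) fun c =>
      frc (Nat.lor bits (Nat.shiftLeft 1 (Nat.mod (Nat.mul e a) m))) fun bits' =>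
      ih (SL.cons V W B b c acc) bits') l

/-- initial states tau = n-1 .. 0 -/
noncomputable def initSL {R : Type} (m h : ℕ) (k : SL → R) (n : ℕ) : SL → R :=
  Nat.rec k (fun t ih acc =>
    frc (Nat.mod (Nat.add (Nat.mul t t) (Nat.sub m 1)) m) fun V =>
    frc (Nat.mod (Nat.mul (Nat.add (Nat.mul t t) 1) h) m) fun Y =>
    frc (Nat.mod (Nat.mul (Nat.sub m Y) Y) m) fun W =>
    frc (Nat.mod (Nat.add V Y) m) fun b =>
    ih (SL.cons V W b 1 b acc)) n

/-- check all states are initial -/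
noncomputable def okSL (l : SL) : Bool :=
  SL.rec true (fun _ _ B a b _ ih => cond (Nat.beq a 1) (cond (Nat.beq b B) ih false) false) l

noncomputable def runSL {R : Type} (m : ℕ) (k : ℕ → ℕ → SL → List ℕ → R) (P : ℕ) :
    ℕ → ℕ → SL → List ℕ → R :=
  Nat.rec (fun e e' st tab => k e e' st tab)
    (fun _ ih e e' st tab =>
      frc (Nat.sub m e) fun e'' =>
      stepSL m e (fun st' bits => ih e' e'' st' (bits :: tab)) st SL.nil 0) P

noncomputable def maskS {R : Type} (m s2 : ℕ) (k : ℕ → ℕ → R) (tab : List ℕ) : ℕ → ℕ → R :=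
  List.rec (fun f acc => k f acc)
    (fun x _ ih f acc =>
      frc (Nat.mod (Nat.mul f s2) m) fun f' =>
      frc (Nat.add (Nat.mul 2 acc) (Nat.mod (Nat.shiftRight x f') 2)) fun acc' =>
      ih f' acc') tab

noncomputable def tgt (s : ℕ) : ℕ :=
  cond (Nat.beq s 3) 5 (cond (Nat.beq s 5) 3 (cond (Nat.beq s 19) 3 (cond (Nat.beq s 71) 3 1)))

/-- apply the table of one modulus to all the masks; finished masks are dropped -/
noncomputable def applyML (m rep : ℕ) (tab : List ℕ) (k : ML → Bool) (l : ML) : ML → Bool :=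
  ML.rec k (fun s mask _ ih acc =>
    frc (Nat.mod (Nat.mul s s) m) fun s2 =>
    maskS m s2 (fun f g =>
      cond (Nat.beq f 1)
        (frc (Nat.land mask (Nat.mul g rep)) fun mask' =>
          cond (Nat.beq mask' (tgt s)) (ih acc) (ih (ML.cons s mask' acc)))
        (ih (ML.cons s mask acc))) tab 1 0) l

/-- the repunit with `n` ones at distance `P` -/
noncomputable def repU (P n : ℕ) : ℕ := Nat.div (Nat.sub (Nat.pow 2 (Nat.mul n P)) 1) (Nat.sub (Nat.pow 2 P) 1)

noncomputable def sieve (M : ℕ) (d : DL) : ML → Bool :=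
  DL.rec (fun l => ML.rec true (fun _ _ _ _ => false) l)
    (fun m P _ ih l =>
      frc (Nat.div (Nat.add m 1) 2) fun h =>
      initSL m h (fun st =>
        runSL m (fun e e' st' tab =>
          cond (and (and (Nat.beq e 1) (Nat.beq e' 1)) (and (okSL st') (and (Nat.ble 1 P) (Nat.beq (Nat.mod m 2) 1))))
            (frc (repU P (Nat.add (Nat.div M P) 1)) fun rep =>
              applyML m rep tab ih l ML.nil)
            false) P 1 1 st []) h SL.nil) d

def SL.Has (V W B a b : ℕ) : SL → Prop
  | .nil => False
  | .cons V' W' B' a' b' t => (V = V' ∧ W = W' ∧ B = B' ∧ a = a' ∧ b = b') ∨ SL.Has V W B a b t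

theorem stepSL_cons {R : Type} (m e : ℕ) (k : SL → ℕ → R) (V W B a b : ℕ) (t acc : SL) (bits : ℕ) :
    stepSL m e k (SL.cons V W B a b t) acc bits =
      stepSL m e k t (SL.cons V W B b ((V * b + W * a) % m) acc) (bits ||| (1 <<< (e * a % m))) := by
  have h : stepSL m e k (SL.cons V W B a b t) acc bits =
      frc (Nat.mod (Nat.add (Nat.mul V b) (Nat.mul W a)) m) fun c =>
      frc (Nat.lor bits (Nat.shiftLeft 1 (Nat.mod (Nat.mul e a) m))) fun bits' =>
      stepSL m e k t (SL.cons V W B b c acc) bits' := rfl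
  rw [h, frc_eq, frc_eq]
  rfl

theorem initSL_succ {R : Type} (m h : ℕ) (k : SL → R) (t V Y W B : ℕ) (acc : SL)
    (hV : V = (t * t + (m - 1)) % m) (hY : Y = ((t * t + 1) * h) % m) (hW : W = ((m - Y) * Y) % m)
    (hB : B = (V + Y) % m) :
    initSL m h k (t + 1) acc = initSL m h k t (SL.cons V W B 1 B acc) := by
  have h : initSL m h k (t + 1) acc =
    frc (Nat.mod (Nat.add (Nat.mul t t) (Nat.sub m 1)) m) fun V =>
    frc (Nat.mod (Nat.mul (Nat.add (Nat.mul t t) 1) h) m) fun Y =>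
    frc (Nat.mod (Nat.mul (Nat.sub m Y) Y) m) fun W =>
    frc (Nat.mod (Nat.add V Y) m) fun b =>
    initSL m h k t (SL.cons V W b 1 b acc) := rfl
  rw [h, frc_eq, frc_eq, frc_eq, frc_eq]
  subst hV hY
  subst hW hB
  rfl

theorem runSL_succ {R : Type} (m : ℕ) (k : ℕ → ℕ → SL → List ℕ → R) (P e e' : ℕ) (st : SL) (tab : List ℕ) :
    runSL m k (P + 1) e e' st tab =
      stepSL m e (fun st' bits => runSL m k P e' (m - e) st' (bits :: tab)) st SL.nil 0 := by
  have h : runSL m k (P + 1) e e' st tab = frc (Nat.sub m e) fun e'' =>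
      stepSL m e (fun st' bits => runSL m k P e' e'' st' (bits :: tab)) st SL.nil 0 := rfl
  rw [h, frc_eq]
  rfl

theorem maskS_cons {R : Type} (m s2 : ℕ) (k : ℕ → ℕ → R) (x : ℕ) (t : List ℕ) (f acc : ℕ) :
    maskS m s2 k (x :: t) f acc =
      maskS m s2 k t (f * s2 % m) (2 * acc + (x >>> (f * s2 % m)) % 2) := by
  have h : maskS m s2 k (x :: t) f acc =
      frc (Nat.mod (Nat.mul f s2) m) fun f' =>
      frc (Nat.add (Nat.mul 2 acc) (Nat.mod (Nat.shiftRight x f') 2)) fun acc' =>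
      maskS m s2 k t f' acc' := rfl
  rw [h, frc_eq, frc_eq]
  rfl

theorem stepSL_spec {R : Type} (m e : ℕ) (k : SL → ℕ → R) (l : SL) : ∀ (acc : SL) (bits : ℕ),
    ∃ acc' bits', stepSL m e k l acc bits = k acc' bits' ∧
      (∀ V W B a b, l.Has V W B a b → acc'.Has V W B b ((V * b + W * a) % m) ∧
        bits'.testBit (e * a % m) = true) ∧
      (∀ V W B a b, acc.Has V W B a b → acc'.Has V W B a b) ∧
      (∀ i, bits.testBit i = true → bits'.testBit i = true) := by
  induction l with
  | nil => exact fun acc bits => ⟨acc, bits, rfl, fun _ _ _ _ _ h => h.elim, fun _ _ _ _ _ h => h, fun _ h => h⟩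
  | cons V W B a b t ih =>
    intro acc bits
    obtain ⟨acc', bits', h1, h2, h3, h4⟩ := ih (SL.cons V W B b ((V * b + W * a) % m) acc)
      (bits ||| (1 <<< (e * a % m)))
    refine ⟨acc', bits', ?_, ?_, ?_, ?_⟩
    · rw [← h1, stepSL_cons]
    · rintro V' W' B' a' b' (⟨rfl, rfl, rfl, rfl, rfl⟩ | h)
      · refine ⟨h3 _ _ _ _ _ (Or.inl ⟨rfl, rfl, rfl, rfl, rfl⟩), h4 _ ?_⟩
        simp
      · exact h2 _ _ _ _ _ h
    · intro V' W' B' a' b' h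
      exact h3 _ _ _ _ _ (Or.inr h)
    · intro i h
      exact h4 i (by simp [h])

theorem initSL_spec {R : Type} (m h : ℕ) (k : SL → R) (n : ℕ) : ∀ acc : SL,
    ∃ acc', initSL m h k n acc = k acc' ∧
      (∀ t, t < n → ∃ V Y W B, acc'.Has V W B 1 B ∧ V = (t * t + (m - 1)) % m ∧
        Y = ((t * t + 1) * h) % m ∧ W = ((m - Y) * Y) % m ∧ B = (V + Y) % m) ∧
      (∀ V W B a b, acc.Has V W B a b → acc'.Has V W B a b) := by
  induction n with
  | zero => exact fun acc => ⟨acc, rfl, fun t ht => absurd ht (by omega), fun _ _ _ _ _ h => h⟩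
  | succ t ih =>
    intro acc
    obtain ⟨V, hV⟩ : ∃ V, V = (t * t + (m - 1)) % m := ⟨_, rfl⟩
    obtain ⟨Y, hY⟩ : ∃ Y, Y = ((t * t + 1) * h) % m := ⟨_, rfl⟩
    obtain ⟨W, hW⟩ : ∃ W, W = ((m - Y) * Y) % m := ⟨_, rfl⟩
    obtain ⟨B, hB⟩ : ∃ B, B = (V + Y) % m := ⟨_, rfl⟩
    obtain ⟨acc', h1, h2, h3⟩ := ih (SL.cons V W B 1 B acc)
    refine ⟨acc', ?_, ?_, ?_⟩
    · rw [← h1, initSL_succ m h k t V Y W B acc hV hY hW hB]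
    · intro u hu
      rcases Nat.lt_succ_iff_lt_or_eq.1 hu with hu | rfl
      · exact h2 u hu
      · exact ⟨V, Y, W, B, h3 _ _ _ _ _ (Or.inl ⟨rfl, rfl, rfl, rfl, rfl⟩), hV, hY, hW, hB⟩
    · intro V' W' B' a' b' h
      exact h3 _ _ _ _ _ (Or.inr h)

theorem okSL_spec (l : SL) (h : okSL l = true) (V W B a b : ℕ) (hh : l.Has V W B a b) : a = 1 ∧ b = B := by
  induction l with
  | nil => exact hh.elim
  | cons V' W' B' a' b' t ih =>
    change cond (Nat.beq a' 1) (cond (Nat.beq b' B') (okSL t) false) false = true at h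
    simp only [Bool.cond_false_right, Bool.and_eq_true] at h
    obtain ⟨h1, h2, h3⟩ := h
    rcases hh with ⟨rfl, rfl, rfl, rfl, rfl⟩ | hh
    · exact ⟨Nat.eq_of_beq_eq_true h1, Nat.eq_of_beq_eq_true h2⟩
    · exact ih h3 hh

def Fst (m V W : ℕ) (x : ℕ × ℕ) : ℕ × ℕ := (x.2, (V * x.2 + W * x.1) % m)
def Gst (m : ℕ) (x : ℕ × ℕ) : ℕ × ℕ := (x.2, m - x.1)

def tb : List ℕ → ℕ → ℕ
  | [], _ => 0
  | x :: t, j => if j = t.length then x else tb t j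

theorem runSL_spec {R : Type} (m : ℕ) (k : ℕ → ℕ → SL → List ℕ → R) (P : ℕ) : ∀ e e' st tab,
    ∃ st' tab', runSL m k P e e' st tab = k ((Gst m)^[P] (e, e')).1 ((Gst m)^[P] (e, e')).2 st' tab' ∧
      (∀ V W B a b, st.Has V W B a b →
        st'.Has V W B ((Fst m V W)^[P] (a, b)).1 ((Fst m V W)^[P] (a, b)).2 ∧
        ∀ i < P, (tb tab' (tab.length + i)).testBit
          (((Gst m)^[i] (e, e')).1 * ((Fst m V W)^[i] (a, b)).1 % m) = true) ∧
      (∀ i < tab.length, tb tab' i = tb tab i) ∧ tab'.length = tab.length + P := by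
  induction P with
  | zero => exact fun e e' st tab => ⟨st, tab, rfl, fun V W B a b h => ⟨h, by omega⟩, fun _ _ => rfl, rfl⟩
  | succ P ih =>
    intro e e' st tab
    obtain ⟨st1, bits, h1, h2, -, -⟩ := stepSL_spec m e
      (fun st' bits => runSL m k P e' (m - e) st' (bits :: tab)) st SL.nil 0
    obtain ⟨st', tab', g1, g2, g3, g4⟩ := ih e' (m - e) st1 (bits :: tab)
    refine ⟨st', tab', ?_, ?_, ?_, ?_⟩
    · rw [runSL_succ]
      exact h1.trans g1
    · intro V W B a b h
      obtain ⟨q1, q2⟩ := h2 _ _ _ _ _ h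
      obtain ⟨r1, r2⟩ := g2 _ _ _ _ _ q1
      refine ⟨r1, ?_⟩
      intro i hi
      cases i with
      | zero =>
        rw [Nat.add_zero, g3 _ (by simp)]
        simpa [tb] using q2
      | succ i =>
        have := r2 i (by omega)
        rw [List.length_cons, show tab.length + 1 + i = tab.length + (i + 1) by ring] at this
        exact this
    · intro i hi
      rw [g3 i (by simp; omega)]
      simp [tb, hi.ne]
    · rw [g4, List.length_cons]; ring

theorem maskS_spec {R : Type} (m s2 : ℕ) (k : ℕ → ℕ → R) (tab : List ℕ) : ∀ f acc,
    ∃ f' acc', maskS m s2 k tab f acc = k f' acc' ∧ f' ≡ f * s2 ^ tab.length [MOD m] ∧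
      (∀ j < tab.length, acc'.testBit j = (tb tab j).testBit (f * s2 ^ (tab.length - j) % m)) ∧
      (∀ j, tab.length ≤ j → acc'.testBit j = acc.testBit (j - tab.length)) := by
  induction tab with
  | nil => exact fun f acc => ⟨f, acc, rfl, by simp; rfl, by simp, by simp⟩
  | cons x t ih =>
    intro f acc
    obtain ⟨f', acc', h1, h2, h3, h4⟩ := ih (f * s2 % m) (2 * acc + (x >>> (f * s2 % m)) % 2)
    refine ⟨f', acc', ?_, ?_, ?_, ?_⟩
    · rw [← h1, maskS_cons]
    · refine h2.trans ?_
      rw [List.length_cons, pow_succ', ← mul_assoc]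
      exact Nat.ModEq.mul_right _ (Nat.mod_modEq _ _)
    · intro j hj
      rw [List.length_cons] at hj ⊢
      rcases Nat.lt_succ_iff_lt_or_eq.1 hj with hj | rfl
      · rw [h3 j hj]
        simp only [tb, hj.ne, if_false]
        congr 1
        have : t.length + 1 - j = (t.length - j) + 1 := by omega
        rw [this, pow_succ', ← mul_assoc]
        exact Nat.ModEq.mul_right _ (Nat.mod_modEq _ _)
      · rw [h4 _ le_rfl]
        simp only [tb, if_true, Nat.sub_self]
        rw [show t.length + 1 - t.length = 1 by omega, pow_one]
        rw [Nat.testBit_zero, Nat.testBit_eq_decide_div_mod_eq, Nat.shiftRight_eq_div_pow]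
        simp [Nat.add_mod, Nat.mul_mod]
    · intro j hj
      rw [List.length_cons] at hj ⊢
      rw [h4 j (by omega)]
      obtain ⟨i, rfl⟩ : ∃ i, j = t.length + 1 + i := ⟨j - (t.length + 1), by omega⟩
      rw [show t.length + 1 + i - t.length = i + 1 by omega, show t.length + 1 + i - (t.length + 1) = i by omega,
        Nat.testBit_succ]
      congr 1
      omega

def lseq {R : Type*} [CommRing R] (V Y : R) : ℕ → R
  | 0 => 1
  | 1 => V + Y
  | n + 2 => V * lseq V Y (n + 1) - Y ^ 2 * lseq V Y n

theorem lseq_map {R S : Type*} [CommRing R] [CommRing S] (f : R →+* S) (V Y : R) (j : ℕ) :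
    f (lseq V Y j) = lseq (f V) (f Y) j := by
  induction j using Nat.twoStepInduction with
  | zero => simp [lseq]
  | one => simp [lseq]
  | more n h1 h2 => simp [lseq, h1, h2]

theorem lseq_scale {R : Type*} [CommRing R] (c V Y : R) (j : ℕ) :
    lseq (c * V) (c * Y) j = c ^ j * lseq V Y j := by
  induction j using Nat.twoStepInduction with
  | zero => simp [lseq]
  | one => simp [lseq]; ring
  | more n h1 h2 => simp only [lseq, h1, h2]; ring

def sgn : ℕ → ℤ
  | 0 => 1
  | 1 => 1
  | n + 2 => - sgn n

theorem sgn_sq (j : ℕ) : sgn j * sgn j = 1 := by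
  induction j using Nat.twoStepInduction with
  | zero => simp [sgn]
  | one => simp [sgn]
  | more n h1 h2 => simpa [sgn] using h1

theorem Fst_iter (m V W B : ℕ) (v y : ZMod m) (hV : (V : ZMod m) = v) (hW : (W : ZMod m) = - y ^ 2)
    (hB : (B : ZMod m) = v + y) (j : ℕ) :
    ((((Fst m V W)^[j] (1, B)).1 : ℕ) : ZMod m) = lseq v y j ∧
    ((((Fst m V W)^[j] (1, B)).2 : ℕ) : ZMod m) = lseq v y (j + 1) := by
  induction j with
  | zero => simp [lseq, hB]
  | succ j ih =>
    rw [Function.iterate_succ_apply']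
    refine ⟨ih.2, ?_⟩
    simp only [Fst, ZMod.natCast_mod]
    push_cast
    rw [ih.1, ih.2, hV, hW]
    simp only [lseq]; ring

theorem Gst_iter (m : ℕ) (hm : 1 ≤ m) (j : ℕ) :
    ((((Gst m)^[j] (1, 1)).1 : ℕ) : ZMod m) = sgn j ∧
    ((((Gst m)^[j] (1, 1)).2 : ℕ) : ZMod m) = sgn (j + 1) ∧ ((Gst m)^[j] (1, 1)).1 ≤ m ∧
      ((Gst m)^[j] (1, 1)).2 ≤ m := by
  induction j with
  | zero => simp [sgn, hm]
  | succ j ih =>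
    rw [Function.iterate_succ_apply']
    refine ⟨ih.2.1, ?_, ih.2.2.2, Nat.sub_le _ _⟩
    simp only [Gst]
    rw [Nat.cast_sub ih.2.2.1, ih.1]
    simp [sgn]

/-- The property that the sieve works with. -/
def Good (s : ℕ) (j : ℕ) : Prop :=
  (2 * j + 1).Prime ∧ ∃ t Y : ℤ, 2 * Y = t ^ 2 + (s:ℤ) ^ 2 ∧ lseq (t ^ 2 - (s:ℤ) ^ 2) Y j = sgn j

theorem tile_spec (P : ℕ) (g : ℕ) (hg : g < 2 ^ P) (n : ℕ) : ∀ j < n * P,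
    (g * ∑ i ∈ Finset.range n, (2 ^ P) ^ i).testBit j = g.testBit (j % P) := by
  induction n with
  | zero => intro j hj; simp at hj
  | succ n ih =>
    intro j hj
    rw [Finset.sum_range_succ', pow_zero, mul_add, mul_one]
    have : ∑ k ∈ Finset.range n, ((2:ℕ) ^ P) ^ (k + 1) = 2 ^ P * ∑ k ∈ Finset.range n, (2 ^ P) ^ k := by
      rw [Finset.mul_sum]; exact Finset.sum_congr rfl fun _ _ => pow_succ' _ _
    rw [this, mul_left_comm, Nat.testBit_two_pow_mul_add _ hg]
    split_ifs with h
    · rw [Nat.mod_eq_of_lt h]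
    · rw [ih (j - P) (by rw [add_mul] at hj; omega)]
      rw [← Nat.mod_eq_sub_mod (by omega)]

theorem repU_eq (P n : ℕ) (hP : 1 ≤ P) : repU P n = ∑ i ∈ Finset.range n, (2 ^ P) ^ i := by
  rw [Nat.geomSum_eq (show 2 ≤ 2 ^ P by
    calc 2 = 2 ^ 1 := rfl
      _ ≤ 2 ^ P := Nat.pow_le_pow_right (by norm_num) hP), ← pow_mul, mul_comm P n]
  rfl

theorem repU_spec (M P g : ℕ) (hP : 1 ≤ P) (hg : g < 2 ^ P) (j : ℕ) (hj : j < M) :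
    (g * repU P (M / P + 1)).testBit j = g.testBit (j % P) := by
  rw [repU_eq _ _ hP]
  apply tile_spec P g hg
  have := Nat.lt_div_mul_add (a := M) (b := P) hP
  rw [add_mul, one_mul]; omega

/-- A table is valid for a modulus. -/
def TabOK (m P : ℕ) (tab : List ℕ) : Prop :=
  1 ≤ P ∧ tab.length = P ∧ ∀ τ < (m + 1) / 2, ∀ j : ℕ, ∃ A : ℕ,
    (A : ZMod m) = sgn j * lseq ((τ:ZMod m) ^ 2 - 1) (((τ : ZMod m) ^ 2 + 1) * ((m + 1) / 2 : ℕ)) j ∧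
    (tb tab (j % P)).testBit (A % m) = true

theorem tab_good (m P : ℕ) (hm : m % 2 = 1) (tab : List ℕ) (h : TabOK m P tab) (s j : ℕ) (hG : Good s j)
    (hs : (s * s % m) ^ P ≡ 1 [MOD m]) :
    (tb tab (j % P)).testBit ((s * s % m) ^ (P - j % P) % m) = true := by
  obtain ⟨hP, hlen, h⟩ := h
  obtain ⟨-, t, Y, hY, hl⟩ := hG
  have hm0 : 0 < m := by omega
  have : NeZero m := ⟨by omega⟩
  have hs1 : ((s:ZMod m) ^ 2) ^ P = 1 := by
    have := (ZMod.natCast_eq_natCast_iff _ _ _).2 hs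
    push_cast at this
    rw [ZMod.natCast_mod] at this
    push_cast at this
    rw [← this, sq]
  obtain ⟨si, hsi⟩ : ∃ si : ZMod m, (s:ZMod m) * si = 1 := by
    refine ⟨s * ((s:ZMod m) ^ 2) ^ (P - 1), ?_⟩
    rw [← hs1]
    obtain ⟨P', rfl⟩ : ∃ P', P = P' + 1 := ⟨P - 1, by omega⟩
    simp; ring
  set z : ZMod m := (t : ZMod m) * si with hz
  set τ : ℕ := z.valMinAbs.natAbs with hτ
  have hτlt : τ < (m + 1) / 2 := by
    have := ZMod.natAbs_valMinAbs_le z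
    omega
  have hτ2 : (τ : ZMod m) ^ 2 = z ^ 2 := by
    have h1 : ((z.valMinAbs : ℤ) : ZMod m) = z := ZMod.coe_valMinAbs z
    have h2 : ((τ:ℤ)) ^ 2 = z.valMinAbs ^ 2 := by rw [hτ]; exact Int.natAbs_sq _
    have h3 := congrArg (Int.cast : ℤ → ZMod m) h2
    push_cast at h3
    rw [h3]
  have hzt : (s:ZMod m) ^ 2 * z ^ 2 = (t:ZMod m) ^ 2 := by
    rw [hz]; linear_combination ((t:ZMod m)) ^ 2 * ((s:ZMod m) * si + 1) * hsi
  have h2 : (2 : ZMod m) * (((m + 1) / 2 : ℕ) : ZMod m) = 1 := by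
    have : 2 * ((m + 1) / 2) = m + 1 := by omega
    have := congrArg (Nat.cast : ℕ → ZMod m) this
    push_cast at this
    rw [this]; simp
  obtain ⟨A, hA, hbit⟩ := h τ hτlt j
  have hYz : (Y : ZMod m) = (s:ZMod m) ^ 2 * (((τ : ZMod m) ^ 2 + 1) * ((m + 1) / 2 : ℕ)) := by
    have := congrArg (Int.cast : ℤ → ZMod m) hY
    push_cast at this
    rw [hτ2]
    linear_combination (-(Y:ZMod m)) * h2 + (((m + 1) / 2 : ℕ) : ZMod m) * this - (((m + 1) / 2 : ℕ) : ZMod m) * hzt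
  have hVz : ((t ^ 2 - (s:ℤ) ^ 2 : ℤ) : ZMod m) = (s:ZMod m) ^ 2 * ((τ:ZMod m) ^ 2 - 1) := by
    push_cast; rw [hτ2]; linear_combination - hzt
  have hlz : lseq (R := ZMod m) ((s:ZMod m) ^ 2 * ((τ:ZMod m) ^ 2 - 1)) ((s:ZMod m) ^ 2 * (((τ : ZMod m) ^ 2 + 1) * ((m + 1) / 2 : ℕ))) j = sgn j := by
    rw [← hYz, ← hVz, ← hl]
    have := lseq_map (Int.castRingHom (ZMod m)) (t ^ 2 - (s:ℤ) ^ 2) Y j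
    simpa only [eq_intCast] using this.symm
  rw [lseq_scale] at hlz
  have hsg : ((sgn j : ℤ) : ZMod m) * sgn j = 1 := by exact_mod_cast congrArg (Int.cast : ℤ → ZMod m) (sgn_sq j)
  have hAj : (A : ZMod m) * ((s:ZMod m) ^ 2) ^ j = 1 := by
    rw [hA]; linear_combination (sgn j : ZMod m) * hlz + hsg
  have hjs : ((s:ZMod m) ^ 2) ^ j = ((s:ZMod m) ^ 2) ^ (j % P) := by
    conv_lhs => rw [← Nat.div_add_mod j P, pow_add, pow_mul, hs1, one_pow, one_mul]
  have hA2 : (A : ZMod m) = ((s:ZMod m) ^ 2) ^ (P - j % P) := by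
    have h4 : ((s:ZMod m) ^ 2) ^ (j % P) * ((s:ZMod m) ^ 2) ^ (P - j % P) = 1 := by
      rw [← pow_add, Nat.add_sub_cancel' (Nat.mod_lt _ hP).le, hs1]
    rw [hjs] at hAj
    linear_combination (((s:ZMod m) ^ 2) ^ (P - j % P)) * hAj - (A : ZMod m) * h4
  have : A % m = (s * s % m) ^ (P - j % P) % m := by
    apply (ZMod.natCast_eq_natCast_iff _ _ _).1
    rw [hA2]
    push_cast
    rw [ZMod.natCast_mod]
    push_cast
    rw [sq]
  rw [← this]
  exact hbit

theorem tab_of_run (m P : ℕ) (hm : m % 2 = 1) (hP : 1 ≤ P) (st st' : SL) (tab' : List ℕ)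
    (h1 : ∀ t, t < (m + 1) / 2 → ∃ V Y W B, st.Has V W B 1 B ∧ V = (t * t + (m - 1)) % m ∧
        Y = ((t * t + 1) * ((m + 1) / 2)) % m ∧ W = ((m - Y) * Y) % m ∧ B = (V + Y) % m)
    (h2 : ∀ V W B a b, st.Has V W B a b →
        st'.Has V W B ((Fst m V W)^[P] (a, b)).1 ((Fst m V W)^[P] (a, b)).2 ∧
        ∀ i < P, (tb tab' (([] : List ℕ).length + i)).testBit
          (((Gst m)^[i] (1, 1)).1 * ((Fst m V W)^[i] (a, b)).1 % m) = true)
    (h3 : tab'.length = ([] : List ℕ).length + P) (hok : okSL st' = true)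
    (he : ((Gst m)^[P] (1, 1)).1 = 1) (he' : ((Gst m)^[P] (1, 1)).2 = 1) : TabOK m P tab' := by
  refine ⟨hP, by simpa using h3, ?_⟩
  intro τ hτ j
  have hm1 : 1 ≤ m := by omega
  obtain ⟨V, Y, W, B, hst, hV, hY, hW, hB⟩ := h1 τ hτ
  obtain ⟨q1, q2⟩ := h2 _ _ _ _ _ hst
  obtain ⟨o1, o2⟩ := okSL_spec _ hok _ _ _ _ _ q1
  have hVz : (V : ZMod m) = (τ:ZMod m) ^ 2 - 1 := by
    rw [hV, ZMod.natCast_mod]; push_cast [Nat.cast_sub hm1]; simp; ring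
  have hYz : (Y : ZMod m) = ((τ : ZMod m) ^ 2 + 1) * ((m + 1) / 2 : ℕ) := by
    rw [hY, ZMod.natCast_mod]; push_cast; ring
  have hYm : Y ≤ m := by rw [hY]; exact (Nat.mod_lt _ hm1).le
  have hWz : (W : ZMod m) = - (Y:ZMod m) ^ 2 := by
    rw [hW, ZMod.natCast_mod]; push_cast [Nat.cast_sub hYm]; simp; ring
  have hBz : (B : ZMod m) = (V:ZMod m) + Y := by
    rw [hB, ZMod.natCast_mod]; push_cast; ring
  have pF : Function.IsPeriodicPt (Fst m V W) P (1, B) := Prod.ext o1 o2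
  have pG : Function.IsPeriodicPt (Gst m) P (1, 1) := Prod.ext he he'
  refine ⟨((Gst m)^[j] (1, 1)).1 * ((Fst m V W)^[j] (1, B)).1, ?_, ?_⟩
  · push_cast
    rw [(Gst_iter m hm1 j).1, (Fst_iter m V W B _ _ hVz (hYz ▸ hWz) (by rw [hBz, hYz, hVz]) j).1]
  · have := q2 (j % P) (Nat.mod_lt _ hP)
    rw [pF.iterate_mod_apply, pG.iterate_mod_apply] at this
    simpa using this

def ML.Mem (s : ℕ) : ML → Prop
  | .nil => False
  | .cons s' _ t => s = s' ∨ ML.Mem s t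

def MaskOK (M s mask : ℕ) : Prop := ∀ j < M, Good s j → mask.testBit j = true

def ML.AllOK (M : ℕ) : ML → Prop
  | .nil => True
  | .cons s mask t => MaskOK M s mask ∧ ML.AllOK M t

theorem applyML_spec (M m P : ℕ) (hm : m % 2 = 1) (tab : List ℕ) (hT : TabOK m P tab) (k : ML → Bool) (l : ML) :
    ∀ acc, l.AllOK M → acc.AllOK M → ∃ acc', applyML m (repU P (M / P + 1)) tab k l acc = k acc' ∧
      acc'.AllOK M ∧ ∀ s, l.Mem s ∨ acc.Mem s → acc'.Mem s ∨ MaskOK M s (tgt s) := by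
  induction l with
  | nil => exact fun acc _ h => ⟨acc, rfl, h, fun s hs => Or.inl (hs.resolve_left (fun h => h))⟩
  | cons s mask t ih =>
    intro acc hl hacc
    have hkeep : ∀ mask', MaskOK M s mask' → ∃ acc', applyML m (repU P (M / P + 1)) tab k t (ML.cons s mask' acc) = k acc' ∧
      acc'.AllOK M ∧ ∀ s', (ML.cons s mask t).Mem s' ∨ acc.Mem s' → acc'.Mem s' ∨ MaskOK M s' (tgt s') := by
      intro mask' hmask'
      obtain ⟨acc', h1, h2, h3⟩ := ih (ML.cons s mask' acc) hl.2 ⟨hmask', hacc⟩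
      refine ⟨acc', h1, h2, ?_⟩
      rintro s' ((rfl | h) | h)
      · exact h3 _ (Or.inr (Or.inl rfl))
      · exact h3 _ (Or.inl h)
      · exact h3 _ (Or.inr (Or.inr h))
    have hunf : applyML m (repU P (M / P + 1)) tab k (ML.cons s mask t) acc =
      frc (Nat.mod (Nat.mul s s) m) fun s2 =>
      maskS m s2 (fun f g =>
        cond (Nat.beq f 1)
        (frc (Nat.land mask (Nat.mul g (repU P (M / P + 1)))) fun mask' =>
          cond (Nat.beq mask' (tgt s)) (applyML m (repU P (M / P + 1)) tab k t acc)
            (applyML m (repU P (M / P + 1)) tab k t (ML.cons s mask' acc)))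
        (applyML m (repU P (M / P + 1)) tab k t (ML.cons s mask acc))) tab 1 0 := rfl
    rw [hunf, frc_eq]
    obtain ⟨f, g, h1, h2, h3, h4⟩ := maskS_spec m (Nat.mod (Nat.mul s s) m) (fun f g =>
        cond (Nat.beq f 1)
        (frc (Nat.land mask (Nat.mul g (repU P (M / P + 1)))) fun mask' =>
          cond (Nat.beq mask' (tgt s)) (applyML m (repU P (M / P + 1)) tab k t acc)
            (applyML m (repU P (M / P + 1)) tab k t (ML.cons s mask' acc)))
        (applyML m (repU P (M / P + 1)) tab k t (ML.cons s mask acc))) tab 1 0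
    rw [h1]
    cases hf : Nat.beq f 1 with
    | false => exact hkeep mask hl.1
    | true =>
      rw [cond_true, frc_eq]
      have hf1 : f = 1 := Nat.eq_of_beq_eq_true hf
      have hP := hT.1
      have hlen := hT.2.1
      rw [hf1, one_mul, hlen] at h2
      have hg : g < 2 ^ P := by
        apply Nat.lt_pow_two_of_testBit
        intro i hi
        rw [h4 i (by omega)]; simp
      have hmask' : MaskOK M s (Nat.land mask (Nat.mul g (repU P (M / P + 1)))) := by
        intro j hj hG
        change (mask &&& (g * repU P (M / P + 1))).testBit j = true
        rw [Nat.testBit_and, hl.1 j hj hG, Bool.true_and, repU_spec M P g hP hg j hj]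
        rw [h3 _ (by rw [hlen]; exact Nat.mod_lt _ hP), one_mul, hlen]
        exact tab_good m P hm tab hT s j hG h2.symm
      cases hb : Nat.beq (Nat.land mask (Nat.mul g (repU P (M / P + 1)))) (tgt s) with
      | false => exact hkeep _ hmask'
      | true =>
        rw [Nat.eq_of_beq_eq_true hb] at hmask'
        obtain ⟨acc', h1, h2, h3⟩ := ih acc hl.2 hacc
        refine ⟨acc', h1, h2, ?_⟩
        rintro s' ((rfl | h) | h)
        · exact Or.inr hmask'
        · exact h3 _ (Or.inl h)
        · exact h3 _ (Or.inr h)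

theorem sieve_spec (M : ℕ) (d : DL) : ∀ l : ML, sieve M d l = true → l.AllOK M → ∀ s, l.Mem s → MaskOK M s (tgt s) := by
  induction d with
  | nil =>
    intro l h _ s hs
    cases l with
    | nil => exact hs.elim
    | cons => exact absurd h (by simp [sieve])
  | cons m P d ih =>
    intro l h hl s hs
    have hunf : sieve M (DL.cons m P d) l = frc (Nat.div (Nat.add m 1) 2) fun h =>
      initSL m h (fun st =>
        runSL m (fun e e' st' tab =>
          cond (and (and (Nat.beq e 1) (Nat.beq e' 1)) (and (okSL st') (and (Nat.ble 1 P) (Nat.beq (Nat.mod m 2) 1))))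
            (frc (repU P (Nat.add (Nat.div M P) 1)) fun rep =>
              applyML m rep tab (sieve M d) l ML.nil)
            false) P 1 1 st []) h SL.nil := rfl
    rw [hunf, frc_eq] at h
    obtain ⟨st, h1, h2, -⟩ := initSL_spec m (Nat.div (Nat.add m 1) 2) (fun st =>
        runSL m (fun e e' st' tab =>
          cond (and (and (Nat.beq e 1) (Nat.beq e' 1)) (and (okSL st') (and (Nat.ble 1 P) (Nat.beq (Nat.mod m 2) 1))))
            (frc (repU P (Nat.add (Nat.div M P) 1)) fun rep =>
              applyML m rep tab (sieve M d) l ML.nil)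
            false) P 1 1 st []) (Nat.div (Nat.add m 1) 2) SL.nil
    rw [h1] at h
    obtain ⟨st', tab', g1, g2, -, g3⟩ := runSL_spec m (fun e e' st' tab =>
          cond (and (and (Nat.beq e 1) (Nat.beq e' 1)) (and (okSL st') (and (Nat.ble 1 P) (Nat.beq (Nat.mod m 2) 1))))
            (frc (repU P (Nat.add (Nat.div M P) 1)) fun rep =>
              applyML m rep tab (sieve M d) l ML.nil)
            false) P 1 1 st []
    rw [g1] at h
    rw [Bool.cond_eq_ite] at h
    split_ifs at h with hc
    simp only [Bool.and_eq_true] at hc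
    obtain ⟨⟨c1, c2⟩, c3, c4, c5⟩ := hc
    rw [frc_eq] at h
    have hP : 1 ≤ P := Nat.le_of_ble_eq_true c4
    have hm : m % 2 = 1 := Nat.eq_of_beq_eq_true c5
    have hT := tab_of_run m P hm hP st st' tab' h2 g2 g3 c3 (Nat.eq_of_beq_eq_true c1) (Nat.eq_of_beq_eq_true c2)
    obtain ⟨acc', k1, k2, k3⟩ := applyML_spec M m P hm tab' hT (sieve M d) l ML.nil hl trivial
    change applyML m (repU P (M / P + 1)) tab' (sieve M d) l ML.nil = true at h
    rw [k1] at h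
    rcases k3 s (Or.inl hs) with h' | h'
    · exact ih acc' h k2 s h'
    · exact h'

/-- base mask: coprimality -/
noncomputable def baseM {α : Type} (M : ℕ) (k : ℕ → α) (n : ℕ) : ℕ → α :=
  Nat.rec k (fun r ih acc =>
    frc (Nat.add (Nat.mul 2 r) 3) fun P =>
    frc (Nat.pow 2 (Nat.add r 1)) fun b =>
    frc (Nat.sub (Nat.sub (Nat.pow 2 P) 1) b) fun g =>
    frc (Nat.land acc (Nat.lor (Nat.mul g (repU P (Nat.add (Nat.div M P) 1))) b)) ih) n

theorem baseM_spec {α : Type} (M : ℕ) (k : ℕ → α) (n : ℕ) : ∀ acc,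
    ∃ acc', baseM M k n acc = k acc' ∧ ∀ j < M, (2 * j + 1).Prime → acc.testBit j = true → acc'.testBit j = true := by
  induction n with
  | zero => exact fun acc => ⟨acc, rfl, fun _ _ _ h => h⟩
  | succ r ih =>
    intro acc
    have hunf : baseM M k (r + 1) acc = frc (Nat.add (Nat.mul 2 r) 3) fun P =>
      frc (Nat.pow 2 (Nat.add r 1)) fun b =>
      frc (Nat.sub (Nat.sub (Nat.pow 2 P) 1) b) fun g =>
      frc (Nat.land acc (Nat.lor (Nat.mul g (repU P (Nat.add (Nat.div M P) 1))) b)) (baseM M k r) := rfl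
    rw [hunf, frc_eq, frc_eq, frc_eq, frc_eq]
    obtain ⟨acc', h1, h2⟩ := ih (Nat.land acc (Nat.lor (Nat.mul (Nat.sub (Nat.sub (Nat.pow 2 (Nat.add (Nat.mul 2 r) 3)) 1) (Nat.pow 2 (Nat.add r 1))) (repU (Nat.add (Nat.mul 2 r) 3) (Nat.add (Nat.div M (Nat.add (Nat.mul 2 r) 3)) 1))) (Nat.pow 2 (Nat.add r 1))))
    refine ⟨acc', h1, fun j hj hp ha => h2 j hj hp ?_⟩
    change (acc &&& ((2 ^ (2 * r + 3) - 1 - 2 ^ (r + 1)) * repU (2 * r + 3) (M / (2 * r + 3) + 1) ||| 2 ^ (r + 1))).testBit j = true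
    rw [Nat.testBit_and, ha, Bool.true_and, Nat.testBit_or, Bool.or_eq_true]
    have hg : 2 ^ (2 * r + 3) - 1 - 2 ^ (r + 1) < 2 ^ (2 * r + 3) := by
      have : 0 < 2 ^ (2 * r + 3) := by positivity
      exact Nat.lt_of_le_of_lt (Nat.sub_le _ _) (Nat.sub_lt this one_pos)
    rw [repU_spec M (2 * r + 3) _ (by omega) hg j hj]
    by_cases hjr : j % (2 * r + 3) = r + 1
    · right
      have hd : (2 * r + 3) ∣ 2 * j + 1 := by
        refine ⟨2 * (j / (2 * r + 3)) + 1, ?_⟩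
        have := Nat.div_add_mod j (2 * r + 3)
        rw [hjr] at this
        nlinarith
      have := (Nat.dvd_prime hp).1 hd
      have : j = r + 1 := by omega
      rw [this]; simp
    · left
      have hlt : j % (2 * r + 3) < 2 * r + 3 := Nat.mod_lt _ (by omega)
      rw [Nat.sub_sub, add_comm 1, Nat.testBit_two_pow_sub_succ (Nat.pow_lt_pow_right (by norm_num) (by omega))]
      simp [hlt]
      rw [Nat.testBit_two_pow]
      simp; omega

def mkDL : List (ℕ × ℕ) → DL
  | [] => .nil
  | x :: t => .cons x.1 x.2 (mkDL t)

noncomputable def mkML (mask : ℕ) (l : List ℕ) : ML := List.rec ML.nil (fun s _ ih => ML.cons s mask ih) l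

def modDL : DL := mkDL [(5,4),(17,8),(9,12),(13,12),(41,20),(7,24),(29,28),(27,36),(37,36),(73,36),(89,44),(97,48),(53,52),
  (113,56),(11,60),(61,60),(137,68),(193,96),(101,100),(109,108),(233,116),(241,120),(257,128),(281,140),(149,148),(157,156),
  (313,156),(337,168),(173,172),(353,176),(181,180),(197,196),(401,200),(409,204),(433,216),(449,224),(229,228),(457,228),
  (521,260),(269,268),(277,276),(569,284),(577,288),(293,292),(593,296),(601,300),(617,308),(317,316)]

def sList : List ℕ := [3,5,7,9,11,13,17,19,23,25,27,29,31,37,41,43,47,49,53,59,61,67,71,73,79,81,83,89,97,101,103,107,109,113,121,125,127,131,137,139,149,151,157,163,167,169,173,179,181,191,193,197,199,211,223,227,229,233,239,241,243,251,257,263,269,271,277,281,283,289,293,307,311,313,317,331,337,343,347,349,353,359,361,367,373,379,383,389,397,401,409,419,421,431,433,439,443,449,457,461,463,467,479,487,491,499]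

/-- the statement checked by the kernel -/
def SieveRun (M : ℕ) (d : DL) (l : List ℕ) (n : ℕ) : Prop :=
  baseM M (fun mask => sieve M d (mkML mask l)) n (Nat.sub (Nat.pow 2 M) 1) = true

set_option maxRecDepth 1000000 in
theorem sieve_run : SieveRun 1048576 modDL sList 199 := by
  delta SieveRun
  decide +kernel

theorem lseq_im (T S Y : ℤ) (h : T ^ 2 + S ^ 2 = 2 * Y) (n : ℕ) :
    ((⟨T, S⟩ : GaussianInt) ^ (2 * n + 1)).im = S * 2 ^ n * lseq (T ^ 2 - S ^ 2) Y n := by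
  have key : ∀ n, (⟨T, S⟩ : GaussianInt) ^ (2 * (n + 2) + 1) =
      (2 * (T ^ 2 - S ^ 2) : ℤ) * (⟨T, S⟩ : GaussianInt) ^ (2 * (n + 1) + 1) - ((2 * Y) ^ 2 : ℤ) * (⟨T, S⟩ : GaussianInt) ^ (2 * n + 1) := by
    intro n
    have h4 : (⟨T, S⟩ : GaussianInt) ^ 4 = ((2 * (T ^ 2 - S ^ 2) : ℤ) : GaussianInt) * (⟨T, S⟩ : GaussianInt) ^ 2 - (((2 * Y) ^ 2 : ℤ) : GaussianInt) := by
      rw [← h]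
      have h2 : (⟨T, S⟩ : GaussianInt) ^ 2 = ⟨T ^ 2 - S ^ 2, 2 * T * S⟩ := by
        rw [pow_two]; apply Zsqrtd.ext
        · simp; ring
        · simp; ring
      have h3 : (⟨T, S⟩ : GaussianInt) ^ 4 = (⟨T, S⟩ ^ 2) ^ 2 := by ring
      rw [h3, h2, pow_two]
      apply Zsqrtd.ext
      · rw [Zsqrtd.re_sub, Zsqrtd.re_intCast, Zsqrtd.re_mul, Zsqrtd.re_mul, Zsqrtd.re_intCast, Zsqrtd.im_intCast]; ring
      · rw [Zsqrtd.im_sub, Zsqrtd.im_intCast, Zsqrtd.im_mul, Zsqrtd.im_mul, Zsqrtd.re_intCast, Zsqrtd.im_intCast]; ring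
    have h5 : (⟨T, S⟩ : GaussianInt) ^ (2 * (n + 2) + 1) = ⟨T, S⟩ ^ 4 * ⟨T, S⟩ ^ (2 * n + 1) := by ring
    rw [h5, h4]; ring
  induction n using Nat.twoStepInduction with
  | zero => simp [lseq]
  | one =>
    have h3 : (⟨T, S⟩ : GaussianInt) ^ (2 * 1 + 1) = ⟨T, S⟩ * ⟨T, S⟩ * ⟨T, S⟩ := by ring
    rw [h3]
    simp [lseq]
    linear_combination S * h
  | more n h1 h2 =>
    rw [key, Zsqrtd.im_sub, Zsqrtd.im_mul, Zsqrtd.im_mul, h1, h2, Zsqrtd.re_intCast, Zsqrtd.im_intCast, Zsqrtd.re_intCast, Zsqrtd.im_intCast]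
    simp only [lseq]; ring

theorem descent (x a y : ℕ) (j : ℕ) (hxy : Nat.Coprime x y) (ha : Odd a)
    (heq : x ^ 2 + a ^ 2 = 2 * y ^ (2 * j + 1)) :
    ∃ t s : ℕ, Odd t ∧ Odd s ∧ Nat.Coprime t s ∧ t ^ 2 + s ^ 2 = 2 * y ∧
      (lseq ((t:ℤ) ^ 2 - (s:ℤ) ^ 2) y j).natAbs * s = a := by
  have hx : Odd x := by
    rcases Nat.even_or_odd x with h | h
    · exfalso
      have h1 : Odd (x ^ 2 + a ^ 2) := (h.pow_of_ne_zero (by norm_num)).add_odd ha.pow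
      rw [heq] at h1
      exact absurd h1 (by simp)
    · exact h
  have hy : Odd y := by
    rcases Nat.even_or_odd y with ⟨r, hr⟩ | h
    · exfalso
      obtain ⟨e, rfl⟩ := hx
      obtain ⟨f, rfl⟩ := ha
      have h4 : 4 ∣ 2 * y ^ (2 * j + 1) := ⟨r * y ^ (2 * j), by rw [pow_succ]; nth_rw 2 [hr]; ring⟩
      rw [← heq] at h4
      ring_nf at h4
      omega
    · exact h
  have hxa : Nat.Coprime x a := by
    apply Nat.Coprime.symm
    refine Nat.coprime_of_dvd fun r hr h1 h2 => ?_
    have h3 : r ∣ 2 * y ^ (2 * j + 1) := by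
      rw [← heq]
      exact dvd_add (dvd_pow h2 (by norm_num)) (dvd_pow h1 (by norm_num))
    rcases (Nat.Prime.dvd_mul hr).1 h3 with h4 | h4
    · have := (Nat.prime_dvd_prime_iff_eq hr Nat.prime_two).1 h4
      subst this
      obtain ⟨f, rfl⟩ := ha
      omega
    · have h5 := hr.dvd_of_dvd_pow h4
      exact hr.one_lt.ne' (Nat.dvd_one.1 (hxy ▸ Nat.dvd_gcd h2 h5))
  obtain ⟨T, S, hTS⟩ := descent0 x a y j hxa hx ha hy heq
  have hn : (T ^ 2 + S ^ 2) ^ (2 * j + 1) = (2 * (y:ℤ)) ^ (2 * j + 1) := by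
    have h1 := congrArg Zsqrtd.norm hTS
    have h2 : ∀ (z : GaussianInt) n, (z ^ n).norm = z.norm ^ n := fun z n => map_pow Zsqrtd.normMonoidHom z n
    rw [Zsqrtd.norm_mul, h2, h2] at h1
    have h3 : (⟨T, S⟩ : GaussianInt).norm = T ^ 2 + S ^ 2 := by simp only [Zsqrtd.norm]; ring
    have h4 : (⟨x, a⟩ : GaussianInt).norm = 2 * (y:ℤ) ^ (2 * j + 1) := by
      have : ((x : ℤ)) ^ 2 + (a:ℤ) ^ 2 = 2 * y ^ (2 * j + 1) := by exact_mod_cast heq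
      rw [← this]
      simp only [Zsqrtd.norm]; ring
    have h5 : (2 : GaussianInt).norm = 4 := by decide
    rw [h3, h4, h5] at h1
    rw [h1, mul_pow, pow_succ 2, pow_mul]; norm_num; ring
  have hn2 : T ^ 2 + S ^ 2 = 2 * y := by
    have := (Odd.strictMono_pow (R := ℤ) (n := 2 * j + 1) ⟨j, rfl⟩).injective
    exact this hn
  have him := lseq_im T S y hn2 j
  rw [hTS] at him
  have hcast : ((2:GaussianInt) ^ j) = ((2 ^ j : ℤ) : GaussianInt) := by push_cast; rfl
  rw [hcast, Zsqrtd.im_mul, Zsqrtd.re_intCast, Zsqrtd.im_intCast] at him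
  have hL : S * lseq (T ^ 2 - S ^ 2) (y:ℤ) j = a := by
    have h2 : (2:ℤ) ^ j ≠ 0 := by positivity
    apply mul_left_cancel₀ h2
    linear_combination -him
  have hre : ((⟨T, S⟩ : GaussianInt) ^ (2 * j + 1)).re = 2 ^ j * x := by
    rw [hTS, hcast, Zsqrtd.re_mul, Zsqrtd.re_intCast, Zsqrtd.im_intCast]; ring
  have hSodd : Odd S := by
    have : Odd (S * lseq (T ^ 2 - S ^ 2) (y:ℤ) j) := by rw [hL]; exact_mod_cast ha
    exact (Int.odd_mul.1 this).1
  have hTodd : Odd T := by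
    rcases Int.even_or_odd T with h | h
    · exfalso
      have h1 : Odd (T ^ 2 + S ^ 2) := (h.pow_of_ne_zero (by norm_num)).add_odd hSodd.pow
      rw [hn2] at h1
      exact absurd h1 (by simp)
    · exact h
  have hcop : Nat.Coprime T.natAbs S.natAbs := by
    refine Nat.coprime_of_dvd fun r hr h1 h2 => ?_
    have h1' : (r:ℤ) ∣ T := Int.natCast_dvd.2 h1
    have h2' : (r:ℤ) ∣ S := Int.natCast_dvd.2 h2
    have hra : r ∣ a := by
      have : (r:ℤ) ∣ (a:ℤ) := by rw [← hL]; exact h2'.mul_right _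
      exact_mod_cast this
    have hr2 : r ≠ 2 := by
      rintro rfl
      obtain ⟨f, rfl⟩ := ha
      omega
    have hrx : r ∣ x := by
      have h3 : ((r:ℤ) : GaussianInt) ∣ ⟨T, S⟩ := by
        obtain ⟨u, rfl⟩ := h1'
        obtain ⟨v, rfl⟩ := h2'
        exact ⟨⟨u, v⟩, by apply Zsqrtd.ext <;> simp⟩
      have h4 : ((r:ℤ) : GaussianInt) ∣ ⟨T, S⟩ ^ (2 * j + 1) := dvd_pow h3 (by omega)
      have h5 := ((Zsqrtd.intCast_dvd _ _).1 h4).1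
      rw [hre] at h5
      have h6 : r ∣ 2 ^ j * x := by exact_mod_cast h5
      rcases (Nat.Prime.dvd_mul hr).1 h6 with h7 | h7
      · exact absurd ((Nat.prime_dvd_prime_iff_eq hr Nat.prime_two).1 (hr.dvd_of_dvd_pow h7)) hr2
      · exact h7
    exact hr.one_lt.ne' (Nat.dvd_one.1 (hxa ▸ Nat.dvd_gcd hrx hra))
  refine ⟨T.natAbs, S.natAbs, Int.natAbs_odd.2 hTodd, Int.natAbs_odd.2 hSodd, hcop, ?_, ?_⟩
  · zify
    rw [sq_abs, sq_abs]; exact hn2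
  · rw [Int.natCast_natAbs, Int.natCast_natAbs, sq_abs, sq_abs, mul_comm, ← Int.natAbs_mul, hL]
    simp


theorem lseq_mod_p (t s Y : ℤ) (hs : s ≠ 0) (h : t ^ 2 + s ^ 2 = 2 * Y) (j : ℕ) (hp : (2 * j + 1).Prime) :
    ((2 * j + 1 : ℕ) : ℤ) ∣ 2 ^ j * lseq (t ^ 2 - s ^ 2) Y j - (-1) ^ j * s ^ (2 * j) := by
  have him := lseq_im t s Y h j
  have h1 : (⟨t, s⟩ : GaussianInt) = (t : GaussianInt) + ⟨0, s⟩ := by apply Zsqrtd.ext <;> simp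
  obtain ⟨r, hr⟩ := exists_add_pow_prime_eq hp (t : GaussianInt) ⟨0, s⟩
  rw [← h1] at hr
  have h2 : (⟨0, s⟩ : GaussianInt) ^ (2 * j + 1) = ⟨0, (-1) ^ j * s ^ (2 * j + 1)⟩ := by
    have h3 : (⟨0, s⟩ : GaussianInt) ^ 2 = ((- s ^ 2 : ℤ) : GaussianInt) := by
      rw [pow_two]; apply Zsqrtd.ext
      · rw [Zsqrtd.re_intCast]; simp; ring
      · rw [Zsqrtd.im_intCast]; simp
    rw [pow_succ, pow_mul, h3, ← Int.cast_pow]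
    have e : (- s ^ 2) ^ j = (-1) ^ j * s ^ (2 * j) := by rw [neg_pow, pow_mul]
    rw [e]
    apply Zsqrtd.ext
    · rw [Zsqrtd.re_mul, Zsqrtd.re_intCast, Zsqrtd.im_intCast]; ring
    · rw [Zsqrtd.im_mul, Zsqrtd.re_intCast, Zsqrtd.im_intCast]; ring
  have h4 := congrArg Zsqrtd.im hr
  rw [him, h2, Zsqrtd.im_add, Zsqrtd.im_add, ← Int.cast_pow, Zsqrtd.im_intCast] at h4
  have h5 : (((2 * j + 1 : ℕ) : GaussianInt) * (t : GaussianInt) * ⟨0, s⟩ * r).im = ((2 * j + 1 : ℕ) : ℤ) * t * s * r.re := by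
    have : ((2 * j + 1 : ℕ) : GaussianInt) * (t : GaussianInt) = ((((2 * j + 1 : ℕ) : ℤ) * t : ℤ) : GaussianInt) := by
      rw [Int.cast_mul, Int.cast_natCast]
    rw [this, Zsqrtd.im_mul, Zsqrtd.im_mul, Zsqrtd.re_mul, Zsqrtd.re_intCast, Zsqrtd.im_intCast]; ring
  rw [h5] at h4
  refine ⟨t * r.re, ?_⟩
  apply mul_left_cancel₀ hs
  linear_combination h4

theorem chi_sgn (j : ℕ) : ZMod.χ₈' ((2 * j + 1 : ℕ) : ZMod 8) = sgn j := by
  induction j using Nat.twoStepInduction with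
  | zero => decide
  | one => decide
  | more n h1 h2 =>
    simp only [sgn, ← h1]
    have : ∀ z : ZMod 8, ZMod.χ₈' (z + 4) = - ZMod.χ₈' z := by decide
    rw [← this]
    congr 1
    push_cast
    ring

theorem sign_lemma (t s Y : ℤ) (h : t ^ 2 + s ^ 2 = 2 * Y) (j : ℕ) (hj : 1 ≤ j)
    (hp : (2 * j + 1).Prime) (hs : s ≠ 0) (hL : (lseq (t ^ 2 - s ^ 2) Y j).natAbs = 1) :
    lseq (t ^ 2 - s ^ 2) Y j = sgn j := by
  have h1 := lseq_mod_p t s Y hs h j hp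
  have : Fact (2 * j + 1).Prime := ⟨hp⟩
  have h2 : (2:ZMod (2 * j + 1)) ≠ 0 := by
    intro h2
    have : ((2:ℕ) : ZMod (2 * j + 1)) = 0 := by exact_mod_cast h2
    rw [ZMod.natCast_eq_zero_iff] at this
    have := Nat.le_of_dvd (by norm_num) this
    omega
  rw [← ZMod.intCast_zmod_eq_zero_iff_dvd] at h1
  push_cast at h1
  rw [sub_eq_zero] at h1
  set L := lseq (t ^ 2 - s ^ 2) Y j with hLd
  have hL' : L = 1 ∨ L = -1 := Int.natAbs_eq_iff.1 hL |>.imp (by simp) (by simp)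
  have hL2 : (L : ZMod (2 * j + 1)) ≠ 0 := by
    rcases hL' with h | h <;> rw [h] <;> simp
  have hs0 : (s : ZMod (2 * j + 1)) ≠ 0 := by
    intro h0
    rw [h0, zero_pow (by omega), mul_zero] at h1
    exact mul_ne_zero (pow_ne_zero _ h2) hL2 h1
  have hs1 : (s : ZMod (2 * j + 1)) ^ (2 * j) = 1 := by
    have := ZMod.pow_card_sub_one_eq_one hs0
    simpa using this
  rw [hs1, mul_one] at h1
  have h3 := legendreSym.eq_pow (2 * j + 1) (-2)
  rw [legendreSym.at_neg_two (by omega), chi_sgn, show (2 * j + 1) / 2 = j by omega] at h3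
  have h4 : (L : ZMod (2 * j + 1)) = (sgn j : ℤ) := by
    have e : ((sgn j : ℤ) : ZMod (2 * j + 1)) * (L : ZMod (2 * j + 1)) = 1 := by
      rw [h3]; push_cast
      rw [neg_pow, mul_assoc, h1, ← mul_pow]; simp
    have e2 : ((sgn j : ℤ) : ZMod (2 * j + 1)) * (sgn j : ℤ) = 1 := by exact_mod_cast congrArg (Int.cast : ℤ → ZMod (2 * j + 1)) (sgn_sq j)
    linear_combination (sgn j : ZMod (2 * j + 1)) * e - (L : ZMod (2 * j + 1)) * e2
  rw [← sub_eq_zero, ← Int.cast_sub, ZMod.intCast_zmod_eq_zero_iff_dvd] at h4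
  have hsg : sgn j = 1 ∨ sgn j = -1 := by
    have := sgn_sq j
    exact mul_self_eq_one_iff.1 this
  rcases hL' with h | h <;> rcases hsg with h' | h' <;> rw [h, h'] at h4 ⊢
  · have := Int.le_of_dvd (by norm_num) h4
    push_cast at this; omega
  · have := Int.le_of_dvd (by norm_num) ((dvd_neg.2 h4))
    push_cast at this; omega

theorem lseq_two (R : Type*) [CommRing R] (Y : R) (n : ℕ) : lseq (2 * Y) Y n = (2 * n + 1) * Y ^ n := by
  induction n using Nat.twoStepInduction with
  | zero => simp [lseq]
  | one => simp [lseq]; ring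
  | more n h1 h2 => simp only [lseq, h1, h2]; push_cast; ring

/-- If an odd prime `q` divides `s`, not `t`, and divides the value, then `q = 2 * j + 1`. -/
theorem q_eq_p (q : ℕ) (hq : q.Prime) (t s Y : ℤ) (h : t ^ 2 + s ^ 2 = 2 * Y) (j : ℕ) (hp : (2 * j + 1).Prime)
    (hs : (q:ℤ) ∣ s) (ht : ¬ (q:ℤ) ∣ t) (hL : (q:ℤ) ∣ lseq (t ^ 2 - s ^ 2) Y j) : q = 2 * j + 1 := by
  have : Fact q.Prime := ⟨hq⟩
  rw [← ZMod.intCast_zmod_eq_zero_iff_dvd] at hs ht hL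
  have h1 := lseq_map (Int.castRingHom (ZMod q)) (t ^ 2 - s ^ 2) Y j
  have hY : (t : ZMod q) ^ 2 = 2 * (Y : ZMod q) := by
    have := congrArg (Int.cast : ℤ → ZMod q) h
    push_cast at this
    rw [hs] at this
    rw [← this]; ring
  simp only [eq_intCast] at h1
  rw [hL] at h1
  push_cast at h1
  rw [hs, hY, show (2 * (Y:ZMod q) - 0 ^ 2) = 2 * Y by ring, lseq_two] at h1
  have hY0 : (Y : ZMod q) ≠ 0 := by
    intro h0
    rw [h0, mul_zero] at hY
    exact ht (pow_eq_zero_iff (by norm_num) |>.1 hY)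
  have h2 : (((2 * j + 1 : ℕ)) : ZMod q) = 0 := by
    rcases mul_eq_zero.1 h1.symm with h | h
    · push_cast; exact h
    · exact absurd h (pow_ne_zero _ hY0)
  rw [ZMod.natCast_eq_zero_iff] at h2
  exact (Nat.prime_dvd_prime_iff_eq hq hp).1 h2

/-- growth when `t` is large compared to `s` -/
theorem lseq_big (t s Y : ℝ) (hY : 0 < Y) (h : t ^ 2 + s ^ 2 = 2 * Y) (j : ℕ)
    (hb : 2 * (j:ℝ) ^ 2 * s ^ 2 ≤ 2 * Y) : Y ^ j ≤ lseq (t ^ 2 - s ^ 2) Y j := by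
  have hV : t ^ 2 - s ^ 2 = 2 * Y - 2 * s ^ 2 := by linarith
  rw [hV]
  set L := lseq (2 * Y - 2 * s ^ 2) Y with hL
  have hrec : ∀ n, L (n + 2) - Y * L (n + 1) = Y * (L (n + 1) - Y * L n) - 2 * s ^ 2 * L (n + 1) := by
    intro n; simp only [hL, lseq]; ring
  have key : ∀ n, n + 1 ≤ j → Y ^ n ≤ L n ∧ L n ≤ (2 * n + 1) * Y ^ n ∧
      L (n + 1) - Y * L n ≤ 2 * Y ^ (n + 1) ∧
      2 * Y ^ (n + 1) - 2 * s ^ 2 * (n + 1) ^ 2 * Y ^ n ≤ L (n + 1) - Y * L n ∧ Y ^ (n + 1) ≤ L (n + 1) := by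
    intro n
    induction n with
    | zero =>
      intro h1
      have h1' : (1:ℝ) ≤ j := by exact_mod_cast h1
      simp only [hL, lseq]
      refine ⟨by simp, by simp, ?_, ?_, ?_⟩
      · have := sq_nonneg s
        norm_num; linarith
      · norm_num
      · have : s ^ 2 ≤ (j:ℝ) ^ 2 * s ^ 2 := le_mul_of_one_le_left (sq_nonneg s) (one_le_pow₀ h1')
        simp; nlinarith
    | succ n ih =>
      intro h1
      obtain ⟨a1, a2, a3, a4, a5⟩ := ih (by omega)
      have hYn : 0 < Y ^ n := by positivity
      have hYn1 : Y ^ (n + 1) = Y * Y ^ n := pow_succ' _ _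
      have hYn2 : Y ^ (n + 2) = Y * Y ^ (n + 1) := pow_succ' _ _
      have hYp : 0 < Y ^ (n + 1) := by positivity
      have b2 : L (n + 1) ≤ (2 * (n + 1 : ℕ) + 1) * Y ^ (n + 1) := by
        push_cast
        nlinarith
      have hs2 := sq_nonneg s
      have b3 : L (n + 1 + 1) - Y * L (n + 1) ≤ 2 * Y ^ (n + 1 + 1) := by
        rw [hrec]
        have : Y * (L (n + 1) - Y * L n) ≤ Y * (2 * Y ^ (n + 1)) := by gcongr
        have : 0 ≤ 2 * s ^ 2 * L (n + 1) := by
          have : 0 ≤ L (n + 1) := hYp.le.trans a5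
          positivity
        nlinarith
      have b4 : 2 * Y ^ (n + 1 + 1) - 2 * s ^ 2 * ((n + 1 : ℕ) + 1) ^ 2 * Y ^ (n + 1) ≤ L (n + 1 + 1) - Y * L (n + 1) := by
        rw [hrec]
        have e1 : Y * (2 * Y ^ (n + 1) - 2 * s ^ 2 * (n + 1) ^ 2 * Y ^ n) ≤ Y * (L (n + 1) - Y * L n) := by gcongr
        have e2 : 2 * s ^ 2 * L (n + 1) ≤ 2 * s ^ 2 * ((2 * (n + 1 : ℕ) + 1) * Y ^ (n + 1)) := by gcongr
        have e3 : 2 * Y ^ (n + 1 + 1) - 2 * s ^ 2 * ((n + 1 : ℕ) + 1) ^ 2 * Y ^ (n + 1) =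
          Y * (2 * Y ^ (n + 1) - 2 * s ^ 2 * (n + 1) ^ 2 * Y ^ n) - 2 * s ^ 2 * ((2 * (n + 1 : ℕ) + 1) * Y ^ (n + 1)) := by
          push_cast; ring
        linarith
      refine ⟨a5, b2, b3, b4, ?_⟩
      have hn : ((n + 1 : ℕ) : ℝ) + 1 ≤ j := by exact_mod_cast h1
      have e4 : 2 * s ^ 2 * (((n + 1 : ℕ) : ℝ) + 1) ^ 2 ≤ 2 * Y := by
        calc 2 * s ^ 2 * (((n + 1 : ℕ) : ℝ) + 1) ^ 2 ≤ 2 * s ^ 2 * (j:ℝ) ^ 2 := by gcongr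
          _ ≤ 2 * Y := by linarith
      have e5 : 2 * s ^ 2 * (((n + 1 : ℕ) : ℝ) + 1) ^ 2 * Y ^ (n + 1) ≤ 2 * Y * Y ^ (n + 1) := by gcongr
      have e6 : Y * Y ^ (n + 1) ≤ Y * L (n + 1) := by gcongr
      have e7 : Y ^ (n + 1 + 1) = Y * Y ^ (n + 1) := pow_succ' _ _
      linarith
  cases j with
  | zero => simp [hL, lseq]
  | succ j => exact (key j le_rfl).2.2.2.2


noncomputable def run1 (N V W : ℕ) (n : ℕ) : ℕ → ℕ → Bool :=
  Nat.rec (fun _ _ => true) (fun _ ih a b => cond (Nat.ble a 501) false (cond (Nat.ble N (Nat.add a 501)) false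
    (frc (Nat.mod (Nat.add (Nat.mul V b) (Nat.mul W a)) N) fun c => ih b c))) n

theorem run1_spec (N V W : ℕ) (n : ℕ) : ∀ a b, run1 N V W n a b = true → ∀ i < n,
    501 < ((Fst N V W)^[i] (a, b)).1 ∧ ((Fst N V W)^[i] (a, b)).1 + 501 < N := by
  induction n with
  | zero => intro a b _ i hi; omega
  | succ n ih =>
    intro a b h i hi
    have hunf : run1 N V W (n + 1) a b = cond (Nat.ble a 501) false (cond (Nat.ble N (Nat.add a 501)) false
      (frc (Nat.mod (Nat.add (Nat.mul V b) (Nat.mul W a)) N) fun c => run1 N V W n b c)) := rfl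
    rw [hunf, frc_eq] at h
    by_cases h1 : Nat.ble a 501 = true
    · rw [h1] at h; exact absurd h (by simp)
    rw [Bool.not_eq_true] at h1
    rw [h1, cond_false] at h
    by_cases h2 : Nat.ble N (Nat.add a 501) = true
    · rw [h2] at h; exact absurd h (by simp)
    rw [Bool.not_eq_true] at h2
    rw [h2, cond_false] at h
    cases i with
    | zero =>
      have e1 : ¬ (a ≤ 501) := fun hh => by rw [Nat.ble_eq_true_of_le hh] at h1; exact absurd h1 (by simp)
      have e2 : ¬ (N ≤ a + 501) := fun hh => by rw [Nat.ble_eq_true_of_le hh] at h2; exact absurd h2 (by simp)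
      simp only [Function.iterate_zero, id]
      omega
    | succ i =>
      rw [Function.iterate_succ_apply]
      exact ih _ _ h i (by omega)

noncomputable def chk1 (T i0 n : ℕ) : Bool :=
  frc (Nat.sub (Nat.mul T T) 1) fun V =>
  frc (Nat.div (Nat.add (Nat.mul T T) 1) 2) fun Y =>
  frc (Nat.sub 18446744073709551616 (Nat.mul Y Y)) fun W =>
  frc ((Fst 18446744073709551616 V W)^[i0] (1, Nat.add V Y)).1 fun a =>
  frc ((Fst 18446744073709551616 V W)^[i0] (1, Nat.add V Y)).2 fun b =>
  run1 18446744073709551616 V W n a b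

theorem chk1_spec (T i0 n : ℕ) (hT : T ≤ 1000) (hT1 : T % 2 = 1) (h : chk1 T i0 n = true) (j : ℕ) (hj : i0 ≤ j) (hj2 : j < i0 + n)
    (Y : ℤ) (hY : (T:ℤ) ^ 2 + 1 = 2 * Y) : 501 < (lseq ((T:ℤ) ^ 2 - 1) Y j).natAbs := by
  simp only [chk1, frc_eq] at h
  have hh := run1_spec _ _ _ _ _ _ h (j - i0) (by omega)
  rw [Prod.mk.eta, ← Function.iterate_add_apply, show j - i0 + i0 = j by omega] at hh
  obtain ⟨u, rfl⟩ : ∃ u, T = 2 * u + 1 := ⟨T / 2, by omega⟩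
  have hYn : ((((2 * u + 1) * (2 * u + 1)).add 1).div 2 : ℕ) = 2 * u ^ 2 + 2 * u + 1 := by
    change ((2 * u + 1) * (2 * u + 1) + 1) / 2 = _
    have : (2 * u + 1) * (2 * u + 1) + 1 = (2 * u ^ 2 + 2 * u + 1) * 2 := by ring
    rw [this, Nat.mul_div_cancel _ (by norm_num)]
  have hVn : ((2 * u + 1) * (2 * u + 1)).sub 1 = 4 * u ^ 2 + 4 * u := by
    change (2 * u + 1) * (2 * u + 1) - 1 = _
    have : (2 * u + 1) * (2 * u + 1) = 4 * u ^ 2 + 4 * u + 1 := by ring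
    rw [this]; rfl
  have hYz : Y = 2 * u ^ 2 + 2 * u + 1 := by push_cast at hY; linarith
  change 501 < ((Fst _ (((2 * u + 1) * (2 * u + 1)).sub 1) (18446744073709551616 - ((((2 * u + 1) * (2 * u + 1)).add 1).div 2 : ℕ) * ((((2 * u + 1) * (2 * u + 1)).add 1).div 2 : ℕ)))^[j] (1, (((2 * u + 1) * (2 * u + 1)).sub 1) + ((((2 * u + 1) * (2 * u + 1)).add 1).div 2 : ℕ))).1 ∧ ((Fst _ (((2 * u + 1) * (2 * u + 1)).sub 1) (18446744073709551616 - ((((2 * u + 1) * (2 * u + 1)).add 1).div 2 : ℕ) * ((((2 * u + 1) * (2 * u + 1)).add 1).div 2 : ℕ)))^[j] (1, (((2 * u + 1) * (2 * u + 1)).sub 1) + ((((2 * u + 1) * (2 * u + 1)).add 1).div 2 : ℕ))).1 + 501 < _ at hh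
  rw [hYn, hVn] at hh
  have hW : (2 * u ^ 2 + 2 * u + 1) * (2 * u ^ 2 + 2 * u + 1) ≤ 18446744073709551616 := by
    have h1 : 2 * u ^ 2 + 2 * u + 1 ≤ 1000000 := by
      have h2 : u ≤ 499 := by omega
      have h3 : u ^ 2 ≤ 499 ^ 2 := Nat.pow_le_pow_left h2 2
      omega
    calc _ ≤ 1000000 * 1000000 := Nat.mul_le_mul h1 h1
      _ ≤ _ := by norm_num
  have hit := (Fst_iter 18446744073709551616 (4 * u ^ 2 + 4 * u) (18446744073709551616 - (2 * u ^ 2 + 2 * u + 1) * (2 * u ^ 2 + 2 * u + 1))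
    (4 * u ^ 2 + 4 * u + (2 * u ^ 2 + 2 * u + 1)) (((2 * u + 1 : ℕ) : ℤ) ^ 2 - 1 : ℤ) (Y : ℤ)
    (by push_cast; ring) (by rw [Nat.cast_sub hW, ZMod.natCast_self, hYz]; push_cast; ring) (by rw [hYz]; push_cast; ring) j).1
  set X := ((Fst 18446744073709551616 (4 * u ^ 2 + 4 * u) (18446744073709551616 - (2 * u ^ 2 + 2 * u + 1) * (2 * u ^ 2 + 2 * u + 1)))^[j] (1, 4 * u ^ 2 + 4 * u + (2 * u ^ 2 + 2 * u + 1))).1 with hX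
  have hm := lseq_map (Int.castRingHom (ZMod 18446744073709551616)) (((2 * u + 1 : ℕ) : ℤ) ^ 2 - 1) Y j
  simp only [eq_intCast] at hm
  rw [← hm] at hit
  have hd : ((18446744073709551616 : ℕ) : ℤ) ∣ (X : ℤ) - lseq (((2 * u + 1 : ℕ) : ℤ) ^ 2 - 1) Y j := by
    rw [← ZMod.intCast_zmod_eq_zero_iff_dvd]
    push_cast at hit ⊢
    rw [hit, sub_self]
  clear_value X
  generalize lseq (((2 * u + 1 : ℕ) : ℤ) ^ 2 - 1) Y j = Lv at hd ⊢
  obtain ⟨k, hk⟩ := hd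
  have hk' : (X : ℤ) - Lv = 18446744073709551616 * k := by exact_mod_cast hk
  clear hk hX hit hm hW hYz hVn hYn h
  by_contra hcon
  omega

set_option maxRecDepth 100000 in
theorem chk1_run : ∀ t < 88, chk1 (2 * t + 5) 2 124 = true := by decide +kernel
theorem chk1_run3 : chk1 3 5 121 = true := by decide +kernel

def LI (V Y2 B : ℤ) (j : ℕ) : ℤ := ((fun x : ℤ × ℤ => (x.2, V * x.2 - Y2 * x.1))^[j] (1, B)).1
theorem LI_eq (V Y Y2 B : ℤ) (h : Y2 = Y ^ 2) (hB : B = V + Y) (j : ℕ) : LI V Y2 B j = lseq V Y j := by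
  subst h hB
  have : ∀ j, (fun x : ℤ × ℤ => (x.2, V * x.2 - Y ^ 2 * x.1))^[j] (1, V + Y) = (lseq V Y j, lseq V Y (j + 1)) := by
    intro j
    induction j with
    | zero => simp [lseq]
    | succ j ih => rw [Function.iterate_succ_apply', ih]; simp only [lseq]
  rw [LI, this]

theorem LI_run : ∀ u < 125, ∀ x ∈ ([(3,1,1),(3,1,2),(3,1,3),(3,1,4),(3,2,1),(3,2,2),(3,2,3),(3,3,1),(3,3,2),(3,4,1),
    (5,1,1),(5,1,2),(5,2,1),(7,1,1),(7,1,2),(7,2,1),(11,1,1),(13,1,1),(17,1,1),(19,1,1)] : List (ℕ × ℕ × ℕ)),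
    (LI (((2*u+1)*(2*u+1) : ℕ) - ((x.1^x.2.1)*(x.1^x.2.1) : ℕ)) ((((2*u+1)*(2*u+1)+(x.1^x.2.1)*(x.1^x.2.1))/2)*(((2*u+1)*(2*u+1)+(x.1^x.2.1)*(x.1^x.2.1))/2) : ℕ)
      ((((2*u+1)*(2*u+1) : ℕ) - ((x.1^x.2.1)*(x.1^x.2.1) : ℕ)) + (((2*u+1)*(2*u+1)+(x.1^x.2.1)*(x.1^x.2.1))/2 : ℕ)) ((x.1 - 1) / 2)).natAbs = x.1 ^ x.2.2 →
    (u, x) = (0, 3, 1, 1) ∨ (u, x) = (2, 3, 2, 1) ∨ (2 * u + 1) % x.1 = 0 := by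
  decide +kernel


theorem nat_big (t s y j : ℕ) (hy : 0 < y) (h : t ^ 2 + s ^ 2 = 2 * y) (hb : j ^ 2 * s ^ 2 ≤ y) :
    y ^ j ≤ (lseq ((t:ℤ) ^ 2 - (s:ℤ) ^ 2) (y:ℤ) j).natAbs := by
  have hb' : (j:ℝ) ^ 2 * (s:ℝ) ^ 2 ≤ y := by exact_mod_cast hb
  have h1 := lseq_big t s y (by exact_mod_cast hy) (by exact_mod_cast h) j (by linarith)
  have h2 := lseq_map (Int.castRingHom ℝ) ((t:ℤ) ^ 2 - (s:ℤ) ^ 2) (y:ℤ) j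
  simp only [eq_intCast] at h2
  push_cast at h2
  rw [← h2] at h1
  have h3 : (y:ℤ) ^ j ≤ lseq ((t:ℤ) ^ 2 - (s:ℤ) ^ 2) (y:ℤ) j := by exact_mod_cast h1
  have h4 : ((y ^ j : ℕ) : ℤ) ≤ lseq ((t:ℤ) ^ 2 - (s:ℤ) ^ 2) (y:ℤ) j := by exact_mod_cast h3
  omega

theorem p_le (t y j a : ℕ) (hj : 1 ≤ j) (hp : (2 * j + 1).Prime) (h : t ^ 2 + 1 = 2 * y) (ha3 : 3 ≤ a) (ha : a ≤ 501) (hao : Odd a)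
    (hL : (lseq ((t:ℤ) ^ 2 - 1) (y:ℤ) j).natAbs = a) : j ≤ 125 := by
  have h1 := lseq_mod_p t 1 y (by norm_num) (by rw [one_pow]; exact_mod_cast h) j hp
  rw [one_pow, one_pow, mul_one] at h1
  set L := lseq ((t:ℤ) ^ 2 - 1) (y:ℤ) j with hLd
  have : Fact (2 * j + 1).Prime := ⟨hp⟩
  have h2 : (2:ZMod (2 * j + 1)) ≠ 0 := by
    intro h2
    have : ((2:ℕ) : ZMod (2 * j + 1)) = 0 := by exact_mod_cast h2
    rw [ZMod.natCast_eq_zero_iff] at this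
    have := Nat.le_of_dvd (by norm_num) this
    omega
  rw [← ZMod.intCast_zmod_eq_zero_iff_dvd] at h1
  push_cast at h1
  rw [sub_eq_zero] at h1
  have h3 : (2:ZMod (2 * j + 1)) ^ (2 * j) = 1 := by
    have := ZMod.pow_card_sub_one_eq_one h2
    simpa using this
  have h4 : (L : ZMod (2 * j + 1)) ^ 2 = 1 := by
    have e := congrArg (fun z => z ^ 2) h1
    rw [mul_pow, ← pow_mul, mul_comm j 2, h3, one_mul, ← pow_mul, mul_comm j 2, pow_mul] at e
    rw [e]; norm_num
  have h5 : ((2 * j + 1 : ℕ) : ℤ) ∣ ((a:ℤ) - 1) * (a + 1) := by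
    rw [← ZMod.intCast_zmod_eq_zero_iff_dvd]
    have e : (L ^ 2 : ℤ) = (a:ℤ) ^ 2 := by rw [← hL]; rw [Int.natCast_natAbs, sq_abs]
    have e' := congrArg (Int.cast : ℤ → ZMod (2 * j + 1)) e
    push_cast at e' ⊢
    rw [h4] at e'
    linear_combination -e'
  obtain ⟨b, rfl⟩ := hao
  have h6 : ((2 * j + 1 : ℕ) : ℤ) ∣ ((2 * (2 * b * (b + 1)) : ℕ) : ℤ) := by
    convert h5 using 1; push_cast; ring
  have h7 : (2 * j + 1) ∣ 2 * (2 * b * (b + 1)) := Int.natCast_dvd_natCast.1 h6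
  have hn2 : ¬ (2 * j + 1) ∣ 2 := fun hh => by have := Nat.le_of_dvd (by norm_num) hh; omega
  have h8 := ((Nat.Prime.dvd_mul hp).1 h7).resolve_left hn2
  rcases (Nat.Prime.dvd_mul hp).1 h8 with h9 | h9
  · have := Nat.le_of_dvd (by omega) (((Nat.Prime.dvd_mul hp).1 h9).resolve_left hn2)
    omega
  · have := Nat.le_of_dvd (by omega) h9
    omega

theorem caseA (t y j a : ℕ) (hj : 1 ≤ j) (hp : (2 * j + 1).Prime) (hto : Odd t) (ht : 3 ≤ t) (h : t ^ 2 + 1 = 2 * y) (ha3 : 3 ≤ a) (ha : a ≤ 501) (hao : Odd a)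
    (hL : (lseq ((t:ℤ) ^ 2 - 1) (y:ℤ) j).natAbs = a) : (j = 1 ∧ t ≤ 17) ∨ (t = 3 ∧ j ≤ 3) := by
  have hj2 := p_le t y j a hj hp h ha3 ha hao hL
  have hy : 0 < y := by nlinarith
  have ht2 : t < 180 := by
    by_contra hcon
    push Not at hcon
    have hyb : 16200 ≤ y := by nlinarith
    have hb := nat_big t 1 y j hy (by rw [one_pow]; exact h) (by nlinarith)
    simp only [Nat.cast_one, one_pow] at hb
    rw [hL] at hb
    have : y ^ 1 ≤ y ^ j := Nat.pow_le_pow_right hy hj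
    rw [pow_one] at this
    omega
  have hto' : t % 2 = 1 := Nat.odd_iff.1 hto
  have hYz : (t:ℤ) ^ 2 + 1 = 2 * (y:ℤ) := by exact_mod_cast h
  rcases Nat.lt_or_ge j 2 with h2 | h2
  · have : j = 1 := by omega
    subst this
    left
    refine ⟨rfl, ?_⟩
    simp only [lseq] at hL
    by_contra hcon
    have : 19 ≤ t := by omega
    have h3 : (19:ℤ) ≤ t := by exact_mod_cast this
    have h4 : (19:ℤ) ^ 2 ≤ (t:ℤ) ^ 2 := by gcongr
    omega
  · right
    rcases Nat.lt_or_ge t 4 with h4 | h4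
    · have : t = 3 := by omega
      subst this
      refine ⟨rfl, ?_⟩
      by_contra hcon
      rcases Nat.lt_or_ge j 5 with h5 | h5
      · have : j = 4 := by omega
        subst this
        exact absurd hp (by norm_num)
      · have := chk1_spec 3 5 121 (by norm_num) (by norm_num) chk1_run3 j h5 (by omega) y (by exact_mod_cast h)
        push_cast at this hL
        omega
    · exfalso
      obtain ⟨u, rfl⟩ : ∃ u, t = 2 * u + 5 := ⟨(t - 5) / 2, by omega⟩
      have := chk1_spec (2 * u + 5) 2 124 (by omega) (by omega) (chk1_run u (by omega)) j h2 (by omega) y hYz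
      omega

theorem caseB (q m k t y j : ℕ) (hq : q.Prime) (hoq : Odd q) (hqj : q = 2 * j + 1) (hk1 : 1 ≤ k) (hkm : k < m) (h501 : q ^ m ≤ 501)
    (hto : Odd t) (hqt : ¬ q ∣ t) (h : t ^ 2 + (q ^ k) ^ 2 = 2 * y)
    (hL : (lseq ((t:ℤ) ^ 2 - ((q ^ k : ℕ):ℤ) ^ 2) (y:ℤ) j).natAbs = q ^ (m - k)) :
    (q = 3 ∧ k = 1 ∧ m = 2 ∧ t = 1) ∨ (q = 3 ∧ k = 2 ∧ m = 3 ∧ t = 5) := by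
  have hq3 : 3 ≤ q := by
    rcases hq.two_le.lt_or_eq with h | h
    · exact h
    · rw [← h] at hoq; exact absurd hoq (by decide)
  have hq22 : q ≤ 22 := by
    have : q ^ 2 ≤ q ^ m := Nat.pow_le_pow_right (by omega) (by omega)
    nlinarith
  have hm5 : m ≤ 5 := by
    by_contra hcon
    have h1 : 3 ^ 6 ≤ 3 ^ m := Nat.pow_le_pow_right (by norm_num) (by omega)
    have h2 : 3 ^ m ≤ q ^ m := Nat.pow_le_pow_left hq3 m
    omega
  have hmem : (q, k, m - k) ∈ ([(3,1,1),(3,1,2),(3,1,3),(3,1,4),(3,2,1),(3,2,2),(3,2,3),(3,3,1),(3,3,2),(3,4,1),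
    (5,1,1),(5,1,2),(5,2,1),(7,1,1),(7,1,2),(7,2,1),(11,1,1),(13,1,1),(17,1,1),(19,1,1)] : List (ℕ × ℕ × ℕ)) ∧ (j * q ^ k) ^ 2 ≤ 31250 ∧ q ^ (m - k) ≤ 501 := by
    clear hL h hqt hto
    have hjq : j = (q - 1) / 2 := by omega
    subst hjq
    clear hqj
    interval_cases q <;> (first | (exfalso; revert hq; norm_num; done) | skip) <;>
      interval_cases m <;> (try omega) <;> interval_cases k <;> simp
  obtain ⟨hmem, hbd, hbd2⟩ := hmem
  have hj : 1 ≤ j := by omega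
  have hy : 0 < y := by
    have : 0 < q ^ k := by positivity
    nlinarith
  have ht : t < 250 := by
    by_contra hcon
    push Not at hcon
    have hyb : 31250 ≤ y := by nlinarith
    have hb := nat_big t (q ^ k) y j hy h (by rw [← mul_pow]; omega)
    rw [hL] at hb
    have : y ^ 1 ≤ y ^ j := Nat.pow_le_pow_right hy hj
    rw [pow_one] at this
    omega
  obtain ⟨u, rfl⟩ := hto
  have hy2 : y = ((2 * u + 1) * (2 * u + 1) + q ^ k * q ^ k) / 2 := by
    have : (2 * u + 1) * (2 * u + 1) + q ^ k * q ^ k = 2 * y := by rw [← h]; ring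
    omega
  have hLI := LI_run u (by omega) _ hmem
  simp only at hLI
  rw [← hy2] at hLI
  rw [LI_eq _ (y:ℤ) _ _ (by push_cast; ring) rfl, show (q - 1) / 2 = j by omega] at hLI
  have e1 : ((((2 * u + 1) * (2 * u + 1) : ℕ) : ℤ) - ((q ^ k * q ^ k : ℕ) : ℤ)) = ((2 * u + 1 : ℕ) : ℤ) ^ 2 - ((q ^ k : ℕ) : ℤ) ^ 2 := by
    push_cast; ring
  rw [e1] at hLI
  rcases hLI hL with h1 | h1 | h1
  · left; simp only [Prod.mk.injEq] at h1; omega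
  · right; simp only [Prod.mk.injEq] at h1; omega
  · exact absurd (Nat.dvd_of_mod_eq_zero h1) hqt

theorem fin_x (x x0 a y p : ℕ) (h : x ^ 2 + a ^ 2 = 2 * y ^ p) (h0 : x0 ^ 2 + a ^ 2 = 2 * y ^ p) : x = x0 := by
  have : x ^ 2 = x0 ^ 2 := by omega
  exact Nat.pow_left_injective (n := 2) (by norm_num) this


theorem sieve_gen (M : ℕ) (d : DL) (l : List ℕ) (n : ℕ)
    (hrun : SieveRun M d l n)
    (s : ℕ) (hs : s ∈ l) (j : ℕ) (hj : j < M) (hG : Good s j) : (tgt s).testBit j = true := by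
  unfold SieveRun at hrun
  obtain ⟨acc', h1, h2⟩ := baseM_spec M (fun mask => sieve M d (mkML mask l)) n (Nat.sub (Nat.pow 2 M) 1)
  rw [h1] at hrun
  have hok : ∀ s, MaskOK M s acc' := by
    intro s j hj hG
    refine h2 j hj hG.1 ?_
    change (2 ^ M - 1).testBit j = true
    rw [Nat.testBit_two_pow_sub_one]
    simpa using hj
  have hall : ∀ l : List ℕ, (mkML acc' l).AllOK M := by
    intro l
    induction l with
    | nil => exact trivial
    | cons a l ih => exact ⟨hok a, ih⟩
  have hmem : ∀ l : List ℕ, s ∈ l → (mkML acc' l).Mem s := by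
    intro l
    induction l with
    | nil => intro h; simp at h
    | cons a l ih =>
      intro h
      rcases List.mem_cons.1 h with h | h
      · exact Or.inl h
      · exact Or.inr (ih h)
  exact sieve_spec M d _ hrun (hall l) s (hmem l hs) j hj hG

theorem sieve_result (s : ℕ) (hs : s ∈ sList) (j : ℕ) (hj : j < 1048576) (hG : Good s j) : (tgt s).testBit j = true :=
  sieve_gen 1048576 modDL sList 199 sieve_run s hs j hj hG

theorem sList_prime : ∀ q < 502, (∃ d ∈ ([2,3,5,7,11,13,17,19] : List ℕ), q % d = 0 ∧ d < q) ∨ q ∈ sList ∨ q < 3 := by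
  decide +kernel

theorem mem_sList (q m : ℕ) (hq : q.Prime) (hoq : Odd q) (h3 : 3 ≤ q ^ m) (h501 : q ^ m ≤ 501) : q ^ m ∈ sList := by
  have hq3 : 3 ≤ q := by
    rcases hq.two_le.lt_or_eq with h | h
    · exact h
    · rw [← h] at hoq; exact absurd hoq (by decide)
  rcases Nat.lt_or_ge m 2 with hm | hm
  · interval_cases m
    · rw [pow_zero] at h3; omega
    · rw [pow_one] at *
      rcases sList_prime q (by omega) with ⟨d, hd, h1, h2⟩ | h | h
      · exfalso
        have hd2 : 2 ≤ d := by
          have : ∀ d ∈ ([2,3,5,7,11,13,17,19] : List ℕ), 2 ≤ d := by decide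
          exact this d hd
        have := (Nat.dvd_prime hq).1 (Nat.dvd_of_mod_eq_zero h1)
        omega
      · exact h
      · omega
  · have hq22 : q ≤ 22 := by
      have : q ^ 2 ≤ q ^ m := Nat.pow_le_pow_right (by omega) (by omega)
      nlinarith
    have hm5 : m ≤ 5 := by
      by_contra hcon
      have h1 : 3 ^ 6 ≤ 3 ^ m := Nat.pow_le_pow_right (by norm_num) (by omega)
      have h2 : 3 ^ m ≤ q ^ m := Nat.pow_le_pow_left hq3 m
      omega
    interval_cases q <;> (first | (exfalso; revert hq; norm_num; done) | skip) <;>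
      interval_cases m <;> (try omega) <;> simp [sList]

theorem p_bound (t s y j : ℕ) (hto : Odd t) (hso : Odd s) (hts : t ≠ s) (hcop : Nat.Coprime t s) (h : t ^ 2 + s ^ 2 = 2 * y)
    (hs : s ≤ 501) (hp : (2 * j + 1).Prime)
    (hL : (lseq ((t:ℤ) ^ 2 - (s:ℤ) ^ 2) (y:ℤ) j).natAbs = 1) : j < 1048576 := by
  have him := lseq_im t s y (by exact_mod_cast h) j
  have him' := lseq_im t (-s) y (by rw [neg_sq]; exact_mod_cast h) j
  rw [neg_sq] at him'
  set L := lseq ((t:ℤ) ^ 2 - (s:ℤ) ^ 2) (y:ℤ) j with hLd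
  have hL2 : L ^ 2 = 1 := by
    rw [← sq_abs, ← Int.natCast_natAbs, hL]; norm_num
  have hs2 : (s:ℤ) ^ 2 ≤ 501 ^ 2 := by
    have : (s:ℤ) ≤ 501 := by exact_mod_cast hs
    gcongr
  have hpow : (2:ℤ) ^ (2 * j + 1 - 1) = (2 ^ j) ^ 2 := by
    rw [Nat.add_sub_cancel, mul_comm, pow_mul]
  have hle : ((s:ℤ) * 2 ^ j * L) ^ 2 ≤ 2 ^ (2 * j + 1 - 1) * 501 ^ 2 := by
    rw [hpow, mul_pow, mul_pow, hL2, mul_one, mul_comm]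
    gcongr
  have hyodd : ∀ u v : ℤ, IsCoprime (u - v) (u + v) → Odd (u + v) → IsCoprime u v ∧ Odd (u ^ 2 + v ^ 2) := by
    intro u v h1 h2
    constructor
    · obtain ⟨m, n, hmn⟩ := h1
      exact ⟨m + n, n - m, by linear_combination hmn⟩
    · have : u ^ 2 + v ^ 2 = (u + v) ^ 2 - 2 * (u * v) := by ring
      rw [this]
      exact h2.pow.sub_even (even_two_mul _)
  have hcz : IsCoprime (t:ℤ) (s:ℤ) := Nat.isCoprime_iff_coprime.2 hcop
  have htz : Odd (t:ℤ) := by exact_mod_cast hto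
  have hsz : Odd (s:ℤ) := by exact_mod_cast hso
  have key : 2 * j + 1 < 2 ^ 21 := by
    rcases Nat.lt_or_ge t s with hlt | hge
    · obtain ⟨v, hv⟩ : ∃ v : ℤ, (s:ℤ) - t = 2 * v := by
        obtain ⟨v, hv⟩ := hsz.sub_odd htz
        exact ⟨v, by linarith⟩
      obtain ⟨u, hu⟩ : ∃ u : ℤ, u = t + v := ⟨_, rfl⟩
      have e1 : u - v = t := by linarith
      have e2 : u + v = s := by linarith
      obtain ⟨c1, c2⟩ := hyodd u v (by rw [e1, e2]; exact hcz) (by rw [e2]; exact hsz)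
      have ht1 : (1:ℤ) ≤ t := by exact_mod_cast hto.pos
      have hltz : (t:ℤ) < s := by exact_mod_cast hlt
      refine baker_app u v (by omega) (by omega) c1 c2 ?_ (2 * j + 1) hp ⟨1, 1⟩ (Or.inl rfl) ?_
      · have : 1 ≤ v := by omega
        have : 2 ≤ u := by omega
        nlinarith
      · have e : (⟨1, 1⟩ : GaussianInt) * ⟨u, v⟩ = ⟨t, s⟩ := by
          apply Zsqrtd.ext
          · simp; linarith
          · simp; linarith
        rw [e, him]
        exact hle
    · obtain ⟨v, hv⟩ : ∃ v : ℤ, (t:ℤ) - s = 2 * v := by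
        obtain ⟨v, hv⟩ := htz.sub_odd hsz
        exact ⟨v, by linarith⟩
      obtain ⟨u, hu⟩ : ∃ u : ℤ, u = s + v := ⟨_, rfl⟩
      have e1 : u - v = s := by linarith
      have e2 : u + v = t := by linarith
      obtain ⟨c1, c2⟩ := hyodd u v (by rw [e1, e2]; exact hcz.symm) (by rw [e2]; exact htz)
      have ht1 : (1:ℤ) ≤ s := by exact_mod_cast hso.pos
      have hltz : (s:ℤ) < t := by exact_mod_cast (lt_of_le_of_ne hge (Ne.symm hts))
      refine baker_app u v (by omega) (by omega) c1 c2 ?_ (2 * j + 1) hp ⟨1, -1⟩ (Or.inr rfl) ?_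
      · have : 1 ≤ v := by omega
        have : 2 ≤ u := by omega
        nlinarith
      · have e : (⟨1, -1⟩ : GaussianInt) * ⟨u, v⟩ = ⟨t, -s⟩ := by
          apply Zsqrtd.ext
          · simp; linarith
          · simp; linarith
        rw [e, him']
        have : (-(s:ℤ) * 2 ^ j * L) ^ 2 = ((s:ℤ) * 2 ^ j * L) ^ 2 := by ring
        rw [this]
        exact hle
  omega

theorem caseC (t s y j : ℕ) (hto : Odd t) (hso : Odd s) (hs3 : 3 ≤ s) (hsl : s ∈ sList) (hcop : Nat.Coprime t s) (h : t ^ 2 + s ^ 2 = 2 * y)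
    (hs : s ≤ 501) (hj : 1 ≤ j) (hp : (2 * j + 1).Prime)
    (hL : (lseq ((t:ℤ) ^ 2 - (s:ℤ) ^ 2) (y:ℤ) j).natAbs = 1) :
    (j = 1 ∧ ((s = 5 ∧ t = 3) ∨ (s = 19 ∧ t = 11) ∨ (s = 71 ∧ t = 41))) ∨ (j = 2 ∧ s = 3 ∧ t = 1) := by
  have hts : t ≠ s := by
    rintro rfl
    rw [Nat.coprime_self] at hcop
    omega
  have hjb := p_bound t s y j hto hso hts hcop h hs hp hL
  have hz : (t:ℤ) ^ 2 + (s:ℤ) ^ 2 = 2 * y := by exact_mod_cast h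
  have hsg := sign_lemma t s y hz j hj hp (by exact_mod_cast (show s ≠ 0 by omega)) hL
  have hG : Good s j := ⟨hp, t, y, hz.symm, hsg⟩
  have htb := sieve_result s hsl j hjb hG
  have hlt : ∀ n, n < 8 → n.testBit j = true → j < 3 := by
    intro n hn h1
    by_contra hcon
    have : n < 2 ^ j := lt_of_lt_of_le hn (by
      calc 8 = 2 ^ 3 := by norm_num
        _ ≤ 2 ^ j := Nat.pow_le_pow_right (by norm_num) (by omega))
    rw [Nat.testBit_lt_two_pow this] at h1
    exact absurd h1 (by simp)
  have htgt : (s = 3 ∧ tgt s = 5) ∨ ((s = 5 ∨ s = 19 ∨ s = 71) ∧ tgt s = 3) ∨ tgt s = 1 := by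
    by_cases e3 : s = 3
    · subst e3; exact Or.inl ⟨rfl, rfl⟩
    by_cases e5 : s = 5
    · subst e5; exact Or.inr (Or.inl ⟨by simp, rfl⟩)
    by_cases e19 : s = 19
    · subst e19; exact Or.inr (Or.inl ⟨by simp, rfl⟩)
    by_cases e71 : s = 71
    · subst e71; exact Or.inr (Or.inl ⟨by simp, rfl⟩)
    right; right
    have : ∀ n, s ≠ n → Nat.beq s n = false := fun n hn => by
      rw [Bool.eq_false_iff]; exact fun hh => hn (Nat.eq_of_beq_eq_true hh)
    simp [tgt, this 3 e3, this 5 e5, this 19 e19, this 71 e71]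
  rcases htgt with ⟨rfl, e⟩ | ⟨hs', e⟩ | e
  · rw [e] at htb
    have := hlt 5 (by norm_num) htb
    right
    interval_cases j
    · exact absurd htb (by decide)
    · refine ⟨rfl, rfl, ?_⟩
      simp only [lseq, sgn] at hsg
      have hyy : 2 * (y:ℤ) = t ^ 2 + 9 := by rw [← hz]; norm_num
      have e2 : 4 * ((t:ℤ) ^ 2 - (3:ℕ) ^ 2) * ((t:ℤ) ^ 2 - (3:ℕ) ^ 2 + y) - (2 * (y:ℤ)) ^ 2 = -4 := by
        linear_combination 4 * hsg
      have e3 : 2 * ((t:ℤ) ^ 2 - 9) * (3 * t ^ 2 - 9) - (t ^ 2 + 9) ^ 2 = -4 := by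
        rw [← hyy]
        push_cast at e2
        linear_combination e2 - 2 * (t ^ 2 - 9) * hyy
      have e4 : (t:ℤ) ^ 2 ≤ 20 := by nlinarith
      have e5 : t ≤ 4 := by
        have : t ^ 2 ≤ 20 := by exact_mod_cast e4
        nlinarith
      interval_cases t <;> first | rfl | (exfalso; revert e3; norm_num; done)
  · rw [e] at htb
    have := hlt 3 (by norm_num) htb
    left
    interval_cases j
    · refine ⟨rfl, ?_⟩
      simp only [lseq, sgn] at hsg
      have e2 : 3 * (t:ℤ) ^ 2 = (s:ℤ) ^ 2 + 2 := by linarith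
      have e3 : 3 * t ^ 2 = s ^ 2 + 2 := by exact_mod_cast e2
      rcases hs' with rfl | rfl | rfl
      · have : t ^ 2 = 3 ^ 2 := by omega
        have := Nat.pow_left_injective (n := 2) (by norm_num) this
        simp_all
      · have : t ^ 2 = 11 ^ 2 := by omega
        have := Nat.pow_left_injective (n := 2) (by norm_num) this
        simp_all
      · have : t ^ 2 = 41 ^ 2 := by omega
        have := Nat.pow_left_injective (n := 2) (by norm_num) this
        simp_all
    · exact absurd htb (by decide)
  · rw [e] at htb
    have := hlt 1 (by norm_num) htb
    interval_cases j <;> exact absurd htb (by decide)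

theorem small_qm_solutions (q m p x y : ℕ) (hq : Nat.Prime q) (hoq : Odd q)
    (h3 : 3 ≤ q ^ m) (h501 : q ^ m ≤ 501)
    (hx : 0 < x) (hy : 0 < y) (hcop : Nat.gcd x y = 1)
    (hp : Nat.Prime p) (hop : Odd p)
    (heq : x ^ 2 + q ^ (2 * m) = 2 * y ^ p) :
    (x, y, q, m, p) = (3, 5, 79, 1, 5) ∨ (x, y, q, m, p) = (9, 5, 13, 1, 3) ∨
    (x, y, q, m, p) = (13, 5, 3, 2, 3) ∨ (x, y, q, m, p) = (55, 13, 37, 1, 3) ∨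
    (x, y, q, m, p) = (79, 5, 3, 1, 5) ∨ (x, y, q, m, p) = (99, 17, 5, 1, 3) ∨
    (x, y, q, m, p) = (161, 25, 73, 1, 3) ∨ (x, y, q, m, p) = (249, 5, 307, 1, 7) ∨
    (x, y, q, m, p) = (351, 41, 11, 2, 3) ∨ (x, y, q, m, p) = (545, 53, 3, 3, 3) ∨
    (x, y, q, m, p) = (649, 61, 181, 1, 3) ∨ (x, y, q, m, p) = (1665, 113, 337, 1, 3) ∨
    (x, y, q, m, p) = (2431, 145, 433, 1, 3) ∨ (x, y, q, m, p) = (5291, 241, 19, 1, 3) ∨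
    (x, y, q, m, p) = (275561, 3361, 71, 1, 3) := by
  obtain ⟨j, rfl⟩ := hop
  have hj : 1 ≤ j := by
    rcases Nat.eq_zero_or_pos j with h | h
    · subst h; exact absurd hp (by norm_num)
    · exact h
  rw [mul_comm 2 m, pow_mul] at heq
  have hao : Odd (q ^ m) := hoq.pow
  obtain ⟨t, s, hto, hso, hts, hty, hLs⟩ := descent x (q ^ m) y j hcop hao heq
  have hprime : ∀ r : ℕ, r.Prime → q ^ m = r → q = r ∧ m = 1 := fun r hr h => (Nat.Prime.pow_eq_iff hr).1 h
  obtain ⟨k, hkm, rfl⟩ := (Nat.dvd_prime_pow hq).1 (Dvd.intro_left _ hLs)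
  have hL : (lseq ((t:ℤ) ^ 2 - ((q ^ k : ℕ):ℤ) ^ 2) (y:ℤ) j).natAbs = q ^ (m - k) := by
    have hpos : 0 < q ^ k := pow_pos hq.pos k
    apply Nat.eq_of_mul_eq_mul_right hpos
    rw [hLs, ← pow_add, Nat.sub_add_cancel hkm]
  rcases hkm.lt_or_eq with hlt | rfl
  · rcases Nat.eq_zero_or_pos k with hk | hk
    · subst hk
      simp only [pow_zero, Nat.cast_one, one_pow, Nat.sub_zero] at hL hty
      have ht3 : 3 ≤ t := by
        rcases Nat.lt_or_ge t 3 with h | h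
        · exfalso
          have h2 := Nat.odd_iff.1 hto
          have : t = 1 := by omega
          subst this
          have hy1 : y = 1 := by omega
          subst hy1
          rw [one_pow] at heq
          have : 3 ^ 2 ≤ (q ^ m) ^ 2 := Nat.pow_le_pow_left h3 2
          omega
        · exact h
      have hA := caseA t y j (q ^ m) hj hp hto ht3 hty h3 h501 hao hL
      have ht2 := Nat.odd_iff.1 hto
      rcases hA with ⟨rfl, ht17⟩ | ⟨rfl, hj3⟩
      · simp only [lseq] at hL
        have hL' : q ^ m + q ^ m + 1 = 3 * t ^ 2 := by
          have hz : (t:ℤ) ^ 2 + 1 = 2 * (y:ℤ) := by exact_mod_cast hty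
          have h9 : (3:ℤ) ^ 2 ≤ (t:ℤ) ^ 2 := by
            have : (3:ℤ) ≤ t := by exact_mod_cast ht3
            gcongr
          zify
          have : ((q ^ m : ℕ) : ℤ) = (t:ℤ) ^ 2 - 1 + y := by omega
          push_cast at this
          rw [this]; linarith
        interval_cases t
        · have ha : q ^ m = 13 := by omega
          have hy' : y = 5 := by omega
          obtain ⟨rfl, rfl⟩ := hprime 13 (by norm_num) ha
          subst hy'
          have := fin_x x 9 _ _ _ heq (by norm_num)
          subst this; simp
        · omega
        · have ha : q ^ m = 37 := by omega
          have hy' : y = 13 := by omega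
          obtain ⟨rfl, rfl⟩ := hprime 37 (by norm_num) ha
          subst hy'
          have := fin_x x 55 _ _ _ heq (by norm_num)
          subst this; simp
        · omega
        · have ha : q ^ m = 73 := by omega
          have hy' : y = 25 := by omega
          obtain ⟨rfl, rfl⟩ := hprime 73 (by norm_num) ha
          subst hy'
          have := fin_x x 161 _ _ _ heq (by norm_num)
          subst this; simp
        · omega
        · have ha : q ^ m = 11 ^ 2 := by omega
          have hy' : y = 41 := by omega
          have hq11 : q = 11 := by
            have h1 : 11 ∣ q ^ m := by rw [ha]; norm_num
            exact ((Nat.prime_dvd_prime_iff_eq (by norm_num) hq).1 (Nat.Prime.dvd_of_dvd_pow (by norm_num) h1)).symm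
          subst hq11
          have hm2 : m = 2 := Nat.pow_right_injective (le_refl 2 |>.trans (by norm_num)) ha
          subst hm2 hy'
          have := fin_x x 351 _ _ _ heq (by norm_num)
          subst this; simp
        · omega
        · have ha : q ^ m = 181 := by omega
          have hy' : y = 61 := by omega
          obtain ⟨rfl, rfl⟩ := hprime 181 (by norm_num) ha
          subst hy'
          have := fin_x x 649 _ _ _ heq (by norm_num)
          subst this; simp
        · omega
        · exfalso
          have ha : q ^ m = 253 := by omega
          have hq11 : q = 11 := by
            have h1 : 11 ∣ q ^ m := by rw [ha]; norm_num
            exact ((Nat.prime_dvd_prime_iff_eq (by norm_num) hq).1 (Nat.Prime.dvd_of_dvd_pow (by norm_num) h1)).symm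
          have hq23 : q = 23 := by
            have h1 : 23 ∣ q ^ m := by rw [ha]; norm_num
            exact ((Nat.prime_dvd_prime_iff_eq (by norm_num) hq).1 (Nat.Prime.dvd_of_dvd_pow (by norm_num) h1)).symm
          omega
        · omega
        · have ha : q ^ m = 337 := by omega
          have hy' : y = 113 := by omega
          obtain ⟨rfl, rfl⟩ := hprime 337 (by norm_num) ha
          subst hy'
          have := fin_x x 1665 _ _ _ heq (by norm_num)
          subst this; simp
        · omega
        · have ha : q ^ m = 433 := by omega
          have hy' : y = 145 := by omega
          obtain ⟨rfl, rfl⟩ := hprime 433 (by norm_num) ha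
          subst hy'
          have := fin_x x 2431 _ _ _ heq (by norm_num)
          subst this; simp
      · have hy' : y = 5 := by omega
        subst hy'
        interval_cases j
        · have ha : q ^ m = 13 := by rw [← hL]; simp [lseq]
          obtain ⟨rfl, rfl⟩ := hprime 13 (by norm_num) ha
          have := fin_x x 9 _ _ _ heq (by norm_num)
          subst this; simp
        · have ha : q ^ m = 79 := by rw [← hL]; simp [lseq]
          obtain ⟨rfl, rfl⟩ := hprime 79 (by norm_num) ha
          have := fin_x x 3 _ _ _ heq (by norm_num)
          subst this; simp
        · have ha : q ^ m = 307 := by rw [← hL]; simp [lseq]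
          obtain ⟨rfl, rfl⟩ := hprime 307 (by norm_num) ha
          have := fin_x x 249 _ _ _ heq (by norm_num)
          subst this; simp
    · have hqk : q ∣ q ^ k := dvd_pow_self q (by omega)
      have hqt : ¬ q ∣ t := fun h => hq.one_lt.ne' (Nat.dvd_one.1 (hts ▸ Nat.dvd_gcd h hqk))
      have hqL : (q:ℤ) ∣ lseq ((t:ℤ) ^ 2 - ((q ^ k : ℕ):ℤ) ^ 2) (y:ℤ) j := by
        rw [Int.natCast_dvd, hL]
        exact dvd_pow_self q (by omega)
      have hqp := q_eq_p q hq t ((q ^ k : ℕ) : ℤ) y (by exact_mod_cast hty) j hp (by exact_mod_cast hqk)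
        (by exact_mod_cast hqt) hqL
      rcases caseB q m k t y j hq hoq hqp hk hlt h501 hto hqt hty hL with ⟨rfl, rfl, rfl, rfl⟩ | ⟨rfl, rfl, rfl, rfl⟩
      · have hj1 : j = 1 := by omega
        have hy' : y = 5 := by omega
        subst hj1 hy'
        have := fin_x x 13 _ _ _ heq (by norm_num)
        subst this; simp
      · have hj1 : j = 1 := by omega
        have hy' : y = 53 := by omega
        subst hj1 hy'
        have := fin_x x 545 _ _ _ heq (by norm_num)
        subst this; simp
  · rw [Nat.sub_self, pow_zero] at hL
    rcases caseC t (q ^ k) y j hto hso h3 (mem_sList q k hq hoq h3 h501) hts hty h501 hj hp hL with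
      ⟨rfl, ⟨ha, rfl⟩ | ⟨ha, rfl⟩ | ⟨ha, rfl⟩⟩ | ⟨rfl, ha, rfl⟩
    · rw [ha] at hty
      obtain ⟨rfl, rfl⟩ := hprime 5 (by norm_num) ha
      have hy' : y = 17 := by omega
      subst hy'
      have := fin_x x 99 _ _ _ heq (by norm_num)
      subst this; simp
    · rw [ha] at hty
      obtain ⟨rfl, rfl⟩ := hprime 19 (by norm_num) ha
      have hy' : y = 241 := by omega
      subst hy'
      have := fin_x x 5291 _ _ _ heq (by norm_num)
      subst this; simp
    · rw [ha] at hty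
      obtain ⟨rfl, rfl⟩ := hprime 71 (by norm_num) ha
      have hy' : y = 3361 := by omega
      subst hy'
      have := fin_x x 275561 _ _ _ heq (by norm_num)
      subst this; simp
    · rw [ha] at hty
      obtain ⟨rfl, rfl⟩ := hprime 3 (by norm_num) ha
      have hy' : y = 5 := by omega
      subst hy'
      have := fin_x x 79 _ _ _ heq (by norm_num)
      subst this; simp
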